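/- arXiv:1404.7793 — 12 statements merged into one kernel-verified Lean document; each statement's English description precedes it below -/
import Mathlib

section
/- Let q be a prime power, let n, r be positive integers, and for 1 ≤ i ≤ r let P_i ∈ 𝔽_q[t_1,…,t_n] be a nonzero polynomial of degree d_i, with d := d_1 + … + d_r < n. Let Z = {x ∈ 𝔽_q^n : P_1(x) = … = P_r(x) = 0} and z = #Z. Then z = 0 or z ≥ q^{n−d}. -/
open MvPolynomial in
/-- Every polynomial over a finite field agrees as a function with a reduced polynomial whose
total degree is not larger. -/
theorem MvPolynomial.exists_degreeOf_le_eval_eq {σ F : Type*} [Field F] [Fintype F]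
    (p : MvPolynomial σ F) :
    ∃ r : MvPolynomial σ F, (∀ i, r.degreeOf i ≤ Fintype.card F - 1) ∧
      r.totalDegree ≤ p.totalDegree ∧ ∀ x, eval x r = eval x p := by
  classical
  have hq : 1 < Fintype.card F := Fintype.one_lt_card
  have hred (k : ℕ) : ∃ l, l ≤ k ∧ l ≤ Fintype.card F - 1 ∧ ∀ a : F, a ^ l = a ^ k := by
    induction k using Nat.strong_induction_on with
    | _ k ih =>
      by_cases hk : k ≤ Fintype.card F - 1
      · exact ⟨k, le_rfl, hk, fun _ => rfl⟩
      · obtain ⟨l, hl, hl', h⟩ := ih (k - (Fintype.card F - 1)) (by omega)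
        refine ⟨l, by omega, hl', fun a => ?_⟩
        rw [h]
        have h1 : k - (Fintype.card F - 1) = (k - Fintype.card F) + 1 := by omega
        have h2 : k = (k - Fintype.card F) + Fintype.card F := by omega
        conv_rhs => rw [h2, pow_add, FiniteField.pow_card]
        rw [h1, pow_succ]
  choose ρ hρ hρ' hpow using hred
  have hρ0 : ρ 0 = 0 := Nat.le_zero.mp (hρ 0)
  refine ⟨∑ d ∈ p.support, monomial (d.mapRange ρ hρ0) (coeff d p), fun i => ?_, ?_, fun x => ?_⟩
  · refine (degreeOf_sum_le i _ _).trans (Finset.sup_le fun d hd => ?_)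
    rw [degreeOf_monomial_eq _ _ (mem_support_iff.mp hd)]
    exact hρ' _
  · refine totalDegree_finsetSum_le fun d hd => ?_
    refine (totalDegree_monomial_le _ _).trans (le_trans ?_ (le_totalDegree hd))
    change (d.mapRange ρ hρ0).degree ≤ d.degree
    exact Finsupp.degree_mono fun i => hρ _
  · conv_rhs => rw [p.as_sum]
    simp only [map_sum, eval_monomial]
    refine Finset.sum_congr rfl fun d _ => ?_
    rw [Finsupp.prod_mapRange_index (by simp)]
    simp [hpow]

/-- A form of Bernoulli's inequality. -/
theorem Nat.succ_pow_le_succ_pow_of_le {b m : ℕ} (h : b ≤ m) : (m + 1) ^ b ≤ (b + 1) ^ m := by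
  rcases Nat.eq_zero_or_pos b with rfl | hb
  · simp
  have hb' : (0 : ℝ) < b := by exact_mod_cast hb
  have key : 1 + (m / b : ℝ) * b ≤ (1 + (b : ℝ)) ^ (m / b : ℝ) :=
    one_add_mul_self_le_rpow_one_add (by linarith)
      ((one_le_div hb').mpr (by exact_mod_cast h))
  rw [div_mul_cancel₀ _ hb'.ne'] at key
  have := pow_le_pow_left₀ (by positivity) key b
  rw [← Real.rpow_mul_natCast (by positivity), div_mul_cancel₀ _ hb'.ne', Real.rpow_natCast] at this
  rw [add_comm m, add_comm b]
  exact_mod_cast this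

open MvPolynomial in
/-- A lower bound for the number of points where a nonzero reduced polynomial over a finite field
does not vanish. -/
theorem MvPolynomial.card_pow_le_card_eval_ne_zero_pow_mul {F : Type*} [Field F] [Fintype F]
    [DecidableEq F] {n : ℕ} (p : MvPolynomial (Fin n) F) (hp : p ≠ 0)
    (hred : ∀ i, p.degreeOf i ≤ Fintype.card F - 1) :
    Fintype.card F ^ (n * (Fintype.card F - 1)) ≤
      (Finset.univ.filter fun x : Fin n → F => eval x p ≠ 0).card ^ (Fintype.card F - 1) *
        Fintype.card F ^ p.totalDegree := by
  have hq : 1 < Fintype.card F := Fintype.one_lt_card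
  induction n with
  | zero =>
    obtain ⟨c, rfl⟩ := C_surjective (Fin 0) p
    have hc : c ≠ 0 := by rintro rfl; simp at hp
    simp [hc]
  | succ n ih =>
    set f := finSuccEquiv F n p with hf
    have hf0 : f ≠ 0 := by simpa [hf] using hp
    set k := f.natDegree with hk
    have hkq : k ≤ Fintype.card F - 1 := by
      rw [hk, hf, natDegree_finSuccEquiv]; exact hred 0
    have hlead : f.coeff k ≠ 0 := Polynomial.leadingCoeff_ne_zero.mpr hf0
    have hdeg : (f.coeff k).totalDegree + k ≤ p.totalDegree :=
      totalDegree_coeff_finSuccEquiv_add_le p k hlead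
    have hind := ih (f.coeff k) hlead fun i =>
      (degreeOf_coeff_finSuccEquiv p i k).trans (hred i.succ)
    set T := Finset.univ.filter fun y : Fin n → F => eval y (f.coeff k) ≠ 0 with hT
    set S := Finset.univ.filter fun x : Fin (n + 1) → F => eval x p ≠ 0 with hS
    have hfib (y : Fin n → F) (hy : y ∈ T) : Fintype.card F - k ≤
        (Finset.univ.filter fun a : F => eval (Fin.cons a y : Fin (n + 1) → F) p ≠ 0).card := by
      set g := f.map (eval y) with hg
      have hgk : g.coeff k ≠ 0 := by simpa [hg, hT] using hy
      have hg0 : g ≠ 0 := by rintro h; simp [h] at hgk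
      have hroots : g.roots.toFinset.card ≤ k :=
        (Multiset.toFinset_card_le _).trans
          ((Polynomial.card_roots' g).trans Polynomial.natDegree_map_le)
      have hcompl : (Finset.univ.filter fun a : F =>
          eval (Fin.cons a y : Fin (n + 1) → F) p ≠ 0) = g.roots.toFinsetᶜ := by
        ext a
        simp [eval_eq_eval_mv_eval', ← hf, ← hg, hg0]
      rw [hcompl, Finset.card_compl]
      omega
    have hST : T.card * (Fintype.card F - k) ≤ S.card := by
      calc T.card * (Fintype.card F - k)
          ≤ ∑ y ∈ T, (Finset.univ.filter fun a : F =>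
              eval (Fin.cons a y : Fin (n + 1) → F) p ≠ 0).card := by
            rw [← smul_eq_mul]; exact Finset.card_nsmul_le_sum _ _ _ hfib
        _ = (T.sigma fun y => Finset.univ.filter fun a : F =>
              eval (Fin.cons a y : Fin (n + 1) → F) p ≠ 0).card := (Finset.card_sigma _ _).symm
        _ ≤ S.card := by
            refine Finset.card_le_card_of_injOn (fun z => (Fin.cons z.2 z.1 : Fin (n + 1) → F))
              (fun z hz => ?_) (fun z _ w _ h => ?_)
            · simp only [Finset.coe_sigma, Set.mem_sigma_iff, Finset.coe_filter] at hz
              simpa [hS] using hz.2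
            · obtain ⟨h1, h2⟩ := Fin.cons_inj.mp h
              exact Sigma.ext h2 (heq_of_eq h1)
    have hbern : Fintype.card F ^ (Fintype.card F - 1) ≤
        (Fintype.card F - k) ^ (Fintype.card F - 1) * Fintype.card F ^ k := by
      have h := Nat.succ_pow_le_succ_pow_of_le (Nat.sub_le (Fintype.card F - 1) k)
      rw [show Fintype.card F - 1 + 1 = Fintype.card F by omega,
        show Fintype.card F - 1 - k + 1 = Fintype.card F - k by omega] at h
      calc Fintype.card F ^ (Fintype.card F - 1)
          = Fintype.card F ^ (Fintype.card F - 1 - k) * Fintype.card F ^ k := by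
            rw [← pow_add]; congr 1; omega
        _ ≤ _ := Nat.mul_le_mul_right _ h
    calc Fintype.card F ^ ((n + 1) * (Fintype.card F - 1))
        = Fintype.card F ^ (n * (Fintype.card F - 1)) *
            Fintype.card F ^ (Fintype.card F - 1) := by rw [← pow_add]; ring_nf
      _ ≤ (T.card ^ (Fintype.card F - 1) * Fintype.card F ^ (f.coeff k).totalDegree) *
            ((Fintype.card F - k) ^ (Fintype.card F - 1) * Fintype.card F ^ k) :=
          Nat.mul_le_mul hind hbern
      _ = (T.card * (Fintype.card F - k)) ^ (Fintype.card F - 1) *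
            Fintype.card F ^ ((f.coeff k).totalDegree + k) := by rw [mul_pow, pow_add]; ring
      _ ≤ S.card ^ (Fintype.card F - 1) * Fintype.card F ^ p.totalDegree :=
          Nat.mul_le_mul (Nat.pow_le_pow_left hST _) (Nat.pow_le_pow_right (by omega) hdeg)

open MvPolynomial in
/-- Over a finite field with `q` elements, the common zero locus of finitely many polynomials is
the non-vanishing locus of a polynomial whose total degree is at most `q - 1` times the sum of
their total degrees. -/
theorem MvPolynomial.exists_eval_ne_zero_iff_forall_eval_eq_zero {σ ι F : Type*} [Field F]
    [Fintype F] [Fintype ι] (P : ι → MvPolynomial σ F) :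
    ∃ f : MvPolynomial σ F, f.totalDegree ≤ (Fintype.card F - 1) * ∑ i, (P i).totalDegree ∧
      ∀ x, eval x f ≠ 0 ↔ ∀ i, eval x (P i) = 0 := by
  have hq : 1 < Fintype.card F := Fintype.one_lt_card
  refine ⟨∏ i, (1 - P i ^ (Fintype.card F - 1)), ?_, fun x => ?_⟩
  · rw [Finset.mul_sum]
    refine (totalDegree_finsetProd _ _).trans (Finset.sum_le_sum fun i _ => ?_)
    refine (totalDegree_sub _ _).trans (max_le (by simp) (totalDegree_pow _ _))
  · simp only [map_prod, map_sub, map_one, map_pow, Finset.prod_ne_zero_iff, Finset.mem_univ,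
      true_imp_iff]
    refine forall_congr' fun i => ⟨fun h => ?_, fun h => ?_⟩
    · by_contra h0
      exact h (by rw [FiniteField.pow_card_sub_one_eq_one _ h0, sub_self])
    · rw [h, zero_pow (by omega), sub_zero]
      exact one_ne_zero

/-- **Warning's Second Theorem**: over a finite field `F` with `q` elements, if
`P₁, …, P_r` are nonzero polynomials in `n` variables with total degrees summing to
`d < n`, then the number `z` of common zeros satisfies `z = 0` or `z ≥ q^(n-d)`. -/
theorem warning_second_theorem
    {F : Type*} [Field F] [Fintype F]
    (n r : ℕ) (hn : 0 < n) (hr : 0 < r)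
    (P : Fin r → MvPolynomial (Fin n) F)
    (hP : ∀ i, P i ≠ 0)
    (hd : ∑ i, (P i).totalDegree < n) :
    Set.ncard {x : Fin n → F | ∀ i, MvPolynomial.eval x (P i) = 0} = 0 ∨
      Fintype.card F ^ (n - ∑ i, (P i).totalDegree) ≤
        Set.ncard {x : Fin n → F | ∀ i, MvPolynomial.eval x (P i) = 0} := by
  classical
  have hq : 1 < Fintype.card F := Fintype.one_lt_card
  rw [or_iff_not_imp_left]
  intro hz
  obtain ⟨x₀, hx₀⟩ := Set.nonempty_of_ncard_ne_zero hz
  obtain ⟨f, hfdeg, hf⟩ := MvPolynomial.exists_eval_ne_zero_iff_forall_eval_eq_zero P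
  obtain ⟨g, hgred, hgdeg, hg⟩ := f.exists_degreeOf_le_eval_eq
  have hg0 : g ≠ 0 := by
    rintro rfl
    exact (hf x₀).mpr hx₀ (by rw [← hg, map_zero])
  have hcard : Set.ncard {x : Fin n → F | ∀ i, MvPolynomial.eval x (P i) = 0} =
      (Finset.univ.filter fun x : Fin n → F => MvPolynomial.eval x g ≠ 0).card := by
    rw [← Set.ncard_coe_finset]
    congr 1
    ext x
    simp [hg, ← hf]
  have key := g.card_pow_le_card_eval_ne_zero_pow_mul hg0 hgred
  rw [← hcard] at key
  set d := ∑ i, (P i).totalDegree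
  refine le_of_pow_le_pow_left₀ (n := Fintype.card F - 1) (by omega) (Nat.zero_le _) ?_
  refine Nat.le_of_mul_le_mul_right (c := Fintype.card F ^ ((Fintype.card F - 1) * d)) ?_
    (by positivity)
  calc (Fintype.card F ^ (n - d)) ^ (Fintype.card F - 1) *
        Fintype.card F ^ ((Fintype.card F - 1) * d)
      = Fintype.card F ^ (n * (Fintype.card F - 1)) := by
        rw [← pow_mul, ← pow_add, mul_comm _ d, ← add_mul, Nat.sub_add_cancel hd.le]
    _ ≤ _ := key
    _ ≤ _ := Nat.mul_le_mul_left _ (Nat.pow_le_pow_right (by omega) (hgdeg.trans hfdeg))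
end

section
/- Let p be a prime, let n, r be positive integers, and let v_1,…,v_r be positive integers. For 1 ≤ j ≤ r let P_j ∈ ℤ[t_1,…,t_n] be a polynomial with zero constant term. If Σ_{j=1}^r deg(P_j)·(p^{v_j}−1)/(p−1) < n, then there exists x ∈ ℤ^n with not all coordinates divisible by p such that P_j(x) ≡ 0 (mod p^{v_j}) for all 1 ≤ j ≤ r. -/
open MvPolynomial in
/-- A function `h : 𝔽_pⁿ → ℕ` has binomial degree at most `d` if, modulo `p`, every binomial
coefficient `(h a).choose k` is a polynomial function of `a` of degree at most `d * k`. -/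
def HasBinomDegreeLE (p : ℕ) {σ : Type*} (d : ℕ) (h : (σ → ZMod p) → ℕ) : Prop :=
  ∀ k, ∃ G : MvPolynomial σ (ZMod p), G.totalDegree ≤ d * k ∧
    ∀ a, eval a G = ((h a).choose k : ZMod p)

namespace HasBinomDegreeLE

variable {p : ℕ} {σ : Type*} {d : ℕ}

theorem const (c : ℕ) : HasBinomDegreeLE p d (fun _ : σ → ZMod p => c) := fun k =>
  ⟨MvPolynomial.C (c.choose k : ZMod p), by
    rw [MvPolynomial.totalDegree_C]
    exact Nat.zero_le _, fun a => by simp⟩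

theorem add {g h : (σ → ZMod p) → ℕ} (hg : HasBinomDegreeLE p d g)
    (hh : HasBinomDegreeLE p d h) : HasBinomDegreeLE p d (fun a => g a + h a) := by
  intro k
  choose G hG hG' using hg
  choose H hH hH' using hh
  refine ⟨∑ ij ∈ Finset.HasAntidiagonal.antidiagonal k, G ij.1 * H ij.2, ?_, fun a => ?_⟩
  · refine MvPolynomial.totalDegree_finsetSum_le fun ij hij => ?_
    rw [← Finset.HasAntidiagonal.mem_antidiagonal.1 hij, mul_add]
    exact (MvPolynomial.totalDegree_mul _ _).trans (add_le_add (hG _) (hH _))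
  · simp [Nat.add_choose_eq, hG', hH']

theorem const_mul {h : (σ → ZMod p) → ℕ} (hh : HasBinomDegreeLE p d h) (c : ℕ) :
    HasBinomDegreeLE p d (fun a => c * h a) := by
  induction c with
  | zero => simpa using const 0
  | succ c ih => simpa only [add_mul, one_mul] using ih.add hh

theorem sum {ι : Type*} (s : Finset ι) {h : ι → (σ → ZMod p) → ℕ}
    (hh : ∀ i ∈ s, HasBinomDegreeLE p d (h i)) :
    HasBinomDegreeLE p d (fun a => ∑ i ∈ s, h i a) := by
  classical
  induction s using Finset.induction_on with
  | empty => simpa using const 0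
  | insert i s hi ih =>
    simp only [Finset.sum_insert hi]
    exact (hh i (by simp)).add (ih fun j hj => hh j (by simp [hj]))

end HasBinomDegreeLE

/-- Modulo `p`, the function `(t b).choose k` of `b : 𝔽_p` is polynomial of degree at most `k`
whenever `t b` reduces to `b`. -/
theorem ZMod.exists_polynomial_eval_eq_choose {p : ℕ} [Fact p.Prime] {t : ZMod p → ℕ}
    (ht : ∀ b, (t b : ZMod p) = b) (k : ℕ) :
    ∃ f : Polynomial (ZMod p), f.natDegree ≤ k ∧
      ∀ b, f.eval b = ((t b).choose k : ZMod p) := by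
  rcases lt_or_ge k p with hk | hk
  · have hk0 : (k.factorial : ZMod p) ≠ 0 := by
      rw [Ne, ZMod.natCast_eq_zero_iff, (Fact.out : p.Prime).dvd_factorial]
      omega
    refine ⟨Polynomial.C (k.factorial : ZMod p)⁻¹ * descPochhammer (ZMod p) k, ?_, fun b => ?_⟩
    · exact (Polynomial.natDegree_C_mul_le _ _).trans (descPochhammer_natDegree _ k).le
    · rw [Polynomial.eval_mul, Polynomial.eval_C]
      conv_lhs => rw [← ht b]
      rw [descPochhammer_eval_eq_descFactorial, Nat.descFactorial_eq_factorial_mul_choose,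
        Nat.cast_mul, inv_mul_cancel_left₀ hk0]
  · refine ⟨Lagrange.interpolate Finset.univ id fun b => ((t b).choose k : ZMod p), ?_,
      fun b => Lagrange.eval_interpolate_at_node _ (Function.injective_id.injOn)
        (Finset.mem_univ b)⟩
    refine Polynomial.natDegree_le_of_degree_le ?_
    refine (Lagrange.degree_interpolate_lt _ Function.injective_id.injOn).le.trans ?_
    simpa [ZMod.card] using hk

theorem MvPolynomial.totalDegree_aeval_le {R σ : Type*} [CommSemiring R] (f : Polynomial R)
    (g : MvPolynomial σ R) :
    (Polynomial.aeval g f).totalDegree ≤ f.natDegree * g.totalDegree := by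
  rw [Polynomial.aeval_eq_sum_range]
  refine MvPolynomial.totalDegree_finsetSum_le fun i hi => ?_
  refine (MvPolynomial.totalDegree_smul_le _ _).trans
    ((MvPolynomial.totalDegree_pow _ _).trans (Nat.mul_le_mul_right _ ?_))
  simpa [Nat.lt_succ_iff] using hi

theorem HasBinomDegreeLE.comp_eval {p : ℕ} [Fact p.Prime] {σ : Type*} {t : ZMod p → ℕ}
    (ht : ∀ b, (t b : ZMod p) = b) {d : ℕ} {M : MvPolynomial σ (ZMod p)}
    (hM : M.totalDegree ≤ d) : HasBinomDegreeLE p d (fun a => t (MvPolynomial.eval a M)) := by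
  intro k
  obtain ⟨f, hf, hf'⟩ := ZMod.exists_polynomial_eval_eq_choose ht k
  refine ⟨Polynomial.aeval M f, ?_, fun a => ?_⟩
  · rw [mul_comm]
    exact (MvPolynomial.totalDegree_aeval_le f M).trans (Nat.mul_le_mul hf hM)
  · rw [← hf', ← MvPolynomial.coe_aeval_eq_eval, RingHom.coe_coe,
      ← Polynomial.aeval_algHom_apply, Polynomial.coe_aeval_eq_eval]

/-- Modulo `p`, the binomial coefficient `(m + (p ^ v - 1)).choose (p ^ v - 1)` is the indicator
of `p ^ v ∣ m`. -/
theorem ZMod.cast_add_choose_prime_pow_sub_one {p : ℕ} [Fact p.Prime] (v m : ℕ) :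
    ((m + (p ^ v - 1)).choose (p ^ v - 1) : ZMod p) = if p ^ v ∣ m then 1 else 0 := by
  have hpos : 0 < p ^ v := pow_pos (Fact.out : p.Prime).pos v
  set q := p ^ v with hq
  have key (s r : ℕ) : ((q * s + r).choose (q - 1) : ZMod p) = (r.choose (q - 1) : ZMod p) := by
    induction s with
    | zero => simp
    | succ s ih =>
      rw [← ih, show q * (s + 1) + r = q + (q * s + r) by ring, Nat.add_choose_eq]
      push_cast
      rw [Finset.sum_eq_single (0, q - 1)]
      · simp
      · rintro ⟨i, j⟩ hij hne
        rw [Finset.HasAntidiagonal.mem_antidiagonal] at hij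
        have hi : i ≠ 0 := by
          rintro rfl
          exact hne (by simp_all)
        have : ((q.choose i : ℕ) : ZMod p) = 0 := by
          rw [ZMod.natCast_eq_zero_iff]
          exact (Fact.out : p.Prime).dvd_choose_pow hi (by simp only at hij; omega)
        simp [this]
      · simp
  split_ifs with h
  · obtain ⟨s, rfl⟩ := h
    simp [key]
  · have hm : m % q ≠ 0 := fun h' => h (Nat.dvd_of_mod_eq_zero h')
    have hlt := Nat.mod_lt m hpos
    have : m + (q - 1) = q * (m / q + 1) + (m % q - 1) := by
      have := Nat.div_add_mod m q
      rw [mul_add]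
      omega
    rw [this, key, Nat.choose_eq_zero_of_lt (by omega), Nat.cast_zero]

/-- A multiplicative section of reduction modulo `p`, correct modulo `p ^ (V + 1)`. -/
def teichmullerLift (p V : ℕ) (b : ZMod p) : ℕ := b.val ^ p ^ V

section teichmullerLift

variable {p : ℕ} [Fact p.Prime] {V v : ℕ}

theorem teichmullerLift_zero : teichmullerLift p V 0 = 0 := by
  simp [teichmullerLift, (Fact.out : p.Prime).ne_zero]

theorem natCast_teichmullerLift (b : ZMod p) : (teichmullerLift p V b : ZMod p) = b := by
  simp [teichmullerLift, ZMod.pow_card_pow]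

theorem teichmullerLift_mul (hv : v ≤ V) (b c : ZMod p) :
    (teichmullerLift p V (b * c) : ZMod (p ^ v)) =
      teichmullerLift p V b * teichmullerLift p V c := by
  have h : (p : ℤ) ∣ ((b * c).val : ℤ) - (b.val : ℤ) * c.val := by
    rw [← ZMod.intCast_zmod_eq_zero_iff_dvd]
    simp
  have h' := dvd_sub_pow_of_dvd_sub h V
  have h'' : ((p ^ v : ℕ) : ℤ) ∣ ((b * c).val : ℤ) ^ p ^ V - ((b.val : ℤ) * c.val) ^ p ^ V := by
    push_cast
    exact (pow_dvd_pow _ (by omega)).trans h'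
  rw [← ZMod.intCast_zmod_eq_zero_iff_dvd] at h''
  push_cast at h''
  simpa [teichmullerLift, mul_pow] using sub_eq_zero.1 h''

/-- `teichmullerLift` as a homomorphism to `ℤ/p^v`. -/
def teichmullerLiftHom (hv : v ≤ V) : ZMod p →* ZMod (p ^ v) where
  toFun b := teichmullerLift p V b
  map_one' := by
    have : Fact (1 < p) := ⟨(Fact.out : p.Prime).one_lt⟩
    simp [teichmullerLift, ZMod.val_one]
  map_mul' := teichmullerLift_mul hv

theorem exists_hasBinomDegreeLE_natCast_eq {σ : Type*} (hv : v ≤ V) (P : MvPolynomial σ ℤ) :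
    ∃ h : (σ → ZMod p) → ℕ, HasBinomDegreeLE p P.totalDegree h ∧
      ∀ a, (h a : ZMod (p ^ v)) =
        (MvPolynomial.eval (fun i => (teichmullerLift p V (a i) : ℤ)) P : ℤ) := by
  have : NeZero (p ^ v) := ⟨pow_ne_zero _ (Fact.out : p.Prime).ne_zero⟩
  refine ⟨fun a => ∑ m ∈ P.support, ((P.coeff m : ℤ) : ZMod (p ^ v)).val *
    teichmullerLift p V (MvPolynomial.eval a (MvPolynomial.monomial m 1)), ?_, fun a => ?_⟩
  · refine .sum _ fun m hm => .const_mul (.comp_eval natCast_teichmullerLift ?_) _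
    exact (MvPolynomial.totalDegree_monomial_le _ _).trans (MvPolynomial.le_totalDegree hm)
  · have hτ (b : ZMod p) : (teichmullerLift p V b : ZMod (p ^ v)) = teichmullerLiftHom hv b := rfl
    simp only [MvPolynomial.eval_monomial]
    simp [MvPolynomial.eval_eq, Finsupp.prod, hτ]

end teichmullerLift

/-- **Schanuel's Theorem, part a)**: if `P₁, …, P_r ∈ ℤ[t₁,…,t_n]` have zero constant
term and `∑_j deg(P_j)·(p^{v_j}-1)/(p-1) < n`, then there is `x ∈ ℤⁿ` with not all
coordinates divisible by `p` such that `P_j(x) ≡ 0 (mod p^{v_j})` for all `j`. -/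
theorem schanuel_theorem_a
    (p : ℕ) (hp : p.Prime) (n r : ℕ) (hn : 0 < n) (hr : 0 < r)
    (v : Fin r → ℕ) (hv : ∀ j, 0 < v j)
    (P : Fin r → MvPolynomial (Fin n) ℤ)
    (hP0 : ∀ j, MvPolynomial.eval (0 : Fin n → ℤ) (P j) = 0)
    (hdeg : ∑ j, (P j).totalDegree * ((p ^ v j - 1) / (p - 1)) < n) :
    ∃ x : Fin n → ℤ, (¬ ∀ i, (p : ℤ) ∣ x i) ∧
      ∀ j, ((p : ℤ) ^ v j) ∣ MvPolynomial.eval x (P j) := by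
  have : Fact p.Prime := ⟨hp⟩
  set V := ∑ j, v j
  have hvV (j : Fin r) : v j ≤ V := Finset.single_le_sum (fun _ _ => Nat.zero_le _)
    (Finset.mem_univ j)
  choose h hh hcast using fun j => exists_hasBinomDegreeLE_natCast_eq (p := p) (hvV j) (P j)
  have hdvd (j : Fin r) (a : Fin n → ZMod p) : p ^ v j ∣ h j a ↔
      (p : ℤ) ^ v j ∣ MvPolynomial.eval (fun i => (teichmullerLift p V (a i) : ℤ)) (P j) := by
    rw [← ZMod.natCast_eq_zero_iff, hcast, ZMod.intCast_zmod_eq_zero_iff_dvd, Nat.cast_pow]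
  choose G hG hG' using fun j =>
    (hh j).add (HasBinomDegreeLE.const (p ^ v j - 1)) (p ^ v j - 1)
  simp only [ZMod.cast_add_choose_prime_pow_sub_one, hdvd] at hG'
  have hsum : ∑ a, MvPolynomial.eval a (∏ j, G j) = 0 := by
    refine MvPolynomial.sum_eval_eq_zero _ ?_
    rw [ZMod.card, Fintype.card_fin]
    calc (∏ j, G j).totalDegree ≤ ∑ j, (P j).totalDegree * (p ^ v j - 1) :=
          (MvPolynomial.totalDegree_finsetProd _ _).trans (Finset.sum_le_sum fun j _ => hG j)
      _ = (p - 1) * ∑ j, (P j).totalDegree * ((p ^ v j - 1) / (p - 1)) := by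
          rw [Finset.mul_sum]
          refine Finset.sum_congr rfl fun j _ => ?_
          rw [mul_left_comm, Nat.mul_div_cancel' (by simpa using Nat.sub_dvd_pow_sub_pow p 1 (v j))]
      _ < (p - 1) * n := Nat.mul_lt_mul_of_pos_left hdeg (Nat.sub_pos_of_lt hp.one_lt)
  by_contra! hno
  rw [Finset.sum_eq_single 0] at hsum
  · have hzero : (fun _ : Fin n => ((teichmullerLift p V 0 : ℕ) : ℤ)) = 0 := by
      ext
      simp [teichmullerLift_zero]
    simp only [map_prod, hG', Pi.zero_apply, hzero, hP0, dvd_zero, if_true, Finset.prod_const_one,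
      one_ne_zero] at hsum
  · intro a _ ha
    obtain ⟨i, hi⟩ := Function.ne_iff.1 ha
    obtain ⟨j, hj⟩ := hno (fun i => (teichmullerLift p V (a i) : ℤ)) (by
      refine ⟨i, ?_⟩
      rw [← ZMod.intCast_zmod_eq_zero_iff_dvd, Int.cast_natCast, natCast_teichmullerLift]
      exact hi)
    rw [map_prod]
    exact Finset.prod_eq_zero (Finset.mem_univ j) (by rw [hG', if_neg hj])
  · simp
end

section
/- Let q be a prime power, let n, r be positive integers, and let P_1,…,P_r ∈ 𝔽_q[t_1,…,t_n]. For 1 ≤ i ≤ n let A_i be a nonempty subset of 𝔽_q, and put A = Π_{i=1}^n A_i. Let Z_A = {a ∈ A : P_1(a) = … = P_r(a) = 0} and z_A = #Z_A. If Σ_{i=1}^r (q−1)·deg(P_i) < Σ_{i=1}^n (#A_i − 1), then z_A ≠ 1. -/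
open MvPolynomial in
/-- A product of linear factors `X i - c`, with `c` ranging over `S i`, has top coefficient `1`. -/
theorem coeff_prod_prod_X_sub_C {R σ : Type*} [CommRing R] [IsDomain R] [Fintype σ]
    (S : σ → Finset R) :
    (∏ i, ∏ c ∈ S i, (X i - C c : MvPolynomial σ R)).coeff
      (∑ i, Finsupp.single i (S i).card) = 1 := by
  let _ : LinearOrder σ := WellOrderingRel.isWellOrder.linearOrder
  let m : MonomialOrder σ := MonomialOrder.lex
  have hmon : ∀ i, m.Monic (∏ c ∈ S i, (X i - C c : MvPolynomial σ R)) := fun i ↦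
    MonomialOrder.Monic.prod fun c _ ↦ m.monic_X_sub_C i c
  have hdeg : m.degree (∏ i, ∏ c ∈ S i, (X i - C c : MvPolynomial σ R)) =
      ∑ i, Finsupp.single i (S i).card := by
    rw [MonomialOrder.degree_prod fun i _ ↦ (hmon i).ne_zero]
    refine Finset.sum_congr rfl fun i _ ↦ ?_
    rw [MonomialOrder.degree_prod fun c _ ↦ (m.monic_X_sub_C i c).ne_zero]
    simp [m.degree_X_sub_C]
  rw [← hdeg]
  exact MonomialOrder.Monic.prod fun i _ ↦ hmon i

open MvPolynomial in
theorem totalDegree_prod_prod_X_sub_C_le {R σ : Type*} [CommRing R] [Nontrivial R] [Fintype σ]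
    (S : σ → Finset R) :
    (∏ i, ∏ c ∈ S i, (X i - C c : MvPolynomial σ R)).totalDegree ≤ ∑ i, (S i).card := by
  refine (totalDegree_finsetProd _ _).trans (Finset.sum_le_sum fun i _ ↦ ?_)
  refine (totalDegree_finsetProd _ _).trans ?_
  refine (Finset.sum_le_card_nsmul _ _ 1 fun c _ ↦ ?_).trans (by simp)
  exact (totalDegree_sub_C_le _ _).trans (totalDegree_X i).le

open MvPolynomial in
/-- A polynomial which is nonzero at exactly one point of a finite grid `∏ A i` has total degree
at least `∑ (#(A i) - 1)`. -/
theorem sum_card_sub_one_le_totalDegree {R σ : Type*} [Field R] [Fintype σ]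
    (A : σ → Finset R) (f : MvPolynomial σ R) (a : σ → R) (ha : ∀ i, a i ∈ A i)
    (hfa : eval a f ≠ 0) (hf : ∀ x, (∀ i, x i ∈ A i) → x ≠ a → eval x f = 0) :
    ∑ i, ((A i).card - 1) ≤ f.totalDegree := by
  classical
  by_contra! hlt
  let S : σ → Finset R := fun i ↦ (A i).erase (a i)
  have hS : ∀ i, (S i).card = (A i).card - 1 := fun i ↦ Finset.card_erase_of_mem (ha i)
  let g : MvPolynomial σ R := ∏ i, ∏ c ∈ S i, (X i - C c)
  let t : σ →₀ ℕ := ∑ i, Finsupp.single i (S i).card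
  have htdeg : t.degree = ∑ i, ((A i).card - 1) := by
    simp only [t, map_sum, Finsupp.degree_single, hS]
  have hti : ∀ i, t i = (S i).card := fun i ↦ by
    simp [t, Finsupp.finsetSum_apply, Finsupp.single_apply]
  have hgdeg : g.totalDegree ≤ t.degree := by
    simpa [htdeg, hS] using totalDegree_prod_prod_X_sub_C_le S
  have hgt : g.coeff t = 1 := coeff_prod_prod_X_sub_C S
  have hft : f.coeff t = 0 := coeff_eq_zero_of_totalDegree_lt (by
    rw [← htdeg] at hlt
    exact hlt)
  have hga : eval a g ≠ 0 := by
    simp only [g, map_prod, map_sub, eval_X, eval_C]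
    refine Finset.prod_ne_zero_iff.2 fun i _ ↦ Finset.prod_ne_zero_iff.2 fun c hc ↦ ?_
    exact sub_ne_zero.2 (Finset.ne_of_mem_erase hc).symm
  have hgx : ∀ x, (∀ i, x i ∈ A i) → x ≠ a → eval x g = 0 := fun x hx hxa ↦ by
    obtain ⟨i, hi⟩ := Function.ne_iff.1 hxa
    simp only [g, map_prod, map_sub, eval_X, eval_C]
    exact Finset.prod_eq_zero (Finset.mem_univ i)
      (Finset.prod_eq_zero (Finset.mem_erase.2 ⟨hi, hx i⟩) (sub_self _))
  let h : MvPolynomial σ R := C (eval a g) * f - C (eval a f) * g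
  have hht : h.coeff t ≠ 0 := by simpa [h, coeff_C_mul, hft, hgt] using hfa
  have hhdeg : h.totalDegree = t.degree := by
    refine le_antisymm ((totalDegree_sub _ _).trans (max_le ?_ ?_))
      (le_totalDegree (mem_support_iff.2 hht))
    · refine (totalDegree_mul _ _).trans ?_
      simpa [htdeg] using hlt.le
    · refine (totalDegree_mul _ _).trans ?_
      simpa using hgdeg
  obtain ⟨x, hxA, hx⟩ := combinatorial_nullstellensatz_exists_eval_nonzero h t hht hhdeg A
    fun i ↦ by
      rw [hti i]
      exact Finset.card_erase_lt_of_mem (ha i)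
  apply hx
  by_cases hxa : x = a
  · simp [h, hxa, mul_comm]
  · simp [h, hf x hxA hxa, hgx x hxA hxa]



/-- **Restricted Variable Chevalley Theorem** (Schauz, Brink): over a finite field `F`
with `q` elements, if `∑_j (q-1)·deg(P_j) < ∑_i (#A_i - 1)` then the number of common
zeros of `P₁,…,P_r` on `A = ∏ A_i` is not `1`. -/
theorem restricted_variable_chevalley
    {F : Type*} [Field F] [Fintype F]
    (n r : ℕ) (hn : 0 < n) (hr : 0 < r)
    (P : Fin r → MvPolynomial (Fin n) F)
    (A : Fin n → Finset F) (hA : ∀ i, (A i).Nonempty)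
    (hdeg : ∑ j, (Fintype.card F - 1) * (P j).totalDegree < ∑ i, ((A i).card - 1)) :
    Set.ncard {x : Fin n → F | (∀ i, x i ∈ A i) ∧
      ∀ j, MvPolynomial.eval x (P j) = 0} ≠ 1 := by
  intro hcard
  obtain ⟨a, ha⟩ := Set.ncard_eq_one.1 hcard
  obtain ⟨haA, haP⟩ : a ∈ {x : Fin n → F | (∀ i, x i ∈ A i) ∧
      ∀ j, MvPolynomial.eval x (P j) = 0} := ha ▸ Set.mem_singleton a
  have hq : Fintype.card F - 1 ≠ 0 := (Nat.sub_pos_of_lt Fintype.one_lt_card).ne'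
  let f : MvPolynomial (Fin n) F := ∏ j, (1 - P j ^ (Fintype.card F - 1))
  have hfdeg : f.totalDegree ≤ ∑ j, (Fintype.card F - 1) * (P j).totalDegree := by
    refine (MvPolynomial.totalDegree_finsetProd _ _).trans (Finset.sum_le_sum fun j _ ↦ ?_)
    refine (MvPolynomial.totalDegree_sub _ _).trans ?_
    simpa using MvPolynomial.totalDegree_pow (P j) (Fintype.card F - 1)
  refine (hfdeg.trans_lt hdeg).not_ge (sum_card_sub_one_le_totalDegree A f a haA ?_ ?_)
  · simp [f, map_prod, haP, hq]
  · intro x hx hxa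
    have hxP : ∃ j, MvPolynomial.eval x (P j) ≠ 0 := by
      by_contra! hxP
      exact hxa (ha.subset ⟨hx, hxP⟩)
    obtain ⟨j, hj⟩ := hxP
    rw [map_prod]
    exact Finset.prod_eq_zero (Finset.mem_univ j)
      (by simp [FiniteField.pow_card_sub_one_eq_one _ hj])
end

section
/- Let p be a prime, let n, r be positive integers, let v_1,…,v_r be positive integers, and let P_1,…,P_r ∈ ℤ[t_1,…,t_n]. For 1 ≤ i ≤ n let A_i be a nonempty finite subset of ℤ whose elements are pairwise incongruent modulo p, and put A = Π_{i=1}^n A_i. Let Z_A = {x ∈ A : P_j(x) ≡ 0 (mod p^{v_j}) for all 1 ≤ j ≤ r} and z_A = #Z_A. If Σ_{j=1}^r (p^{v_j}−1)·deg(P_j) < Σ_{i=1}^n (#A_i − 1), then z_A ≠ 1. -/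
open Finset

/-- The weighted sum of a polynomial over a grid, with Lagrange nodal weights, picks out its top
grid coefficient, so it vanishes for polynomials of small total degree. -/
theorem sum_piFinset_eval_mul_prod_nodalWeight_eq_zero {K ι σ : Type*} [Field K] [Fintype σ]
    [DecidableEq σ] [DecidableEq ι] (A : σ → Finset ι) (u : ι → K)
    (hu : ∀ i, Set.InjOn u (A i)) (F : MvPolynomial σ K)
    (hF : F.totalDegree < ∑ i, (#(A i) - 1)) :
    ∑ x ∈ Fintype.piFinset A, MvPolynomial.eval (fun i => u (x i)) F *
      ∏ i, Lagrange.nodalWeight (A i) u (x i) = 0 := by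
  simp_rw [MvPolynomial.eval_eq', sum_mul]
  rw [sum_comm]
  refine sum_eq_zero fun d hd => ?_
  obtain ⟨i, hi⟩ : ∃ i, d i < #(A i) - 1 := by
    by_contra! h
    refine (hF.trans_le (sum_le_sum fun i _ => h i)).not_ge ?_
    simpa [Finsupp.sum_fintype] using MvPolynomial.le_totalDegree hd
  have hzero : ∑ a ∈ A i, u a ^ d i * Lagrange.nodalWeight (A i) u a = 0 := by
    have h := Lagrange.coeff_eq_sum (P := (Polynomial.X ^ d i : Polynomial K)) (hu i) (by
      rw [Polynomial.degree_X_pow]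
      exact_mod_cast (by omega : d i < #(A i)))
    rw [Polynomial.coeff_X_pow, if_neg hi.ne'] at h
    simpa [Lagrange.nodalWeight, div_eq_mul_inv] using h.symm
  simp_rw [mul_assoc, ← prod_mul_distrib]
  rw [← mul_sum, ← prod_univ_sum A fun i a => u a ^ d i * Lagrange.nodalWeight (A i) u a,
    prod_eq_zero (mem_univ i) hzero, mul_zero]

section Padic

variable {p : ℕ} [Fact p.Prime]

/-- The shifted binomial coefficient `(N + q - 1).choose (q - 1)` with `q = p ^ v` is a `p`-adic
unit when `p ^ v ∣ N`. -/
theorem norm_shifted_choose_eq_one {v : ℕ} {N : ℤ} (hN : (p : ℤ) ^ v ∣ N) :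
    ‖((p ^ v - 1).factorial : ℚ_[p])⁻¹ * ∏ i ∈ range (p ^ v - 1), ((N : ℚ_[p]) + (i + 1))‖ = 1 := by
  have hfac : ((p ^ v - 1).factorial : ℚ_[p]) = ∏ i ∈ range (p ^ v - 1), ((i : ℚ_[p]) + 1) := by
    rw [← prod_range_add_one_eq_factorial]
    push_cast
    rfl
  have hterm : ∀ i ∈ range (p ^ v - 1), ‖(N : ℚ_[p]) + (i + 1)‖ = ‖(i : ℚ_[p]) + 1‖ := by
    intro i hi
    apply Padic.norm_eq_of_norm_sub_lt_right
    rw [add_sub_cancel_right]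
    refine ((Padic.norm_int_le_pow_iff_dvd N v).2 (by exact_mod_cast hN)).trans_lt ?_
    by_contra! h
    have hdvd := (Padic.norm_int_le_pow_iff_dvd (p := p) ((i : ℤ) + 1) v).1 (by exact_mod_cast h)
    have := Nat.le_of_dvd (Nat.succ_pos i) (by exact_mod_cast hdvd)
    have := mem_range.1 hi
    omega
  rw [norm_mul, norm_prod, prod_congr rfl hterm, ← norm_prod, ← hfac, norm_inv]
  exact inv_mul_cancel₀ (norm_ne_zero_iff.2 (by exact_mod_cast Nat.factorial_ne_zero _))

/-- The shifted binomial coefficient `(N + q - 1).choose (q - 1)` with `q = p ^ v` is divisible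
by `p` when `p ^ v ∤ N`. -/
theorem norm_shifted_choose_lt_one {v : ℕ} {N : ℤ} (hN : ¬ (p : ℤ) ^ v ∣ N) :
    ‖((p ^ v - 1).factorial : ℚ_[p])⁻¹ * ∏ i ∈ range (p ^ v - 1), ((N : ℚ_[p]) + (i + 1))‖ < 1 := by
  have hpos : 0 < p ^ v := pow_pos (Fact.out : p.Prime).pos v
  obtain ⟨k, hk⟩ : ∃ k, p ^ v = k + 1 := ⟨p ^ v - 1, by omega⟩
  have hlt : ‖((p ^ v : ℕ) : ℚ_[p])‖ < ‖(N : ℚ_[p])‖ := by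
    by_contra! h
    refine hN ?_
    have := (Padic.norm_int_le_pow_iff_dvd (p := p) N v).1 (by simpa using h)
    exact_mod_cast this
  have hNpos : 0 < ‖(N : ℚ_[p])‖ := (norm_nonneg _).trans_lt hlt
  obtain ⟨c, hc⟩ := Nat.factorial_coe_dvd_prod (k + 1) N
  have hprod : (N : ℚ_[p]) * ((k.factorial : ℚ_[p])⁻¹ * ∏ i ∈ range k, ((N : ℚ_[p]) + (i + 1))) =
      ((p ^ v : ℕ) : ℚ_[p]) * c := by
    have hfac : (k.factorial : ℚ_[p]) ≠ 0 := by exact_mod_cast Nat.factorial_ne_zero _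
    have hcast := congrArg (Int.cast : ℤ → ℚ_[p]) hc
    rw [prod_range_succ', Nat.factorial_succ] at hcast
    push_cast at hcast
    rw [hk]
    push_cast
    field_simp
    linear_combination hcast
  have hnorm := congrArg norm hprod
  rw [norm_mul, norm_mul ((p ^ v : ℕ) : ℚ_[p])] at hnorm
  rw [hk, Nat.add_sub_cancel]
  refine lt_of_mul_lt_mul_left (a := ‖(N : ℚ_[p])‖) ?_ hNpos.le
  rw [hnorm, mul_one]
  exact (mul_le_of_le_one_right (norm_nonneg _) (Padic.norm_int_le_one c)).trans_lt hlt

/-- Nodal weights of integers that are pairwise incongruent modulo `p` are `p`-adic units. -/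
theorem norm_nodalWeight_intCast_eq_one {s : Finset ℤ}
    (hs : ∀ a ∈ s, ∀ b ∈ s, (p : ℤ) ∣ a - b → a = b) {a : ℤ} (ha : a ∈ s) :
    ‖Lagrange.nodalWeight s (fun z : ℤ => (z : ℚ_[p])) a‖ = 1 := by
  rw [Lagrange.nodalWeight, norm_prod]
  refine prod_eq_one fun b hb => ?_
  obtain ⟨hba, hb⟩ := mem_erase.1 hb
  rw [norm_inv, inv_eq_one, ← Int.cast_sub]
  refine (Padic.norm_int_le_one _).antisymm (not_lt.1 fun h => hba ?_)
  exact (hs a ha b hb (Padic.norm_intCast_lt_one_iff.1 h)).symm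

/-- A polynomial over `ℚ_[p]` that detects the common zeros of `P j` modulo `p ^ v j`. -/
noncomputable def zeroIndicator (p : ℕ) [Fact p.Prime] {σ τ : Type*} [Fintype τ] (v : τ → ℕ)
    (P : τ → MvPolynomial σ ℤ) : MvPolynomial σ ℚ_[p] :=
  ∏ j, (MvPolynomial.C ((p ^ v j - 1).factorial : ℚ_[p])⁻¹ * ∏ i ∈ range (p ^ v j - 1),
    (MvPolynomial.map (Int.castRingHom ℚ_[p]) (P j) + MvPolynomial.C ((i : ℚ_[p]) + 1)))

variable {σ τ : Type*} [Fintype τ] (v : τ → ℕ) (P : τ → MvPolynomial σ ℤ)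

theorem totalDegree_zeroIndicator_le :
    (zeroIndicator p v P).totalDegree ≤ ∑ j, (p ^ v j - 1) * (P j).totalDegree := by
  refine (MvPolynomial.totalDegree_finsetProd _ _).trans (sum_le_sum fun j _ => ?_)
  refine (MvPolynomial.totalDegree_mul _ _).trans ?_
  rw [MvPolynomial.totalDegree_C, zero_add]
  refine (MvPolynomial.totalDegree_finsetProd _ _).trans ?_
  refine (sum_le_card_nsmul _ _ (P j).totalDegree fun i _ => ?_).trans (by simp)
  refine (MvPolynomial.totalDegree_add _ _).trans (max_le ?_ (by rw [MvPolynomial.totalDegree_C]; exact Nat.zero_le _))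
  exact Finset.sup_mono (MvPolynomial.support_map_subset _ _)

theorem eval_zeroIndicator (x : σ → ℤ) :
    MvPolynomial.eval (fun i => (x i : ℚ_[p])) (zeroIndicator p v P) =
      ∏ j, (((p ^ v j - 1).factorial : ℚ_[p])⁻¹ * ∏ i ∈ range (p ^ v j - 1),
        (((MvPolynomial.eval x (P j) : ℤ) : ℚ_[p]) + (i + 1))) := by
  have hcast : ∀ Q : MvPolynomial σ ℤ, MvPolynomial.eval (fun i => (x i : ℚ_[p]))
      (MvPolynomial.map (Int.castRingHom ℚ_[p]) Q) = ((MvPolynomial.eval x Q : ℤ) : ℚ_[p]) :=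
    fun Q => (MvPolynomial.map_eval (Int.castRingHom ℚ_[p]) x Q).symm
  simp only [zeroIndicator, map_prod, map_mul, map_add, MvPolynomial.eval_C, hcast]

theorem norm_eval_zeroIndicator_eq_one {x : σ → ℤ}
    (hx : ∀ j, (p : ℤ) ^ v j ∣ MvPolynomial.eval x (P j)) :
    ‖MvPolynomial.eval (fun i => (x i : ℚ_[p])) (zeroIndicator p v P)‖ = 1 := by
  rw [eval_zeroIndicator, norm_prod]
  exact prod_eq_one fun j _ => norm_shifted_choose_eq_one (hx j)

theorem norm_eval_zeroIndicator_lt_one {x : σ → ℤ}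
    (hx : ¬ ∀ j, (p : ℤ) ^ v j ∣ MvPolynomial.eval x (P j)) :
    ‖MvPolynomial.eval (fun i => (x i : ℚ_[p])) (zeroIndicator p v P)‖ < 1 := by
  classical
  obtain ⟨j, hj⟩ := not_forall.1 hx
  rw [eval_zeroIndicator, norm_prod, ← mul_prod_erase _ _ (mem_univ j)]
  refine mul_lt_one_of_nonneg_of_lt_one_left (norm_nonneg _) (norm_shifted_choose_lt_one hj) ?_
  refine prod_le_one (fun _ _ => norm_nonneg _) fun i _ => ?_
  by_cases hi : (p : ℤ) ^ v i ∣ MvPolynomial.eval x (P i)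
  · exact (norm_shifted_choose_eq_one hi).le
  · exact (norm_shifted_choose_lt_one hi).le

end Padic


/-- **Brink's Theorem**: restricted variable Chevalley theorem with prime power moduli
over `ℤ`. If each `A_i ⊆ ℤ` is a nonempty finite set whose elements are pairwise
incongruent mod `p` and `∑_j (p^{v_j}-1)·deg(P_j) < ∑_i (#A_i - 1)`, then the number of
`x ∈ ∏ A_i` with `P_j(x) ≡ 0 (mod p^{v_j})` for all `j` is not `1`. -/
theorem brink_theorem
    (p : ℕ) (hp : p.Prime) (n r : ℕ) (hn : 0 < n) (hr : 0 < r)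
    (v : Fin r → ℕ) (hv : ∀ j, 0 < v j)
    (P : Fin r → MvPolynomial (Fin n) ℤ)
    (A : Fin n → Finset ℤ) (hA : ∀ i, (A i).Nonempty)
    (hAp : ∀ i, ∀ a ∈ A i, ∀ b ∈ A i, (p : ℤ) ∣ (a - b) → a = b)
    (hdeg : ∑ j, (p ^ v j - 1) * (P j).totalDegree < ∑ i, ((A i).card - 1)) :
    Set.ncard {x : Fin n → ℤ | (∀ i, x i ∈ A i) ∧
      ∀ j, ((p : ℤ) ^ v j) ∣ MvPolynomial.eval x (P j)} ≠ 1 := by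
  have : Fact p.Prime := ⟨hp⟩
  intro hcard
  obtain ⟨x₀, hx₀⟩ := Set.ncard_eq_one.1 hcard
  have hmem : ∀ x : Fin n → ℤ, ((∀ i, x i ∈ A i) ∧
      ∀ j, ((p : ℤ) ^ v j) ∣ MvPolynomial.eval x (P j)) ↔ x = x₀ := fun x => Set.ext_iff.1 hx₀ x
  obtain ⟨hx₀A, hx₀P⟩ := (hmem x₀).2 rfl
  have hsum := sum_piFinset_eval_mul_prod_nodalWeight_eq_zero A (fun z : ℤ => (z : ℚ_[p]))
    (fun i => Int.cast_injective.injOn) (zeroIndicator p v P)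
    ((totalDegree_zeroIndicator_le v P).trans_lt hdeg)
  have hweight : ∀ x ∈ Fintype.piFinset A,
      ‖∏ i, Lagrange.nodalWeight (A i) (fun z : ℤ => (z : ℚ_[p])) (x i)‖ = 1 := by
    intro x hx
    rw [norm_prod]
    exact prod_eq_one fun i _ =>
      norm_nodalWeight_intCast_eq_one (hAp i) (Fintype.mem_piFinset.1 hx i)
  have hx₀mem : x₀ ∈ Fintype.piFinset A := Fintype.mem_piFinset.2 hx₀A
  rw [← add_sum_erase _ _ hx₀mem] at hsum
  have hnorm := congrArg norm (eq_neg_of_add_eq_zero_left hsum)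
  rw [norm_mul, hweight x₀ hx₀mem, norm_eval_zeroIndicator_eq_one v P hx₀P, norm_neg,
    mul_one] at hnorm
  refine hnorm.not_gt ?_
  rcases ((Fintype.piFinset A).erase x₀).eq_empty_or_nonempty with he | hne
  · simp [he]
  obtain ⟨x, hx, hle⟩ := IsUltrametricDist.exists_norm_finsetSum_le_of_nonempty hne
    fun x => MvPolynomial.eval (fun i => (x i : ℚ_[p])) (zeroIndicator p v P) *
      ∏ i, Lagrange.nodalWeight (A i) (fun z : ℤ => (z : ℚ_[p])) (x i)
  refine hle.trans_lt ?_
  obtain ⟨hxne, hxA⟩ := mem_erase.1 hx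
  rw [norm_mul, hweight x hxA, mul_one]
  exact norm_eval_zeroIndicator_lt_one v P fun h =>
    hxne ((hmem x).1 ⟨Fintype.mem_piFinset.1 hxA, h⟩)
end

section
/- Let K be a number field with ring of integers R, let 𝔭 be a nonzero prime ideal of R, and let q = #(R/𝔭) (a prime power). Let n, r be positive integers, let v_1,…,v_r be positive integers, and let P_1,…,P_r ∈ R[t_1,…,t_n]. For 1 ≤ i ≤ n let A_i be a nonempty finite subset of R whose elements are pairwise incongruent modulo 𝔭, and put A = Π_{i=1}^n A_i. Let Z_A = {x ∈ A : P_j(x) ∈ 𝔭^{v_j} for all 1 ≤ j ≤ r} and z_A = #Z_A. Then z_A = 0 or z_A ≥ m(#A_1,…,#A_n; #A_1 + … + #A_n − Σ_{j=1}^r (q^{v_j}−1)·deg(P_j)). -/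
/-- The balls-in-bins quantity `m(a₁,…,a_n; N)`: the minimum of `y₁⋯y_n` over all
integer tuples with `1 ≤ y_i ≤ a_i` and `∑ y_i = N` when `n ≤ N ≤ ∑ a_i`; extended by
`1` for `N < n` and by `∏ a_i` for `N > ∑ a_i`. -/
noncomputable def mBB (n : ℕ) (a : Fin n → ℕ) (N : ℤ) : ℕ :=
  if N < (n : ℤ) then 1
  else if (∑ i, (a i : ℤ)) < N then ∏ i, a i
  else sInf {P : ℕ | ∃ y : Fin n → ℕ,
    (∀ i, 1 ≤ y i ∧ y i ≤ a i) ∧ (∑ i, (y i : ℤ)) = N ∧ P = ∏ i, y i}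

open Finset

section Valuation

variable {K Γ₀ : Type*} [Field K] [LinearOrderedCommGroupWithZero Γ₀] (v : Valuation K Γ₀)

/-- Lagrange basis polynomials have integral coefficients when the nodes are integral and
pairwise incongruent. -/
theorem valuation_coeff_lagrangeBasis_le_one [DecidableEq K] {s : Finset K}
    (hs : ∀ a ∈ s, v a ≤ 1)
    (hsub : ∀ a ∈ s, ∀ b ∈ s, a ≠ b → v (a - b) = 1) {a : K} (ha : a ∈ s) (k : ℕ) :
    v ((Lagrange.basis s id a).coeff k) ≤ 1 := by
  have key : Lagrange.basis s id a ∈ Polynomial.liftsRing v.integer.subtype := by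
    refine Subring.prod_mem _ fun b hb => ?_
    rw [mem_erase] at hb
    have hC : ∀ c : K, v c ≤ 1 → Polynomial.C c ∈ Polynomial.liftsRing v.integer.subtype :=
      fun c hc => (Polynomial.lifts_iff_liftsRing _ _).1 (Polynomial.C'_mem_lifts ⟨⟨c, hc⟩, rfl⟩)
    refine mul_mem (hC _ ?_) (sub_mem ?_ (hC _ (hs b hb.2)))
    · simp [map_inv₀, hsub a ha b hb.2 hb.1.symm]
    · exact (Polynomial.lifts_iff_liftsRing _ _).1 (Polynomial.X_mem_lifts _)
  obtain ⟨c, hc⟩ := (Polynomial.lifts_iff_coeff_lifts _).1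
    ((Polynomial.lifts_iff_liftsRing _ _).2 key) k
  rw [← hc]
  exact c.2

theorem valuation_coeff_interpolate_le_one [DecidableEq K] {s : Finset K}
    (hs : ∀ a ∈ s, v a ≤ 1)
    (hsub : ∀ a ∈ s, ∀ b ∈ s, a ≠ b → v (a - b) = 1) {g : K → K} (hg : ∀ a ∈ s, v (g a) ≤ 1)
    (k : ℕ) : v ((Lagrange.interpolate s id g).coeff k) ≤ 1 := by
  rw [Lagrange.interpolate_apply, Polynomial.finsetSum_coeff]
  refine v.map_sum_le fun a ha => ?_
  rw [Polynomial.coeff_C_mul, map_mul]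
  exact mul_le_one' (hg a ha) (valuation_coeff_lagrangeBasis_le_one v hs hsub ha k)

/-- A polynomial whose reduction has degree `e` has at most `e` incongruent roots modulo the
maximal ideal. -/
theorem card_le_of_valuation_eval_lt_one (p : Polynomial K) {e : ℕ}
    (he : v (p.coeff e) = 1) (hgt : ∀ k, e < k → v (p.coeff k) < 1) {s : Finset K}
    (hs : ∀ a ∈ s, v a ≤ 1) (hsub : ∀ a ∈ s, ∀ b ∈ s, a ≠ b → v (a - b) = 1)
    (hroot : ∀ a ∈ s, v (p.eval a) < 1) : #s ≤ e := by
  classical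
  by_contra! hlt
  obtain ⟨t, hts, ht⟩ := exists_subset_card_eq (Nat.succ_le_of_lt hlt)
  set g : Polynomial K := ∑ k ∈ range (e + 1), Polynomial.monomial k (p.coeff k) with hg
  have hgdeg : g.degree < #t := by
    rw [ht]
    refine (Polynomial.degree_lt_iff_coeff_zero _ _).2 fun m hm => ?_
    simp only [hg, Polynomial.finsetSum_coeff, Polynomial.coeff_monomial]
    refine sum_eq_zero fun k hk => if_neg ?_
    rw [mem_range] at hk
    omega
  have hgcoeff : g.coeff e = p.coeff e := by
    simp [hg, Polynomial.finsetSum_coeff, Polynomial.coeff_monomial]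
  have hgeval : ∀ a ∈ t, v (g.eval a) < 1 := by
    intro a ha
    have hdiff : g.eval a = p.eval a - ∑ k ∈ Ico (e + 1) (p.natDegree + 1 + (e + 1)),
        p.coeff k * a ^ k := by
      rw [Polynomial.eval_eq_sum_range' (p := p) (n := p.natDegree + 1 + (e + 1)) (by omega) a,
        ← sum_range_add_sum_Ico _ (show e + 1 ≤ p.natDegree + 1 + (e + 1) by omega),
        add_sub_cancel_right, hg, Polynomial.eval_finsetSum]
      simp
    rw [hdiff]
    refine v.map_sub_lt (hroot a (hts ha)) (v.map_sum_lt one_ne_zero fun k hk => ?_)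
    rw [map_mul, map_pow]
    rw [mem_Ico] at hk
    exact mul_lt_one_of_lt_of_le (hgt k (by omega)) (pow_le_one' (hs a (hts ha)) k)
  have hcoeff := Lagrange.coeff_eq_sum (s := t) (v := id) Function.injective_id.injOn hgdeg
  rw [ht, Nat.succ_sub_one, hgcoeff] at hcoeff
  refine he.not_lt ?_
  rw [hcoeff]
  refine v.map_sum_lt one_ne_zero fun a ha => ?_
  rw [map_div₀, map_prod, prod_eq_one, div_one]
  · exact hgeval a ha
  · intro b hb
    rw [mem_erase] at hb
    exact hsub a (hts ha) b (hts hb.2) hb.1.symm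

end Valuation

section PolyFun

variable (K : Type*) [Field K]

/-- The polynomial functions on `Kⁿ` of total degree at most `d`. -/
def polyFun (n : ℕ) (d : ℤ) : Submodule K ((Fin n → K) → K) :=
  Submodule.span K {g | ∃ α : Fin n → ℕ, ∑ i, (α i : ℤ) ≤ d ∧ g = fun x => ∏ i, x i ^ α i}

variable {K}

theorem eval_mem_polyFun {n : ℕ} (p : MvPolynomial (Fin n) K) {d : ℤ}
    (hd : (p.totalDegree : ℤ) ≤ d) : (fun x => MvPolynomial.eval x p) ∈ polyFun K n d := by
  have hsum : (fun x => MvPolynomial.eval x p) =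
      ∑ m ∈ p.support, p.coeff m • fun x : Fin n → K => ∏ i, x i ^ m i := by
    ext x
    simp [MvPolynomial.eval_eq']
  rw [hsum]
  refine sum_mem fun m hm => Submodule.smul_mem _ _ (Submodule.subset_span ⟨m, ?_, rfl⟩)
  refine le_trans ?_ hd
  have := MvPolynomial.le_totalDegree hm
  rw [Finsupp.sum_fintype _ _ (fun _ => rfl)] at this
  exact_mod_cast this

/-- The `k`-th coefficient of the polynomial interpolating `f` in its first variable at the
nodes `s`. -/
noncomputable def sliceCoeff [DecidableEq K] {n : ℕ} (s : Finset K) (k : ℕ)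
    (f : (Fin (n + 1) → K) → K) (y : Fin n → K) : K :=
  (Lagrange.interpolate s id fun a => f (Fin.cons a y)).coeff k

theorem coeff_interpolate_pow [DecidableEq K] (s : Finset K) {j k : ℕ} (hjk : j < k) :
    (Lagrange.interpolate s id fun a => a ^ j).coeff k = 0 := by
  rcases lt_or_ge j #s with hj | hj
  · rw [← Lagrange.eq_interpolate_of_eval_eq (f := (Polynomial.X ^ j : Polynomial K))
      _ Function.injective_id.injOn]
    · rw [Polynomial.coeff_X_pow, if_neg hjk.ne']
    · simpa using hj
    · simp
  · refine Polynomial.coeff_eq_zero_of_degree_lt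
      ((Lagrange.degree_interpolate_lt _ Function.injective_id.injOn).trans ?_)
    exact_mod_cast hj.trans_lt hjk

theorem sliceCoeff_mem_polyFun [DecidableEq K] {n : ℕ} (s : Finset K) (k : ℕ) {d : ℤ}
    {f : (Fin (n + 1) → K) → K} (hf : f ∈ polyFun K (n + 1) d) :
    sliceCoeff s k f ∈ polyFun K n (d - k) := by
  induction hf using Submodule.span_induction with
  | mem f hf =>
    obtain ⟨α, hα, rfl⟩ := hf
    have hslice : sliceCoeff s k (fun x => ∏ i, x i ^ α i) =
        (Lagrange.interpolate s id fun a => a ^ α 0).coeff k •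
          fun y : Fin n → K => ∏ i : Fin n, y i ^ α i.succ := by
      ext y
      have : (fun a : K => ∏ i, (Fin.cons a y : Fin (n + 1) → K) i ^ α i) =
          (∏ i : Fin n, y i ^ α i.succ) • fun a : K => a ^ α 0 := by
        ext a
        simp [Fin.prod_univ_succ, mul_comm]
      simp only [sliceCoeff, this, map_smul, Polynomial.coeff_smul, Pi.smul_apply, smul_eq_mul]
      ring
    rw [hslice]
    rcases lt_or_ge (α 0) k with hk | hk
    · rw [coeff_interpolate_pow s hk, zero_smul]
      exact zero_mem _
    · refine Submodule.smul_mem _ _ (Submodule.subset_span ⟨_, ?_, rfl⟩)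
      rw [Fin.sum_univ_succ] at hα
      omega
  | zero =>
    convert (polyFun K n (d - k)).zero_mem
    ext y
    exact congrArg (Polynomial.coeff · k) (map_zero (Lagrange.interpolate s id))
  | add f g _ _ hf hg =>
    convert add_mem hf hg
    ext y
    simp only [sliceCoeff, Pi.add_apply, ← Polynomial.coeff_add, ← map_add]
    rfl
  | smul c f _ hf =>
    convert Submodule.smul_mem _ c hf
    ext y
    simp only [sliceCoeff, Pi.smul_apply, ← Polynomial.coeff_smul, ← map_smul]
    rfl

end PolyFun

/-- **Alon–Füredi theorem modulo the maximal ideal of a valuation.** -/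
theorem exists_prod_le_card_valuation_eq_one {K Γ₀ : Type*} [Field K]
    [LinearOrderedCommGroupWithZero Γ₀] (v : Valuation K Γ₀) {n : ℕ} (A : Fin n → Finset K)
    (hA : ∀ i, ∀ a ∈ A i, v a ≤ 1)
    (hsub : ∀ i, ∀ a ∈ A i, ∀ b ∈ A i, a ≠ b → v (a - b) = 1) {d : ℤ} {f : (Fin n → K) → K}
    (hf : f ∈ polyFun K n d) (hle : ∀ x ∈ Fintype.piFinset A, v (f x) ≤ 1)
    (hne : ∃ x ∈ Fintype.piFinset A, v (f x) = 1) :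
    ∃ y : Fin n → ℕ, (∀ i, 1 ≤ y i ∧ y i ≤ #(A i)) ∧
      ∑ i, (#(A i) : ℤ) - d ≤ ∑ i, (y i : ℤ) ∧
      ∏ i, y i ≤ #{x ∈ Fintype.piFinset A | v (f x) = 1} := by
  classical
  induction n generalizing d with
  | zero =>
    obtain ⟨x, hx, hfx⟩ := hne
    refine ⟨0, fun i => i.elim0, ?_, ?_⟩
    · by_contra! hd
      simp only [univ_eq_empty, sum_empty, zero_sub, Left.neg_pos_iff] at hd
      have : polyFun K 0 d = ⊥ := by
        rw [polyFun, Submodule.span_eq_bot]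
        rintro _ ⟨α, hα, -⟩
        simp only [univ_eq_empty, sum_empty] at hα
        omega
      rw [this, Submodule.mem_bot] at hf
      simp [hf] at hfx
    · simp only [univ_eq_empty, prod_empty, Nat.one_le_iff_ne_zero]
      exact card_ne_zero_of_mem (mem_filter.2 ⟨hx, hfx⟩)
  | succ n ih =>
    have hcons : ∀ {a : K} {y : Fin n → K}, (Fin.cons a y : Fin (n + 1) → K) ∈
        Fintype.piFinset A ↔ a ∈ A 0 ∧ y ∈ Fintype.piFinset (fun i => A i.succ) := by
      intro a y
      simp [Fintype.mem_piFinset, Fin.forall_fin_succ]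
    have hdeg : ∀ y : Fin n → K, (Lagrange.interpolate (A 0) id
        fun a => f (Fin.cons a y)).degree < #(A 0) :=
      fun y => Lagrange.degree_interpolate_lt _ Function.injective_id.injOn
    have heval : ∀ (y : Fin n → K), ∀ a ∈ A 0, (Lagrange.interpolate (A 0) id
        fun a => f (Fin.cons a y)).eval a = f (Fin.cons a y) :=
      fun y a ha => Lagrange.eval_interpolate_at_node (s := A 0) (v := id)
        (fun a => f (Fin.cons a y)) Function.injective_id.injOn ha
    have hslice : ∀ k, ∀ y ∈ Fintype.piFinset (fun i => A i.succ),
        v (sliceCoeff (A 0) k f y) ≤ 1 := fun k y hy =>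
      valuation_coeff_interpolate_le_one v (hA 0) (hsub 0)
        (fun a ha => hle _ (hcons.2 ⟨ha, hy⟩)) k
    have hzero : ∀ k, #(A 0) ≤ k → ∀ y, sliceCoeff (A 0) k f y = 0 := fun k hk y =>
      Polynomial.coeff_eq_zero_of_degree_lt ((hdeg y).trans_le (by exact_mod_cast hk))
    let good : ℕ → Prop := fun k =>
      ∃ y ∈ Fintype.piFinset (fun i => A i.succ), v (sliceCoeff (A 0) k f y) = 1
    have hgood_lt : ∀ k, good k → k < #(A 0) := by
      rintro k ⟨y, -, hy⟩
      by_contra! hk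
      simp [hzero k hk y] at hy
    obtain ⟨k₀, hk₀⟩ : ∃ k, good k := by
      obtain ⟨x, hx, hfx⟩ := hne
      rw [← Fin.cons_self_tail x] at hx hfx
      by_contra! hbad
      refine hfx.not_lt ?_
      rw [← heval _ _ (hcons.1 hx).1, Polynomial.eval_eq_sum_range]
      refine v.map_sum_lt one_ne_zero fun k _ => ?_
      rw [map_mul, map_pow]
      refine mul_lt_one_of_lt_of_le ((hslice k _ (hcons.1 hx).2).lt_of_ne fun h => ?_)
        (pow_le_one' (hA 0 _ (hcons.1 hx).1) k)
      exact hbad k ⟨_, (hcons.1 hx).2, h⟩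
    set e := Nat.findGreatest good #(A 0)
    have hge : good e := Nat.findGreatest_spec (hgood_lt k₀ hk₀).le hk₀
    have hmax : ∀ k, e < k → ∀ y ∈ Fintype.piFinset (fun i => A i.succ),
        v (sliceCoeff (A 0) k f y) < 1 := fun k hk y hy =>
      (hslice k y hy).lt_of_ne fun h => by
        have hgk : good k := ⟨y, hy, h⟩
        exact hk.not_ge (Nat.le_findGreatest (hgood_lt k hgk).le hgk)
    have helt := hgood_lt e hge
    obtain ⟨z, hz, hzsum, hzprod⟩ := ih (fun i => A (Fin.succ i)) (fun i => hA (Fin.succ i))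
      (fun i => hsub (Fin.succ i)) (sliceCoeff_mem_polyFun (A 0) e hf) (hslice e) hge
    refine ⟨Fin.cons (#(A 0) - e) z, ?_, ?_, ?_⟩
    · refine Fin.forall_fin_succ.2 ⟨?_, fun i => by simpa using hz i⟩
      simp only [Fin.cons_zero]
      omega
    · simp only [Fin.sum_univ_succ, Fin.cons_zero, Fin.cons_succ]
      omega
    · set T := {y ∈ Fintype.piFinset (fun i : Fin n => A i.succ) | v (sliceCoeff (A 0) e f y) = 1}
      have hfib : ∀ y ∈ T, #(A 0) - e ≤ #{a ∈ A 0 | v (f (Fin.cons a y)) = 1} := by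
        intro y hy
        obtain ⟨hyA, hye⟩ := mem_filter.1 hy
        have hcard := card_filter_add_card_filter_not (s := A 0)
          (fun a => v (f (Fin.cons a y)) = 1)
        have hroots : #{a ∈ A 0 | ¬ v (f (Fin.cons a y)) = 1} ≤ e := by
          refine card_le_of_valuation_eval_lt_one v (Lagrange.interpolate (A 0) id
            fun a => f (Fin.cons a y)) hye (fun k hk => hmax k hk y hyA)
            (fun a ha => hA 0 a (mem_filter.1 ha).1)
            (fun a ha b hb => hsub 0 a (mem_filter.1 ha).1 b (mem_filter.1 hb).1)
            fun a ha => ?_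
          obtain ⟨ha, hav⟩ := mem_filter.1 ha
          rw [heval y a ha]
          exact (hle _ (hcons.2 ⟨ha, hyA⟩)).lt_of_ne hav
        omega
      calc ∏ i, (Fin.cons (#(A 0) - e) z : Fin (n + 1) → ℕ) i
          = (∏ i, z i) * (#(A 0) - e) := by
            simp only [Fin.prod_univ_succ, Fin.cons_zero, Fin.cons_succ, mul_comm]
        _ ≤ #T * (#(A 0) - e) := Nat.mul_le_mul_right _ hzprod
        _ ≤ ∑ y ∈ T, #{a ∈ A 0 | v (f (Fin.cons a y)) = 1} := by
            rw [← smul_eq_mul]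
            exact card_nsmul_le_sum _ _ _ hfib
        _ = #(T.sigma fun y => {a ∈ A 0 | v (f (Fin.cons a y)) = 1}) := (card_sigma _ _).symm
        _ ≤ #{x ∈ Fintype.piFinset A | v (f x) = 1} := by
            refine card_le_card_of_injOn (fun w => Fin.cons w.2 w.1) ?_ ?_
            · rintro ⟨y, a⟩ hw
              obtain ⟨hy, ha⟩ := mem_sigma.1 (mem_coe.1 hw)
              obtain ⟨ha, hav⟩ := mem_filter.1 ha
              exact mem_coe.2 (mem_filter.2 ⟨hcons.2 ⟨ha, (mem_filter.1 hy).1⟩, hav⟩)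
            · rintro ⟨y, a⟩ - ⟨y', a'⟩ - h
              obtain ⟨rfl, rfl⟩ := Fin.cons_inj.1 h
              rfl

theorem exists_one_le_le_sum_eq {ι : Type*} [Fintype ι] {N : ℕ} (hN : Fintype.card ι ≤ N)
    (y : ι → ℕ) (hy : ∀ i, 1 ≤ y i) (hsum : N ≤ ∑ i, y i) :
    ∃ z : ι → ℕ, (∀ i, 1 ≤ z i ∧ z i ≤ y i) ∧ ∑ i, z i = N := by
  classical
  obtain ⟨k, hk⟩ := Nat.exists_eq_add_of_le hsum
  induction k generalizing y with
  | zero => exact ⟨y, fun i => ⟨hy i, le_rfl⟩, hk⟩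
  | succ k ih =>
    obtain ⟨i, -, hi⟩ : ∃ i ∈ univ, 1 < y i :=
      exists_lt_of_sum_lt (s := univ) (f := fun _ => 1) (by simp; omega)
    have hupd : ∀ j, 1 ≤ Function.update y i (y i - 1) j ∧
        Function.update y i (y i - 1) j ≤ y j := by
      intro j
      rcases eq_or_ne j i with rfl | hj
      · simp only [Function.update_self]
        omega
      · simpa [Function.update_of_ne hj] using hy j
    have hsum' : ∑ j, Function.update y i (y i - 1) j = N + k := by
      have h₁ := sum_update_of_mem (mem_univ i) y (y i - 1)
      have h₂ := sum_eq_add_sum_sdiff_singleton_of_mem (mem_univ i) y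
      omega
    obtain ⟨z, hz, hzN⟩ := ih _ (fun j => (hupd j).1) (by omega) hsum'
    exact ⟨z, fun j => ⟨(hz j).1, (hz j).2.trans (hupd j).2⟩, hzN⟩

theorem mBB_le_prod {n : ℕ} {a : Fin n → ℕ} {N : ℤ} (y : Fin n → ℕ)
    (hy : ∀ i, 1 ≤ y i ∧ y i ≤ a i) (hN : N ≤ ∑ i, (y i : ℤ)) : mBB n a N ≤ ∏ i, y i := by
  have hsum : ∑ i, (y i : ℤ) ≤ ∑ i, (a i : ℤ) :=
    sum_le_sum fun i _ => by exact_mod_cast (hy i).2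
  rw [mBB, if_neg (hN.trans hsum).not_gt]
  split_ifs with hn
  · exact one_le_prod' fun i _ => (hy i).1
  · lift N to ℕ using by omega
    obtain ⟨z, hz, hzN⟩ := exists_one_le_le_sum_eq (N := N) (by simpa using hn) y
      (fun i => (hy i).1) (by exact_mod_cast hN)
    refine le_trans (Nat.sInf_le ?_) (prod_le_prod' fun i _ => (hz i).2)
    exact ⟨z, fun i => ⟨(hz i).1, (hz i).2.trans (hy i).2⟩, by exact_mod_cast hzN, rfl⟩

namespace IsDedekindDomain.HeightOneSpectrum

variable {R : Type*} [CommRing R] [IsDedekindDomain R] (v : HeightOneSpectrum R)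

theorem intValuation_lt_of_mem_pow {m : ℕ} {x y : R} (hx : x ∈ v.asIdeal ^ m)
    (hy : y ∉ v.asIdeal ^ m) : v.intValuation x < v.intValuation y := by
  rw [← v.intValuation_le_pow_iff_mem] at hx hy
  exact hx.trans_lt (not_le.1 hy)

/-- The valuation of a nonzero class modulo `vᵐ` does not depend on the representative. -/
theorem intValuation_eq_of_sub_mem_pow {m : ℕ} {x y : R} (hxy : x - y ∈ v.asIdeal ^ m)
    (hy : y ∉ v.asIdeal ^ m) : v.intValuation x = v.intValuation y := by
  rw [← add_sub_cancel y x]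
  exact v.intValuation.map_add_eq_of_lt_left (v.intValuation_lt_of_mem_pow hxy hy)

/-- If `S` represents the nonzero classes modulo `vᵐ`, the valuation of `∏ s ∈ S, (x - s)` detects
whether `x ∈ vᵐ`. -/
theorem exists_finset_intValuation_prod_sub (m : ℕ) [Finite (R ⧸ v.asIdeal ^ m)] :
    ∃ S : Finset R, #S = Nat.card (R ⧸ v.asIdeal ^ m) - 1 ∧ (∀ s ∈ S, s ≠ 0) ∧ ∀ x : R,
      v.intValuation (∏ s ∈ S, (x - s)) ≤ v.intValuation (∏ s ∈ S, s) ∧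
      (v.intValuation (∏ s ∈ S, (x - s)) = v.intValuation (∏ s ∈ S, s) ↔
        x ∈ v.asIdeal ^ m) := by
  classical
  have := Fintype.ofFinite (R ⧸ v.asIdeal ^ m)
  let out : R ⧸ v.asIdeal ^ m → R := Quotient.out
  have hout : ∀ c, Ideal.Quotient.mk (v.asIdeal ^ m) (out c) = c := Quotient.out_eq'
  have hmem : ∀ x, x ∈ v.asIdeal ^ m ↔ Ideal.Quotient.mk (v.asIdeal ^ m) x = 0 :=
    fun x => Ideal.Quotient.eq_zero_iff_mem.symm
  have hinj : Function.Injective out := fun c c' h => by rw [← hout c, h, hout]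
  have hval : ∀ x c, c ≠ 0 → Ideal.Quotient.mk (v.asIdeal ^ m) x = c →
      v.intValuation x = v.intValuation (out c) := by
    rintro x c hc rfl
    refine v.intValuation_eq_of_sub_mem_pow (m := m) ?_ ?_
    · rw [hmem, map_sub, hout, sub_self]
    · rwa [hmem, hout]
  have hne : ∀ c, c ≠ 0 → out c ≠ 0 := by
    rintro c hc h
    rw [← hout c, h, map_zero] at hc
    exact hc rfl
  have hin : ∀ x, x ∈ v.asIdeal ^ m →
      v.intValuation (∏ c ∈ univ.erase 0, (x - out c)) =
        v.intValuation (∏ c ∈ univ.erase 0, out c) := by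
    intro x hx
    rw [map_prod, map_prod]
    refine prod_congr rfl fun c hc => ?_
    rw [v.intValuation.map_sub_swap]
    refine hval _ c (ne_of_mem_erase hc) ?_
    rw [map_sub, hout, (hmem x).1 hx, sub_zero]
  have hnotin : ∀ x, x ∉ v.asIdeal ^ m →
      v.intValuation (∏ c ∈ univ.erase 0, (x - out c)) <
        v.intValuation (∏ c ∈ univ.erase 0, out c) := by
    intro x hx
    set b := Ideal.Quotient.mk (v.asIdeal ^ m) x with hb
    have hb0 : b ≠ 0 := fun h => hx ((hmem x).2 h)
    have hshift : ∏ c ∈ (univ.erase 0).erase b, v.intValuation (x - out c) =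
        ∏ c ∈ (univ.erase 0).erase b, v.intValuation (out c) := by
      refine prod_nbij' (fun c => b - c) (fun c => b - c) ?_ ?_ ?_ ?_ ?_
      · intro c hc
        simp only [mem_erase, mem_univ, and_true, ne_eq, sub_eq_self, sub_eq_zero] at hc ⊢
        exact ⟨hc.2, fun h => hc.1 h.symm⟩
      · intro c hc
        simp only [mem_erase, mem_univ, and_true, ne_eq, sub_eq_self, sub_eq_zero] at hc ⊢
        exact ⟨hc.2, fun h => hc.1 h.symm⟩
      · simp
      · simp
      · intro c hc
        refine hval _ _ (sub_ne_zero.2 (ne_of_mem_erase hc).symm) ?_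
        rw [map_sub, hout]
    have hbmem : b ∈ (univ : Finset (R ⧸ v.asIdeal ^ m)).erase 0 :=
      mem_erase.2 ⟨hb0, mem_univ b⟩
    rw [map_prod, map_prod, ← mul_prod_erase _ _ hbmem,
      ← mul_prod_erase _ (fun c => v.intValuation (out c)) hbmem, hshift]
    refine mul_lt_mul_of_pos_right (v.intValuation_lt_of_mem_pow (m := m) ?_ ?_) ?_
    · rw [hmem, map_sub, hout, sub_self]
    · rwa [hmem, hout]
    · refine zero_lt_iff.2 (prod_ne_zero_iff.2 fun c hc => ?_)
      exact v.intValuation_ne_zero _ (hne c (ne_of_mem_erase (mem_of_mem_erase hc)))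
  refine ⟨(univ.erase 0).map ⟨out, hinj⟩, ?_, ?_, fun x => ?_⟩
  · simp [Nat.card_eq_fintype_card]
  · intro s hs
    obtain ⟨c, hc, rfl⟩ := mem_map.1 hs
    exact hne c (ne_of_mem_erase hc)
  · simp only [prod_map, Function.Embedding.coeFn_mk]
    by_cases hx : x ∈ v.asIdeal ^ m
    · exact ⟨(hin x hx).le, iff_of_true (hin x hx) hx⟩
    · exact ⟨(hnotin x hx).le, iff_of_false (hnotin x hx).ne hx⟩

variable (K : Type*) [Field K] [Algebra R K] [IsFractionRing R K]

/-- The condition `P x ∈ vᵐ` is detected by the reduction of an integer-valued polynomial. -/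
theorem exists_mvPolynomial_valuation_eq_one_iff {σ : Type*} (P : MvPolynomial σ R) (m : ℕ)
    [Finite (R ⧸ v.asIdeal ^ m)] :
    ∃ g : MvPolynomial σ K,
      g.totalDegree ≤ (Nat.card (R ⧸ v.asIdeal ^ m) - 1) * P.totalDegree ∧
      ∀ x : σ → R, v.valuation K (MvPolynomial.eval (algebraMap R K ∘ x) g) ≤ 1 ∧
        (v.valuation K (MvPolynomial.eval (algebraMap R K ∘ x) g) = 1 ↔
          MvPolynomial.eval x P ∈ v.asIdeal ^ m) := by
  obtain ⟨S, hcard, hS, hval⟩ := v.exists_finset_intValuation_prod_sub m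
  refine ⟨MvPolynomial.C (algebraMap R K (∏ s ∈ S, s))⁻¹ *
    MvPolynomial.map (algebraMap R K) (∏ s ∈ S, (P - MvPolynomial.C s)), ?_, fun x => ?_⟩
  · refine (MvPolynomial.totalDegree_mul _ _).trans ?_
    rw [MvPolynomial.totalDegree_C, zero_add, ← hcard, ← smul_eq_mul]
    refine (Finset.sup_mono (MvPolynomial.support_map_subset _ _)).trans ?_
    refine (MvPolynomial.totalDegree_finsetProd _ _).trans (sum_le_card_nsmul _ _ _ fun s _ => ?_)
    exact MvPolynomial.totalDegree_sub_C_le P s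
  · have hpos : 0 < v.intValuation (∏ s ∈ S, s) :=
      zero_lt_iff.2 (v.intValuation_ne_zero _ (prod_ne_zero_iff.2 hS))
    have hev : v.valuation K (MvPolynomial.eval (algebraMap R K ∘ x)
        (MvPolynomial.C (algebraMap R K (∏ s ∈ S, s))⁻¹ *
          MvPolynomial.map (algebraMap R K) (∏ s ∈ S, (P - MvPolynomial.C s)))) =
        v.intValuation (∏ s ∈ S, (MvPolynomial.eval x P - s)) /
          v.intValuation (∏ s ∈ S, s) := by
      rw [map_mul, MvPolynomial.eval_C, MvPolynomial.eval_map, ← MvPolynomial.eval₂_comp,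
        map_mul, map_inv₀, v.valuation_of_algebraMap, v.valuation_of_algebraMap, div_eq_inv_mul]
      simp only [map_prod, map_sub, MvPolynomial.eval_C]
    rw [hev, div_le_one₀ hpos, div_eq_one_iff_eq hpos.ne']
    exact hval _

end IsDedekindDomain.HeightOneSpectrum

/-- **Restricted Variable Warning's Second Theorem** (main theorem of the paper). -/
theorem restricted_variable_warning_second_theorem
    (K : Type*) [Field K] [NumberField K]
    (𝔭 : Ideal (NumberField.RingOfIntegers K)) [𝔭.IsPrime] (h𝔭 : 𝔭 ≠ ⊥)
    (q : ℕ) (hq : q = Nat.card (NumberField.RingOfIntegers K ⧸ 𝔭))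
    (n r : ℕ) (hn : 0 < n) (hr : 0 < r)
    (v : Fin r → ℕ) (hv : ∀ j, 0 < v j)
    (P : Fin r → MvPolynomial (Fin n) (NumberField.RingOfIntegers K))
    (A : Fin n → Finset (NumberField.RingOfIntegers K)) (hA : ∀ i, (A i).Nonempty)
    (hAp : ∀ i, ∀ a ∈ A i, ∀ b ∈ A i, a - b ∈ 𝔭 → a = b) :
    Set.ncard {x : Fin n → NumberField.RingOfIntegers K | (∀ i, x i ∈ A i) ∧
        ∀ j, MvPolynomial.eval x (P j) ∈ 𝔭 ^ v j} = 0 ∨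
      mBB n (fun i => (A i).card)
        ((∑ i, ((A i).card : ℤ)) - ∑ j, ((q : ℤ) ^ v j - 1) * ((P j).totalDegree : ℤ)) ≤
        Set.ncard {x : Fin n → NumberField.RingOfIntegers K | (∀ i, x i ∈ A i) ∧
          ∀ j, MvPolynomial.eval x (P j) ∈ 𝔭 ^ v j} := by
  classical
  let w : IsDedekindDomain.HeightOneSpectrum (NumberField.RingOfIntegers K) := ⟨𝔭, ‹_›, h𝔭⟩
  have hfin : ∀ m, Finite (NumberField.RingOfIntegers K ⧸ w.asIdeal ^ m) := fun m =>
    Ring.HasFiniteQuotients.finiteQuotient (pow_ne_zero m h𝔭)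
  have hcard : ∀ m, Nat.card (NumberField.RingOfIntegers K ⧸ w.asIdeal ^ m) = q ^ m := fun m => by
    rw [hq, ← Submodule.cardQuot_apply, cardQuot_pow_of_prime h𝔭, Submodule.cardQuot_apply]
  have hqpos : 0 < q := by
    have := Ring.HasFiniteQuotients.finiteQuotient h𝔭
    rw [hq]
    exact Nat.card_pos
  choose g hgdeg hgval using fun j => w.exists_mvPolynomial_valuation_eq_one_iff K (P j) (v j)
  set Z := {x : Fin n → NumberField.RingOfIntegers K | (∀ i, x i ∈ A i) ∧
    ∀ j, MvPolynomial.eval x (P j) ∈ 𝔭 ^ v j}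
  have hinj : Function.Injective (algebraMap (NumberField.RingOfIntegers K) K) :=
    IsFractionRing.injective _ _
  let B : Fin n → Finset K := fun i => (A i).image (algebraMap _ K)
  have hBcard : ∀ i, #(B i) = #(A i) := fun i => card_image_of_injective _ hinj
  have hB : ∀ y ∈ Fintype.piFinset B, ∃ x : Fin n → NumberField.RingOfIntegers K,
      (∀ i, x i ∈ A i) ∧ algebraMap _ K ∘ x = y := by
    intro y hy
    have hy' : ∀ i, ∃ a ∈ A i, algebraMap _ K a = y i := fun i =>
      mem_image.1 (Fintype.mem_piFinset.1 hy i)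
    choose x hx hxy using hy'
    exact ⟨x, hx, funext hxy⟩
  let f : (Fin n → K) → K := fun y => MvPolynomial.eval y (∏ j, g j)
  have hf : ∀ x : Fin n → NumberField.RingOfIntegers K,
      w.valuation K (f (algebraMap _ K ∘ x)) ≤ 1 ∧
      (w.valuation K (f (algebraMap _ K ∘ x)) = 1 ↔
        ∀ j, MvPolynomial.eval x (P j) ∈ 𝔭 ^ v j) := by
    intro x
    simp only [f, map_prod]
    refine ⟨prod_le_one' fun j _ => (hgval j x).1, ?_⟩
    rw [prod_eq_one_iff_of_le_one' fun j _ => (hgval j x).1]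
    simp only [mem_univ, true_imp_iff]
    exact forall_congr' fun j => (hgval j x).2
  rcases Z.eq_empty_or_nonempty with hempty | ⟨x₀, hx₀A, hx₀⟩
  · exact Or.inl (by rw [hempty, Set.ncard_empty])
  right
  have hdeg : ((∏ j, g j).totalDegree : ℤ) ≤
      ∑ j, ((q : ℤ) ^ v j - 1) * ((P j).totalDegree : ℤ) := by
    calc ((∏ j, g j).totalDegree : ℤ) ≤ ∑ j, ((g j).totalDegree : ℤ) := by
          exact_mod_cast MvPolynomial.totalDegree_finsetProd _ _
      _ ≤ _ := sum_le_sum fun j _ => by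
          have := hgdeg j
          rw [hcard] at this
          zify [Nat.one_le_pow (v j) q hqpos] at this
          exact this
  obtain ⟨y, hy, hysum, hyprod⟩ := exists_prod_le_card_valuation_eq_one (w.valuation K) B
    (fun i a ha => by
      obtain ⟨a, -, rfl⟩ := mem_image.1 ha
      exact w.valuation_le_one a)
    (fun i a ha b hb hab => by
      obtain ⟨a', ha', rfl⟩ := mem_image.1 ha
      obtain ⟨b', hb', rfl⟩ := mem_image.1 hb
      rw [← map_sub, w.valuation_eq_one_iff_notMem]
      exact fun h => hab (congrArg _ (hAp i a' ha' b' hb' h)))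
    (eval_mem_polyFun _ hdeg)
    (fun y hy => by
      obtain ⟨x, -, rfl⟩ := hB y hy
      exact (hf x).1)
    ⟨algebraMap _ K ∘ x₀, Fintype.mem_piFinset.2 fun i => mem_image_of_mem _ (hx₀A i),
      (hf x₀).2.2 hx₀⟩
  simp only [hBcard] at hy hysum
  refine (mBB_le_prod y hy hysum).trans (hyprod.trans ?_)
  have hZfin : Z.Finite := (Fintype.piFinset A).finite_toSet.subset fun x hx =>
    mem_coe.2 (Fintype.mem_piFinset.2 hx.1)
  rw [← Set.ncard_image_of_injective Z hinj.comp_left, ← Set.ncard_coe_finset]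
  refine Set.ncard_le_ncard ?_ (hZfin.image _)
  intro y hy
  obtain ⟨hyB, hfy⟩ := mem_filter.1 (mem_coe.1 hy)
  obtain ⟨x, hxA, rfl⟩ := hB y hyB
  exact ⟨x, ⟨hxA, (hf x).2.1 hfy⟩, rfl⟩
end

section
/- Let K be a number field with ring of integers R, let 𝔭 be a nonzero prime ideal of R, and let q = #(R/𝔭). Let n, r be positive integers, let v_1,…,v_r be positive integers, and let P_1,…,P_r ∈ R[t_1,…,t_n]. Let Z = {x ∈ {0,1}^n ⊆ R^n : P_j(x) ∈ 𝔭^{v_j} for all 1 ≤ j ≤ r} and z = #Z. Then z = 0 or z ≥ 2^{n − Σ_{j=1}^r (q^{v_j}−1)·deg(P_j)}. -/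
open Finset in
/-- An Alon–Füredi bound on the Boolean cube, with values in an abelian group: if the alternating
sums of `f` over the subsets of `S` vanish as soon as `d ≤ #S`, then `f` is nonzero on at least
`2 ^ (#U + 1) / 2 ^ d` subsets of `U`, unless it vanishes on all of them. -/
theorem two_pow_card_succ_le_of_alternating_sum_eq_zero {σ A : Type*} [DecidableEq σ]
    [AddCommGroup A] [DecidableEq A] (U : Finset σ) (d : ℕ) (f : Finset σ → A)
    (hf : ∀ S ⊆ U, d ≤ #S → ∑ T ∈ S.powerset, (-1 : ℤ) ^ #T • f T = 0)
    (hne : ∃ T ⊆ U, f T ≠ 0) :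
    2 ^ (#U + 1) ≤ 2 ^ d * #{T ∈ U.powerset | f T ≠ 0} := by
  induction U using Finset.induction_on generalizing d f with
  | empty =>
    obtain ⟨T, hT, hfT⟩ := hne
    obtain rfl := subset_empty.1 hT
    have hd : d ≠ 0 := by
      rintro rfl
      exact hfT (by simpa using hf ∅ subset_rfl (Nat.zero_le _))
    have : 2 ^ 1 ≤ 2 ^ d := Nat.pow_le_pow_right two_pos (Nat.one_le_iff_ne_zero.2 hd)
    simpa [filter_singleton, hfT] using this
  | insert a U ha ih =>
    set f₁ : Finset σ → A := fun T => f (insert a T) with hf₁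
    have hmem : ∀ S ⊆ U, a ∉ S := fun S hS h => ha (hS h)
    have h₀ : ∀ S ⊆ U, d ≤ #S → ∑ T ∈ S.powerset, (-1 : ℤ) ^ #T • f T = 0 :=
      fun S hS => hf S (hS.trans (subset_insert _ _))
    have hsplit : ∀ S ⊆ U, d ≤ #S + 1 →
        ∑ T ∈ S.powerset, (-1 : ℤ) ^ #T • f T = ∑ T ∈ S.powerset, (-1 : ℤ) ^ #T • f₁ T := by
      intro S hS hd
      have h := hf (insert a S) (insert_subset_insert _ hS)
        (by rwa [card_insert_of_notMem (hmem S hS)])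
      rw [sum_powerset_insert (hmem S hS)] at h
      rw [← sub_eq_zero, sub_eq_add_neg, ← sum_neg_distrib, ← h]
      congr 1
      refine sum_congr rfl fun T hT => ?_
      rw [card_insert_of_notMem (hmem T ((mem_powerset.1 hT).trans hS)), pow_succ]
      simp [hf₁]
    have h₁ : ∀ S ⊆ U, d ≤ #S → ∑ T ∈ S.powerset, (-1 : ℤ) ^ #T • f₁ T = 0 :=
      fun S hS hd => (hsplit S hS (by omega)).symm.trans (h₀ S hS hd)
    have hcard : #{T ∈ (insert a U).powerset | f T ≠ 0} =
        #{T ∈ U.powerset | f T ≠ 0} + #{T ∈ U.powerset | f₁ T ≠ 0} := by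
      simp only [card_filter]
      exact sum_powerset_insert ha _
    have hle : ∀ g : Finset σ → A, #{T ∈ U.powerset | g T ≠ 0} ≤ 2 ^ #U := fun g =>
      (card_filter_le _ _).trans (card_powerset U).le
    rw [hcard, card_insert_of_notMem ha]
    have hone : ∀ g : Finset σ → A, (∃ T ⊆ U, g T ≠ 0) →
        (∀ S ⊆ U, d ≤ #S + 1 → ∑ T ∈ S.powerset, (-1 : ℤ) ^ #T • g T = 0) →
        2 ^ (#U + 1 + 1) ≤ 2 ^ d * #{T ∈ U.powerset | g T ≠ 0} := by
      intro g hg hg'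
      have := ih (d - 1) g (fun S hS hd => hg' S hS (by omega)) hg
      rcases d with _ | d
      · have h2 := hle g
        have h3 : 0 < 2 ^ #U := by positivity
        rw [pow_succ] at this
        simp only [zero_tsub, pow_zero, one_mul] at this
        omega
      · rw [Nat.add_sub_cancel] at this
        rw [pow_succ 2 (#U + 1), pow_succ 2 d]
        linarith
    by_cases e₀ : ∃ T ⊆ U, f T ≠ 0
    · by_cases e₁ : ∃ T ⊆ U, f₁ T ≠ 0
      · have i₀ := ih d f h₀ e₀
        have i₁ := ih d f₁ h₁ e₁
        rw [pow_succ 2 (#U + 1)]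
        linarith
      · push Not at e₁
        refine (hone f e₀ fun S hS hd => ?_).trans (Nat.mul_le_mul_left _ (Nat.le_add_right _ _))
        rw [hsplit S hS hd]
        exact sum_eq_zero fun T hT => by rw [e₁ T ((mem_powerset.1 hT).trans hS), smul_zero]
    · push Not at e₀
      have e₁ : ∃ T ⊆ U, f₁ T ≠ 0 := by
        obtain ⟨T, hT, hfT⟩ := hne
        by_cases haT : a ∈ T
        · exact ⟨T.erase a, subset_insert_iff.1 hT, by simpa only [hf₁, insert_erase haT] using hfT⟩
        · exact absurd (e₀ T ((subset_insert_iff_of_notMem haT).1 hT)) hfT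
      refine (hone f₁ e₁ fun S hS hd => ?_).trans (Nat.mul_le_mul_left _ (Nat.le_add_left _ _))
      rw [← hsplit S hS hd]
      exact sum_eq_zero fun T hT => by rw [e₀ T ((mem_powerset.1 hT).trans hS), smul_zero]

open Finset in
theorem MvPolynomial.alternating_sum_eval_indicator_eq_zero {σ R : Type*} [DecidableEq σ]
    [CommRing R] (F : MvPolynomial σ R) (S : Finset σ) (hS : F.totalDegree < #S) :
    ∑ T ∈ S.powerset, (-1 : ℤ) ^ #T • eval (fun i => if i ∈ T then (1 : R) else 0) F = 0 := by
  simp only [eval_eq, smul_sum]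
  rw [sum_comm]
  refine sum_eq_zero fun m hm => ?_
  obtain ⟨a, haS, ham⟩ : ∃ a ∈ S, a ∉ m.support := by
    refine exists_mem_notMem_of_card_lt_card (lt_of_le_of_lt ?_ hS)
    refine le_trans ?_ (le_totalDegree hm)
    rw [card_eq_sum_ones]
    exact sum_le_sum fun i hi => Nat.one_le_iff_ne_zero.2 (Finsupp.mem_support_iff.1 hi)
  rw [← insert_erase haS, sum_powerset_insert (notMem_erase a S), ← sum_add_distrib]
  refine sum_eq_zero fun T hT => ?_
  have haT : a ∉ T := fun h => notMem_erase a S (mem_powerset.1 hT h)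
  have : ∏ i ∈ m.support, (if i ∈ insert a T then (1 : R) else 0) ^ m i =
      ∏ i ∈ m.support, (if i ∈ T then (1 : R) else 0) ^ m i := by
    refine prod_congr rfl fun i hi => ?_
    have : i ≠ a := fun h => ham (h ▸ hi)
    simp [this]
  rw [this, card_insert_of_notMem haT, pow_succ]
  simp

section Dedekind

variable {R : Type*} [CommRing R] [IsDedekindDomain R]

theorem Ideal.mem_pow_iff_le_emultiplicity_span_singleton (I : Ideal R) (x : R) (k : ℕ) :
    x ∈ I ^ k ↔ (k : ℕ∞) ≤ emultiplicity I (Ideal.span {x}) := by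
  rw [← pow_dvd_iff_le_emultiplicity, Ideal.dvd_span_singleton]

theorem Ideal.emultiplicity_span_singleton_prod {I : Ideal R} (hI : Prime I) {ι : Type*}
    (s : Finset ι) (f : ι → R) :
    emultiplicity I (Ideal.span {∏ i ∈ s, f i}) =
      ∑ i ∈ s, emultiplicity I (Ideal.span {f i}) := by
  rw [← Ideal.prod_span_singleton, Finset.emultiplicity_prod hI]

/-- The `I`-adic valuation truncated at `v` factors through `R ⧸ I ^ v`. -/
theorem Ideal.exists_emultiplicity_eq_on_quotient_pow (I : Ideal R) (v : ℕ) :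
    ∃ u : R ⧸ I ^ v → ℕ, u 0 = v ∧ (∀ c ≠ 0, u c < v) ∧
      (∀ x, (u (Ideal.Quotient.mk _ x) : ℕ∞) ≤ emultiplicity I (Ideal.span {x})) ∧
      ∀ x, Ideal.Quotient.mk (I ^ v) x ≠ 0 →
        emultiplicity I (Ideal.span {x}) = u (Ideal.Quotient.mk _ x) := by
  classical
  let u : R ⧸ I ^ v → ℕ := fun c =>
    Nat.findGreatest (fun k => c ∈ (I ^ k).map (Ideal.Quotient.mk (I ^ v))) v
  have hiff : ∀ x, ∀ k ≤ v,
      (Ideal.Quotient.mk (I ^ v) x ∈ (I ^ k).map (Ideal.Quotient.mk (I ^ v)) ↔ x ∈ I ^ k) :=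
    fun x k hk => Ideal.mem_quotient_iff_mem (Ideal.pow_le_pow_right hk)
  have hle : ∀ c, u c ≤ v := fun c => Nat.findGreatest_le v
  have hmem : ∀ x, x ∈ I ^ u (Ideal.Quotient.mk _ x) := by
    intro x
    rw [← hiff x _ (hle _)]
    exact Nat.findGreatest_spec
      (P := fun k => Ideal.Quotient.mk (I ^ v) x ∈ (I ^ k).map (Ideal.Quotient.mk (I ^ v)))
      (Nat.zero_le v) ((hiff x 0 (Nat.zero_le v)).2 (by simp))
  have hlt : ∀ c ≠ 0, u c < v := by
    intro c hc
    obtain ⟨x, rfl⟩ := Ideal.Quotient.mk_surjective c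
    refine lt_of_le_of_ne (hle _) fun h => hc ?_
    have := hmem x
    rw [h] at this
    exact Ideal.Quotient.eq_zero_iff_mem.2 this
  refine ⟨u, le_antisymm (hle 0) (Nat.le_findGreatest le_rfl (Ideal.zero_mem _)), hlt,
    fun x => (I.mem_pow_iff_le_emultiplicity_span_singleton x _).1 (hmem x), fun x hx => ?_⟩
  rw [emultiplicity_eq_coe, Ideal.dvd_span_singleton, Ideal.dvd_span_singleton]
  refine ⟨hmem x, fun h => ?_⟩
  exact Nat.findGreatest_is_greatest (Nat.lt_succ_self _) (hlt _ hx)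
    ((hiff x _ (hlt _ hx)).2 h)

open Finset in
/-- The product of `t - a` over representatives `a` of the nonzero classes modulo `I ^ v` has
its smallest valuation exactly for `t ∈ I ^ v`. -/
theorem Ideal.exists_emultiplicity_prod_sub_out {I : Ideal R} (hI : Prime I) (v : ℕ)
    [Fintype (R ⧸ I ^ v)] [DecidableEq (R ⧸ I ^ v)] :
    ∃ N : ℕ, ∀ t : R,
      (t ∈ I ^ v → emultiplicity I (Ideal.span
        {∏ a ∈ (univ : Finset (R ⧸ I ^ v)).erase 0, (t - Quotient.out a)}) = N) ∧
      (t ∉ I ^ v → ((N + 1 : ℕ) : ℕ∞) ≤ emultiplicity I (Ideal.span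
        {∏ a ∈ (univ : Finset (R ⧸ I ^ v)).erase 0, (t - Quotient.out a)})) := by
  obtain ⟨u, hu0, hult, hule, hueq⟩ := I.exists_emultiplicity_eq_on_quotient_pow v
  have hmk : ∀ (t : R) (a : R ⧸ I ^ v), Ideal.Quotient.mk (I ^ v) (t - Quotient.out a) =
      Ideal.Quotient.mk (I ^ v) t - a := by
    intro t a
    rw [map_sub, Ideal.Quotient.mk_out]
  have hsum : ∀ b : R ⧸ I ^ v,
      ∑ a ∈ univ.erase 0, u (b - a) + u b = ∑ c ∈ univ.erase 0, u c + v := by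
    intro b
    have h1 := sum_erase_add univ (fun a => u (b - a)) (mem_univ 0)
    have h2 := sum_erase_add univ u (mem_univ 0)
    have h3 : ∑ a, u (b - a) = ∑ a, u a := Equiv.sum_comp (Equiv.subLeft b) u
    rw [sub_zero] at h1
    rw [h1, h3, ← h2, hu0]
  refine ⟨∑ c ∈ univ.erase 0, u c, fun t => ⟨fun ht => ?_, fun ht => ?_⟩⟩
  · have ht0 : Ideal.Quotient.mk (I ^ v) t = 0 := Ideal.Quotient.eq_zero_iff_mem.2 ht
    have h := hsum 0
    rw [hu0, Nat.add_right_cancel_iff] at h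
    rw [Ideal.emultiplicity_span_singleton_prod hI, ← h, Nat.cast_sum]
    refine sum_congr rfl fun a ha => ?_
    have := hmk t a
    rw [ht0] at this
    rw [hueq, this]
    rw [this, zero_sub]
    exact neg_ne_zero.2 (ne_of_mem_erase ha)
  · have ht0 : Ideal.Quotient.mk (I ^ v) t ≠ 0 := fun h => ht (Ideal.Quotient.eq_zero_iff_mem.1 h)
    have h := hsum (Ideal.Quotient.mk (I ^ v) t)
    have hlt := hult _ ht0
    rw [Ideal.emultiplicity_span_singleton_prod hI]
    calc ((∑ c ∈ univ.erase 0, u c + 1 : ℕ) : ℕ∞)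
        ≤ ((∑ a ∈ univ.erase 0, u (Ideal.Quotient.mk (I ^ v) t - a) : ℕ) : ℕ∞) := by
          exact_mod_cast (by omega)
      _ ≤ _ := by
          rw [Nat.cast_sum]
          exact sum_le_sum fun a _ => hmk t a ▸ hule (t - Quotient.out a)

open Finset in
/-- A system of congruences modulo powers of a prime `I` is detected by one polynomial modulo a
power of `I`. -/
theorem MvPolynomial.exists_totalDegree_le_eval_mem_pow_iff {I : Ideal R} (hI : Prime I)
    {ι σ : Type*} [Fintype ι] (v : ι → ℕ) [∀ j, Finite (R ⧸ I ^ v j)]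
    (P : ι → MvPolynomial σ R) :
    ∃ (F : MvPolynomial σ R) (N : ℕ),
      F.totalDegree ≤ ∑ j, (Nat.card (R ⧸ I ^ v j) - 1) * (P j).totalDegree ∧
      ∀ x, eval x F ∈ I ^ N ↔ ¬ ∀ j, eval x (P j) ∈ I ^ v j := by
  classical
  have _ := fun j => Fintype.ofFinite (R ⧸ I ^ v j)
  choose N hN using fun j => Ideal.exists_emultiplicity_prod_sub_out hI (v j)
  refine ⟨∏ j, ∏ a ∈ (univ : Finset (R ⧸ I ^ v j)).erase 0, (P j - C (Quotient.out a)),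
    ∑ j, N j + 1, ?_, fun x => ?_⟩
  · refine (totalDegree_finsetProd _ _).trans (sum_le_sum fun j _ => ?_)
    refine (totalDegree_finsetProd _ _).trans
      ((sum_le_card_nsmul _ _ _ fun a _ => totalDegree_sub_C_le _ _).trans ?_)
    rw [card_erase_of_mem (mem_univ _), card_univ, Nat.card_eq_fintype_card, smul_eq_mul]
  · simp only [map_prod, map_sub, eval_C]
    rw [Ideal.mem_pow_iff_le_emultiplicity_span_singleton,
      Ideal.emultiplicity_span_singleton_prod hI]
    refine ⟨fun h hx => ?_, fun hx => ?_⟩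
    · rw [sum_congr rfl fun j _ => (hN j _).1 (hx j), ← Nat.cast_sum, Nat.cast_le] at h
      omega
    · push Not at hx
      obtain ⟨j, hj⟩ := hx
      rw [← add_sum_erase univ N (mem_univ j), ← add_sum_erase univ _ (mem_univ j),
        add_right_comm, Nat.cast_add, Nat.cast_sum]
      refine add_le_add ((hN j _).2 hj) (sum_le_sum fun i _ => ?_)
      by_cases hi : eval x (P i) ∈ I ^ v i
      · exact ((hN i _).1 hi).ge
      · exact le_trans (by exact_mod_cast Nat.le_succ _) ((hN i _).2 hi)

end Dedekind


/-- **Boolean case of the Restricted Variable Warning's Second Theorem**: the number `z`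
of `x ∈ {0,1}ⁿ ⊆ Rⁿ` with `P_j(x) ∈ 𝔭^{v_j}` for all `j` satisfies `z = 0` or
`z ≥ 2^(n - ∑_j (q^{v_j}-1)·deg P_j)`. -/
theorem restricted_variable_warning_second_boolean
    (K : Type*) [Field K] [NumberField K]
    (𝔭 : Ideal (NumberField.RingOfIntegers K)) [𝔭.IsPrime] (h𝔭 : 𝔭 ≠ ⊥)
    (q : ℕ) (hq : q = Nat.card (NumberField.RingOfIntegers K ⧸ 𝔭))
    (n r : ℕ) (hn : 0 < n) (hr : 0 < r)
    (v : Fin r → ℕ) (hv : ∀ j, 0 < v j)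
    (P : Fin r → MvPolynomial (Fin n) (NumberField.RingOfIntegers K)) :
    Set.ncard {x : Fin n → NumberField.RingOfIntegers K | (∀ i, x i = 0 ∨ x i = 1) ∧
        ∀ j, MvPolynomial.eval x (P j) ∈ 𝔭 ^ v j} = 0 ∨
      (2 : ℝ) ^ ((n : ℤ) - ∑ j, ((q : ℤ) ^ v j - 1) * ((P j).totalDegree : ℤ)) ≤
        (Set.ncard {x : Fin n → NumberField.RingOfIntegers K | (∀ i, x i = 0 ∨ x i = 1) ∧
          ∀ j, MvPolynomial.eval x (P j) ∈ 𝔭 ^ v j} : ℝ) := by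
  classical
  have hp : Prime 𝔭 := Ideal.prime_of_isPrime h𝔭 inferInstance
  have hcard : ∀ k, Nat.card (NumberField.RingOfIntegers K ⧸ 𝔭 ^ k) = q ^ k := by
    intro k
    have := map_pow (Ideal.absNorm (S := NumberField.RingOfIntegers K)) 𝔭 k
    rw [hq]
    simpa only [Ideal.absNorm_apply, Submodule.cardQuot_apply] using this
  have hfin : ∀ j, Finite (NumberField.RingOfIntegers K ⧸ 𝔭 ^ v j) := fun j =>
    Ideal.finiteQuotientOfFreeOfNeBot _ (pow_ne_zero _ h𝔭)
  have hqpos : 0 < q := by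
    have := Ideal.finiteQuotientOfFreeOfNeBot 𝔭 h𝔭
    exact hq ▸ Nat.card_pos
  obtain ⟨F, N, hF, hFx⟩ := MvPolynomial.exists_totalDegree_le_eval_mem_pow_iff hp v P
  simp only [hcard] at hF
  set Z := {x : Fin n → NumberField.RingOfIntegers K | (∀ i, x i = 0 ∨ x i = 1) ∧
    ∀ j, MvPolynomial.eval x (P j) ∈ 𝔭 ^ v j} with hZ
  set D := ∑ j, (q ^ v j - 1) * (P j).totalDegree with hD
  let χ : Finset (Fin n) → Fin n → NumberField.RingOfIntegers K :=
    fun T i => if i ∈ T then 1 else 0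
  have hχ : Function.Injective χ := by
    intro S T h
    ext i
    have := congrFun h i
    by_cases hS : i ∈ S <;> by_cases hT : i ∈ T <;> simp_all [χ]
  let f : Finset (Fin n) → NumberField.RingOfIntegers K ⧸ 𝔭 ^ N :=
    fun T => Ideal.Quotient.mk _ (MvPolynomial.eval (χ T) F)
  have hf : ∀ T, f T ≠ 0 ↔ χ T ∈ Z := by
    intro T
    have hT : ∀ i, χ T i = 0 ∨ χ T i = 1 := fun i => by by_cases h : i ∈ T <;> simp [χ, h]
    rw [Ne, Ideal.Quotient.eq_zero_iff_mem, hFx, not_not]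
    exact ⟨fun h => ⟨hT, h⟩, fun h => h.2⟩
  have hsurj : ∀ x ∈ Z, ∃ T, χ T = x := by
    intro x hx
    refine ⟨Finset.univ.filter fun i => x i = 1, funext fun i => ?_⟩
    rcases hx.1 i with h | h <;> simp [χ, h]
  have hZimage : Z = χ '' (Finset.univ.powerset.filter fun T => f T ≠ 0 : Finset _) := by
    ext x
    constructor
    · intro hx
      obtain ⟨T, rfl⟩ := hsurj x hx
      exact ⟨T, by simpa using (hf T).2 hx, rfl⟩
    · rintro ⟨T, hT, rfl⟩
      exact (hf T).1 (Finset.mem_filter.1 hT).2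
  rcases Z.eq_empty_or_nonempty with hempty | ⟨x, hx⟩
  · left
    rw [hempty, Set.ncard_empty]
  right
  obtain ⟨T, rfl⟩ := hsurj x hx
  have key := two_pow_card_succ_le_of_alternating_sum_eq_zero Finset.univ (D + 1) f
    (fun S _ hS => by
      have h := F.alternating_sum_eval_indicator_eq_zero S (by omega)
      have h' := congrArg (Ideal.Quotient.mk (𝔭 ^ N)) h
      simpa only [map_sum, map_zsmul, map_zero] using h')
    ⟨T, Finset.subset_univ T, (hf T).2 hx⟩
  have hncard : Z.ncard = (Finset.univ.powerset.filter fun T => f T ≠ 0).card := by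
    rw [hZimage, Set.ncard_image_of_injective _ hχ, Set.ncard_coe_finset]
  rw [← hncard, Finset.card_univ, Fintype.card_fin, pow_succ, pow_succ] at key
  have key' : 2 ^ n ≤ 2 ^ D * Z.ncard := by linarith
  have hexp : ∑ j, ((q : ℤ) ^ v j - 1) * ((P j).totalDegree : ℤ) = (D : ℤ) := by
    rw [hD, Nat.cast_sum]
    refine Finset.sum_congr rfl fun j _ => ?_
    rw [Nat.cast_mul, Nat.cast_sub (Nat.one_le_pow _ _ hqpos), Nat.cast_pow, Nat.cast_one]
  rw [hexp, zpow_sub₀ two_ne_zero, zpow_natCast, zpow_natCast,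
    div_le_iff₀ (by positivity), mul_comm]
  exact_mod_cast key'
end

section
/- Let K be a number field with ring of integers R, let 𝔭 be a nonzero prime ideal of R, and let q = #(R/𝔭). Let n, r be positive integers, let v_1,…,v_r be positive integers, and let P_1,…,P_r ∈ R[t_1,…,t_n]. For 1 ≤ i ≤ n let A_i be a nonempty finite subset of R whose elements are pairwise incongruent modulo 𝔭, and put A = Π_{i=1}^n A_i. Let Z_A = {x ∈ A : P_j(x) ∈ 𝔭^{v_j} for all 1 ≤ j ≤ r} and z_A = #Z_A. If Σ_{j=1}^r (q^{v_j}−1)·deg(P_j) < Σ_{i=1}^n (#A_i − 1), then z_A ≠ 1. -/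
open Finset in
/-- If the elements of `A` are pairwise incongruent modulo the prime ideal `P`, there are weights
outside `P` annihilating all powers of exponent less than `#A - 1`. -/
theorem Ideal.IsPrime.exists_weights_sum_mul_pow_eq_zero {R : Type*} [CommRing R] [IsDomain R]
    {P : Ideal R} (hP : P.IsPrime) (A : Finset R)
    (hA : ∀ a ∈ A, ∀ b ∈ A, a - b ∈ P → a = b) :
    ∃ c : R → R, (∀ a ∈ A, c a ∉ P) ∧ ∀ m, m + 1 < #A → ∑ a ∈ A, c a * a ^ m = 0 := by
  classical
  let d : R → R := fun a => ∏ b ∈ A.erase a, (a - b)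
  have hd : ∀ a ∈ A, d a ∉ P := by
    intro a ha h
    obtain ⟨b, hb, hab⟩ := hP.prod_mem_iff.mp h
    obtain ⟨hba, hb⟩ := mem_erase.mp hb
    exact hba (hA a ha b hb hab).symm
  refine ⟨fun a => ∏ b ∈ A.erase a, d b, fun a ha h => ?_, fun m hm => ?_⟩
  · obtain ⟨b, hb, hab⟩ := hP.prod_mem_iff.mp h
    exact hd b (mem_of_mem_erase hb) hab
  · let φ := algebraMap R (FractionRing R)
    have hφ : Function.Injective φ := IsFractionRing.injective R (FractionRing R)
    have hdeg : (Polynomial.X ^ m : Polynomial (FractionRing R)).degree < #A := by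
      rw [Polynomial.degree_X_pow]
      exact_mod_cast (by lia : m < #A)
    have key := Lagrange.coeff_eq_sum (s := A) (v := φ) hφ.injOn hdeg
    rw [Polynomial.coeff_X_pow, if_neg (by lia)] at key
    apply hφ
    rw [map_zero, ← mul_zero (φ (∏ b ∈ A, d b)), key, map_sum, mul_sum]
    refine sum_congr rfl fun a ha => ?_
    have hne : φ (d a) ≠ 0 := by
      rw [Ne, map_eq_zero_iff φ hφ]
      exact fun h => hd a ha (h ▸ P.zero_mem)
    have hda : ∏ b ∈ A.erase a, (φ a - φ b) = φ (d a) := by simp [d]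
    rw [hda, ← mul_prod_erase A d ha, map_mul, map_mul, map_pow, Polynomial.eval_pow,
      Polynomial.eval_X]
    field_simp

open Finset in
/-- Weighted version of the coefficient formula: on a grid whose sides consist of elements
pairwise incongruent modulo `P`, some weights outside `P` annihilate all polynomials of
sufficiently small total degree. -/
theorem MvPolynomial.exists_weights_sum_mul_eval_eq_zero {R σ : Type*} [CommRing R] [IsDomain R]
    [Fintype σ] [DecidableEq σ] {P : Ideal R} (hP : P.IsPrime) (A : σ → Finset R)
    (hA : ∀ i, ∀ a ∈ A i, ∀ b ∈ A i, a - b ∈ P → a = b) :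
    ∃ c : (σ → R) → R, (∀ x ∈ Fintype.piFinset A, c x ∉ P) ∧
      ∀ F : MvPolynomial σ R, F.totalDegree < ∑ i, (#(A i) - 1) →
        ∑ x ∈ Fintype.piFinset A, c x * eval x F = 0 := by
  choose c hcP hc using fun i => hP.exists_weights_sum_mul_pow_eq_zero (A i) (hA i)
  refine ⟨fun x => ∏ i, c i (x i), fun x hx h => ?_, fun F hF => ?_⟩
  · obtain ⟨i, -, hi⟩ := hP.prod_mem_iff.mp h
    exact hcP i _ (Fintype.mem_piFinset.mp hx i) hi
  · simp_rw [eval_eq', mul_sum]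
    rw [sum_comm]
    refine sum_eq_zero fun d hd => ?_
    have hlt : ∑ i, d i < ∑ i, (#(A i) - 1) := by
      refine lt_of_le_of_lt ?_ hF
      simpa [Finsupp.sum_fintype] using le_totalDegree hd
    obtain ⟨i, -, hi⟩ := exists_lt_of_sum_lt hlt
    calc ∑ x ∈ Fintype.piFinset A, (∏ i, c i (x i)) * (coeff d F * ∏ i, x i ^ d i)
        = coeff d F * ∑ x ∈ Fintype.piFinset A, ∏ i, (c i (x i) * x i ^ d i) := by
          rw [mul_sum]
          refine sum_congr rfl fun x _ => ?_
          rw [prod_mul_distrib]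
          ring
      _ = coeff d F * ∏ i, ∑ a ∈ A i, c i a * a ^ d i := by rw [prod_univ_sum]
      _ = 0 := by rw [prod_eq_zero (mem_univ i) (hc i _ (by lia)), mul_zero]

/-- The order of vanishing of `x` at the ideal `P`. -/
noncomputable def Ideal.ordAt {R : Type*} [CommRing R] (P : Ideal R) (x : R) : ℕ∞ :=
  emultiplicity P (Ideal.span {x})

namespace Ideal

variable {R : Type*} [CommRing R] [IsDedekindDomain R] {P : Ideal R}

theorem natCast_le_ordAt {x : R} {k : ℕ} : (k : ℕ∞) ≤ P.ordAt x ↔ x ∈ P ^ k := by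
  rw [ordAt, ← pow_dvd_iff_le_emultiplicity, dvd_span_singleton]

theorem ordAt_lt_natCast {x : R} {k : ℕ} : P.ordAt x < k ↔ x ∉ P ^ k := by
  rw [← natCast_le_ordAt, not_le]

theorem ordAt_prod (hP : Prime P) {ι : Type*} (s : Finset ι) (f : ι → R) :
    P.ordAt (∏ i ∈ s, f i) = ∑ i ∈ s, P.ordAt (f i) := by
  rw [ordAt, ← prod_span_singleton, Finset.emultiplicity_prod hP]
  rfl

theorem ordAt_congr {x y : R} {v : ℕ} (hx : x ∉ P ^ v) (hxy : x - y ∈ P ^ v) :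
    P.ordAt x = P.ordAt y := by
  have hy : y ∉ P ^ v := fun h => hx (by simpa using add_mem hxy h)
  refine ENat.eq_of_forall_natCast_le_iff fun k => ?_
  rw [natCast_le_ordAt, natCast_le_ordAt]
  rcases le_total k v with hk | hk
  · have := pow_le_pow_right (I := P) hk hxy
    exact ⟨fun h => by simpa using sub_mem h this, fun h => by simpa using add_mem this h⟩
  · exact ⟨fun h => absurd (pow_le_pow_right hk h) hx, fun h => absurd (pow_le_pow_right hk h) hy⟩

open Finset in
/-- The product of `y - a` over representatives `a` of the nonzero classes modulo `P ^ v` has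
minimal order at `P` exactly when `y ∈ P ^ v`. -/
theorem exists_ordAt_prod_sub_out (hP : Prime P) (v : ℕ) [Fintype (R ⧸ P ^ v)]
    [DecidableEq (R ⧸ P ^ v)] :
    ∃ e : ℕ, ∀ y : R,
      (y ∈ P ^ v → P.ordAt (∏ c ∈ univ.erase (0 : R ⧸ P ^ v), (y - c.out)) = e) ∧
      (y ∉ P ^ v → (e : ℕ∞) < P.ordAt (∏ c ∈ univ.erase (0 : R ⧸ P ^ v), (y - c.out))) := by
  have hout (c : R ⧸ P ^ v) : Ideal.Quotient.mk (P ^ v) c.out = c := Quotient.out_eq' c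
  let o : R ⧸ P ^ v → ℕ∞ := fun c => P.ordAt c.out
  have ho : ∀ c, c ≠ 0 → o c < v := by
    intro c hc
    rw [ordAt_lt_natCast, ← Ideal.Quotient.eq_zero_iff_mem, hout]
    exact hc
  have hsub : ∀ (y : R) (c : R ⧸ P ^ v), c ≠ Ideal.Quotient.mk _ y →
      P.ordAt (y - c.out) = o (Ideal.Quotient.mk _ y - c) := by
    intro y c hc
    refine ordAt_congr (v := v) ?_ ?_
    · rw [← Ideal.Quotient.eq_zero_iff_mem, map_sub, hout, sub_eq_zero]
      exact hc.symm
    · rw [← Ideal.Quotient.eq_zero_iff_mem, map_sub, map_sub, hout, hout, sub_self]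
  have htop : ∑ c ∈ univ.erase 0, o c ≠ ⊤ :=
    ENat.sum_ne_top.mpr fun c hc => (ho c (ne_of_mem_erase hc)).ne_top
  obtain ⟨e, he⟩ := ENat.ne_top_iff_exists.mp htop
  have hreindex (b : R ⧸ P ^ v) : ∑ c ∈ univ.erase b, o (b - c) = e := by
    rw [he]
    refine sum_bij' (fun c _ => b - c) (fun c _ => b - c) ?_ ?_ ?_ ?_ ?_ <;>
      simp +contextual [sub_eq_zero, eq_comm (a := b)]
  refine ⟨e, fun y => ⟨fun hy => ?_, fun hy => ?_⟩⟩
  · rw [← Ideal.Quotient.eq_zero_iff_mem] at hy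
    rw [ordAt_prod hP, ← hreindex 0]
    refine sum_congr rfl fun c hc => ?_
    rw [hsub y c (hy ▸ ne_of_mem_erase hc), hy]
  · rw [← Ideal.Quotient.eq_zero_iff_mem] at hy
    set b := Ideal.Quotient.mk (P ^ v) y with hb
    have hlt : o b < P.ordAt (y - b.out) := by
      refine (ho b hy).trans_le ?_
      rw [natCast_le_ordAt, ← Ideal.Quotient.eq_zero_iff_mem, map_sub, hout, ← hb, sub_self]
    have hrest : ∑ c ∈ (univ.erase 0).erase b, P.ordAt (y - c.out) =
        ∑ c ∈ (univ.erase b).erase 0, o (b - c) := by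
      rw [erase_right_comm]
      refine sum_congr rfl fun c hc => hsub y c ?_
      exact ne_of_mem_erase (mem_of_mem_erase hc)
    have hsplit := hreindex b
    rw [← add_sum_erase _ _ (mem_erase.mpr ⟨Ne.symm hy, mem_univ (0 : R ⧸ P ^ v)⟩),
      sub_zero] at hsplit
    rw [ordAt_prod hP, ← add_sum_erase _ _ (mem_erase.mpr ⟨hy, mem_univ b⟩), hrest, ← hsplit]
    refine (ENat.add_lt_add_iff_right fun h => ?_).mpr hlt
    rw [h, add_top] at hsplit
    exact ENat.top_ne_natCast e hsplit

end Ideal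

open Finset in
theorem MvPolynomial.totalDegree_prod_sub_C_le {R σ ι : Type*} [CommRing R] (s : Finset ι)
    (a : ι → R) (p : MvPolynomial σ R) :
    (∏ i ∈ s, (p - C (a i))).totalDegree ≤ #s * p.totalDegree :=
  (totalDegree_finsetProd _ _).trans <|
    (sum_le_card_nsmul _ _ _ fun i _ => totalDegree_sub_C_le p (a i)).trans_eq (smul_eq_mul _ _)


/-- **Brink's Theorem over a number field**: if each `A_i ⊆ R` is nonempty finite with
elements pairwise incongruent mod `𝔭`, and `∑_j (q^{v_j}-1)·deg(P_j) < ∑_i (#A_i - 1)`,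
then the number of `x ∈ ∏ A_i` with `P_j(x) ∈ 𝔭^{v_j}` for all `j` is not `1`. -/
theorem brink_theorem_number_field
    (K : Type*) [Field K] [NumberField K]
    (𝔭 : Ideal (NumberField.RingOfIntegers K)) [𝔭.IsPrime] (h𝔭 : 𝔭 ≠ ⊥)
    (q : ℕ) (hq : q = Nat.card (NumberField.RingOfIntegers K ⧸ 𝔭))
    (n r : ℕ) (hn : 0 < n) (hr : 0 < r)
    (v : Fin r → ℕ) (hv : ∀ j, 0 < v j)
    (P : Fin r → MvPolynomial (Fin n) (NumberField.RingOfIntegers K))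
    (A : Fin n → Finset (NumberField.RingOfIntegers K)) (hA : ∀ i, (A i).Nonempty)
    (hAp : ∀ i, ∀ a ∈ A i, ∀ b ∈ A i, a - b ∈ 𝔭 → a = b)
    (hdeg : ∑ j, ((q : ℤ) ^ v j - 1) * ((P j).totalDegree : ℤ) <
      ∑ i, (((A i).card : ℤ) - 1)) :
    Set.ncard {x : Fin n → NumberField.RingOfIntegers K | (∀ i, x i ∈ A i) ∧
      ∀ j, MvPolynomial.eval x (P j) ∈ 𝔭 ^ v j} ≠ 1 := by
  classical
  intro hone
  obtain ⟨z, hz⟩ := Set.ncard_eq_one.mp hone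
  have hmem (x) : ((∀ i, x i ∈ A i) ∧ ∀ j, MvPolynomial.eval x (P j) ∈ 𝔭 ^ v j) ↔ x = z := by
    simpa using Set.ext_iff.mp hz x
  have hprime : Prime 𝔭 := Ideal.prime_of_isPrime h𝔭 inferInstance
  have hfin (j) : Finite (NumberField.RingOfIntegers K ⧸ 𝔭 ^ v j) :=
    Ideal.finiteQuotientOfFreeOfNeBot _ (pow_ne_zero _ h𝔭)
  let _ (j) : Fintype (NumberField.RingOfIntegers K ⧸ 𝔭 ^ v j) := Fintype.ofFinite _
  have hcard (j) : (Finset.univ.erase (0 : NumberField.RingOfIntegers K ⧸ 𝔭 ^ v j)).card + 1 =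
      q ^ v j := by
    rw [Finset.card_erase_add_one (Finset.mem_univ _), Finset.card_univ, ← Nat.card_eq_fintype_card,
      hq]
    exact cardQuot_pow_of_prime h𝔭
  choose e he using fun j => Ideal.exists_ordAt_prod_sub_out hprime (v j)
  let G (j) : MvPolynomial (Fin n) (NumberField.RingOfIntegers K) :=
    ∏ c ∈ Finset.univ.erase (0 : NumberField.RingOfIntegers K ⧸ 𝔭 ^ v j),
      (P j - MvPolynomial.C c.out)
  have hG (x) (j) : MvPolynomial.eval x (G j) =
      ∏ c ∈ Finset.univ.erase (0 : NumberField.RingOfIntegers K ⧸ 𝔭 ^ v j),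
        (MvPolynomial.eval x (P j) - c.out) := by
    simp [G]
  have hord (x) : 𝔭.ordAt (MvPolynomial.eval x (∏ j, G j)) =
      ∑ j, 𝔭.ordAt (MvPolynomial.eval x (G j)) := by
    rw [MvPolynomial.eval_prod, Ideal.ordAt_prod hprime]
  have hle (x) (j) : (e j : ℕ∞) ≤ 𝔭.ordAt (MvPolynomial.eval x (G j)) := by
    rw [hG]
    by_cases hx : MvPolynomial.eval x (P j) ∈ 𝔭 ^ v j
    · exact ((he j _).1 hx).ge
    · exact ((he j _).2 hx).le
  obtain ⟨hzA, hzP⟩ := (hmem z).mpr rfl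
  have hzord : 𝔭.ordAt (MvPolynomial.eval z (∏ j, G j)) = (∑ j, e j : ℕ) := by
    rw [hord, Nat.cast_sum]
    refine Finset.sum_congr rfl fun j _ => ?_
    rw [hG, (he j _).1 (hzP j)]
  have hxord (x) (hxA : ∀ i, x i ∈ A i) (hxz : x ≠ z) :
      MvPolynomial.eval x (∏ j, G j) ∈ 𝔭 ^ (∑ j, e j + 1) := by
    obtain ⟨j, hj⟩ : ∃ j, MvPolynomial.eval x (P j) ∉ 𝔭 ^ v j := by
      by_contra! h
      exact hxz ((hmem x).mp ⟨hxA, h⟩)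
    have hlt := (he j _).2 hj
    rw [← hG, ← ENat.add_one_le_iff (ENat.natCast_ne_top _)] at hlt
    rw [← Ideal.natCast_le_ordAt, hord, ← Finset.add_sum_erase _ e (Finset.mem_univ j), add_right_comm,
      ← Finset.add_sum_erase _ (fun k => 𝔭.ordAt _) (Finset.mem_univ j)]
    push_cast
    exact add_le_add hlt (Finset.sum_le_sum fun k _ => hle x k)
  obtain ⟨c, hcP, hc⟩ := MvPolynomial.exists_weights_sum_mul_eval_eq_zero ‹𝔭.IsPrime› A hAp
  have hsum := hc (∏ j, G j) <| by
    have hdegG : (∏ j, G j).totalDegree ≤ ∑ j, (q ^ v j - 1) * (P j).totalDegree := by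
      refine (MvPolynomial.totalDegree_finsetProd _ _).trans (Finset.sum_le_sum fun j _ => ?_)
      rw [← hcard j, Nat.add_sub_cancel]
      exact MvPolynomial.totalDegree_prod_sub_C_le _ _ _
    refine hdegG.trans_lt ?_
    zify
    convert! hdeg using 1
    · refine Finset.sum_congr rfl fun j _ => ?_
      rw [Nat.cast_sub (by have := hcard j; lia)]
      push_cast
      rfl
    · exact Finset.sum_congr rfl fun i _ => by simpa using Nat.cast_sub (hA i).card_pos
  have hzmem : z ∈ Fintype.piFinset A := Fintype.mem_piFinset.mpr hzA
  rw [← Finset.add_sum_erase _ _ hzmem] at hsum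
  have hczF : c z * MvPolynomial.eval z (∏ j, G j) ∈ 𝔭 ^ (∑ j, e j + 1) := by
    rw [eq_neg_of_add_eq_zero_left hsum]
    refine neg_mem (sum_mem fun x hx => Ideal.mul_mem_left _ _ ?_)
    obtain ⟨hxz, hxA⟩ := Finset.mem_erase.mp hx
    exact hxord x (Fintype.mem_piFinset.mp hxA) hxz
  rw [mul_comm] at hczF
  refine hcP z hzmem (Ideal.mem_prime_of_mul_mem_pow h𝔭 ?_ hczF)
  rw [← Ideal.ordAt_lt_natCast, hzord]
  exact_mod_cast Nat.lt_succ_self _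
end

section
/- Let n be a positive integer, let a_1 ≥ a_2 ≥ … ≥ a_n ≥ 1 be integers, and let N be an integer with n ≤ N ≤ a_1 + … + a_n. Put M = N − n, and let k be the largest index with 0 ≤ k ≤ n such that Σ_{i=1}^k (a_i − 1) ≤ M. Then m(a_1,…,a_n;N) = (Π_{i=1}^k a_i) · (1 + M − Σ_{i=1}^k (a_i − 1)) if k < n, and m(a_1,…,a_n;N) = Π_{i=1}^n a_i if k = n. In other words, the greedy configuration — place one ball in each bin, then fill the bins completely from largest to smallest until the balls run out — achieves the minimum product among all distributions of N balls in bins of capacities a_1,…,a_n. -/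
open Finset in
@[to_additive]
theorem prod_update_update_eq {ι M : Type*} [Fintype ι] [DecidableEq ι] [CommMonoid M]
    (g : ι → ℕ → M) (y : ι → ℕ) {i j : ι} (hij : i ≠ j) (u v : ℕ) :
    ∏ x, g x (Function.update (Function.update y i u) j v x) =
      g i u * (g j v * ∏ x ∈ (univ.erase i).erase j, g x (y x)) := by
  rw [← mul_prod_erase univ _ (mem_univ i),
    ← mul_prod_erase (univ.erase i) _ (mem_erase.2 ⟨hij.symm, mem_univ j⟩)]
  congr 1
  · simp [hij]
  congr 1
  · simp
  refine prod_congr rfl fun x hx => ?_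
  simp only [mem_erase, mem_univ, and_true] at hx
  simp [hx.1, hx.2]

open Finset in
@[to_additive]
theorem prod_eq_mul_mul_prod_erase_erase {ι M : Type*} [Fintype ι] [DecidableEq ι] [CommMonoid M]
    (g : ι → ℕ → M) (y : ι → ℕ) {i j : ι} (hij : i ≠ j) :
    ∏ x, g x (y x) =
      g i (y i) * (g j (y j) * ∏ x ∈ (univ.erase i).erase j, g x (y x)) := by
  simpa using prod_update_update_eq g y hij (y i) (y j)

/-- The distributions of `N` balls in bins of capacities `a`. -/
def ballDistributions {n : ℕ} (a : Fin n → ℕ) (N : ℕ) : Finset (Fin n → ℕ) :=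
  (Fintype.piFinset fun i => Finset.Icc 1 (a i)).filter fun y => ∑ i, y i = N

theorem mem_ballDistributions {n : ℕ} {a : Fin n → ℕ} {N : ℕ} {y : Fin n → ℕ} :
    y ∈ ballDistributions a N ↔ (∀ i, 1 ≤ y i ∧ y i ≤ a i) ∧ ∑ i, y i = N := by
  simp [ballDistributions]

theorem ballDistributions_nonempty {n : ℕ} {a : Fin n → ℕ} (ha : ∀ i, 1 ≤ a i) {N : ℕ}
    (hnN : n ≤ N) (hN : N ≤ ∑ i, a i) : (ballDistributions a N).Nonempty := by
  induction N, hnN using Nat.le_induction with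
  | base => exact ⟨fun _ => 1, mem_ballDistributions.2 ⟨fun i => ⟨le_rfl, ha i⟩, by simp⟩⟩
  | succ N _ ih =>
    obtain ⟨y, hy⟩ := ih (by omega)
    obtain ⟨hy, hsum⟩ := mem_ballDistributions.1 hy
    obtain ⟨i, -, hi⟩ := Finset.exists_lt_of_sum_lt (show ∑ i, y i < ∑ i, a i by omega)
    refine ⟨Function.update y i (y i + 1), mem_ballDistributions.2 ⟨fun x => ?_, ?_⟩⟩
    · rcases eq_or_ne x i with rfl | hx
      · simpa using hi
      · simpa [hx] using hy x
    · rw [Finset.sum_update_of_mem (Finset.mem_univ i), ← hsum,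
        ← Finset.add_sum_erase _ y (Finset.mem_univ i), Finset.sdiff_singleton_eq_erase]
      ring

/-- Replacing two entries of a distribution by admissible ones with the same sum gives a
distribution. -/
theorem update_update_mem_ballDistributions {n : ℕ} {a : Fin n → ℕ} {N : ℕ} {y : Fin n → ℕ}
    (hy : y ∈ ballDistributions a N) {i j : Fin n} (hij : i ≠ j) {u v : ℕ}
    (hu : 1 ≤ u ∧ u ≤ a i) (hv : 1 ≤ v ∧ v ≤ a j) (huv : u + v = y i + y j) :
    Function.update (Function.update y i u) j v ∈ ballDistributions a N := by
  obtain ⟨hy, hsum⟩ := mem_ballDistributions.1 hy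
  refine mem_ballDistributions.2 ⟨fun x => ?_, ?_⟩
  · rcases eq_or_ne x j with rfl | hxj
    · simpa using hv
    rcases eq_or_ne x i with rfl | hxi
    · simpa [hxj] using hu
    · simpa [hxj, hxi] using hy x
  · have h₁ := sum_update_update_eq (fun _ m => m) y hij u v
    have h₂ := sum_eq_add_add_sum_erase_erase (fun _ m => m) y hij
    omega

/-- Some distribution of minimal product fills the bins in order. -/
theorem exists_isLeast_prod_ballDistributions {n : ℕ} {a : Fin n → ℕ} (ha : ∀ i, 1 ≤ a i)
    (hmono : Antitone a) {N : ℕ} (hnN : n ≤ N) (hN : N ≤ ∑ i, a i) :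
    ∃ y ∈ ballDistributions a N, (∀ z ∈ ballDistributions a N, ∏ i, y i ≤ ∏ i, z i) ∧
      ∀ i j, i < j → y i = a i ∨ y j = 1 := by
  obtain ⟨y, hyN, hmin⟩ := Finset.exists_min_image (ballDistributions a N)
    (fun y => toLex (∏ i, y i, ∑ i : Fin n, (i : ℕ) * y i)) (ballDistributions_nonempty ha hnN hN)
  simp only [Prod.Lex.toLex_le_toLex] at hmin
  have hy := (mem_ballDistributions.1 hyN).1
  refine ⟨y, hyN, fun z hz => (hmin z hz).elim le_of_lt fun h => h.1.le, fun i j hij => ?_⟩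
  by_contra! h
  have hi : y i < a i := lt_of_le_of_ne (hy i).2 h.1
  have hj : 1 < y j := lt_of_le_of_ne (hy j).1 h.2.symm
  have hprod := prod_eq_mul_mul_prod_erase_erase (fun _ m => m) y hij.ne
  have hR : 0 < ∏ x ∈ (Finset.univ.erase i).erase j, y x :=
    Finset.prod_pos fun x _ => (hy x).1
  rcases le_or_gt (y j) (y i) with hle | hlt
  · have hz := hmin _ (update_update_mem_ballDistributions hyN hij.ne
      (u := y i + 1) (v := y j - 1) (by omega) (by have := hy j; omega) (by omega))
    have hz₁ := prod_update_update_eq (fun _ m => m) y hij.ne (y i + 1) (y j - 1)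
    have hlt : (y i + 1) * (y j - 1) < y i * y j := by
      obtain ⟨m, hm⟩ := Nat.exists_eq_add_of_lt hj
      rw [show y j - 1 = m + 1 by omega, show y j = m + 1 + 1 by omega]
      nlinarith
    have := Nat.mul_lt_mul_of_pos_right hlt hR
    rw [hz₁, hprod, ← mul_assoc, ← mul_assoc] at hz
    omega
  · have hji := hmono hij.le
    have hz := hmin _ (update_update_mem_ballDistributions hyN hij.ne
      (u := y j) (v := y i) (by have := hy j; omega) (by have := hy j; have := hy i; omega)
      (by omega))
    have hz₁ := prod_update_update_eq (fun _ m => m) y hij.ne (y j) (y i)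
    have hw := sum_eq_add_add_sum_erase_erase (fun (x : Fin n) m => (x : ℕ) * m) y hij.ne
    have hz₂ := sum_update_update_eq (fun (x : Fin n) m => (x : ℕ) * m) y hij.ne (y j) (y i)
    have heq : y j * (y i * ∏ x ∈ (Finset.univ.erase i).erase j, y x) =
      y i * (y j * ∏ x ∈ (Finset.univ.erase i).erase j, y x) := by ring
    rw [hz₁, hprod, hw, hz₂, heq] at hz
    have hij' : (i : ℕ) < j := hij
    have : (i : ℕ) * y j + j * y i < i * y i + j * y j := by nlinarith
    omega

theorem mBB_eq_of_forall_le {n : ℕ} {a : Fin n → ℕ} {N : ℕ} (hnN : n ≤ N) (hN : N ≤ ∑ i, a i)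
    {y : Fin n → ℕ} (hy : y ∈ ballDistributions a N)
    (hmin : ∀ z ∈ ballDistributions a N, ∏ i, y i ≤ ∏ i, z i) : mBB n a N = ∏ i, y i := by
  rw [mBB, if_neg (by exact_mod_cast hnN.not_gt), if_neg (by exact_mod_cast hN.not_gt)]
  refine IsLeast.csInf_eq ⟨?_, ?_⟩
  · obtain ⟨hy, hsum⟩ := mem_ballDistributions.1 hy
    exact ⟨y, hy, by exact_mod_cast hsum, rfl⟩
  · rintro _ ⟨z, hz, hsum, rfl⟩
    exact hmin z (mem_ballDistributions.2 ⟨hz, by exact_mod_cast hsum⟩)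

/-- The greedy configuration achieves the minimum: for `a₁ ≥ … ≥ a_n ≥ 1` and
`n ≤ N ≤ a₁+⋯+a_n`, with `M = N - n` and `k` the largest index with
`∑_{i≤k} (a_i - 1) ≤ M`, one has `m(a₁,…,a_n;N) = (∏_{i≤k} a_i)·(1 + M - ∑_{i≤k} (a_i-1))`
if `k < n`, and `m(a₁,…,a_n;N) = ∏_i a_i` if `k = n`. -/
theorem mBB_greedy
    (n : ℕ) (hn : 0 < n) (a : Fin n → ℕ) (ha : ∀ i, 1 ≤ a i)
    (hmono : ∀ i j : Fin n, i ≤ j → a j ≤ a i)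
    (N : ℕ) (hN1 : n ≤ N) (hN2 : N ≤ ∑ i, a i)
    (k : ℕ) (hkn : k ≤ n)
    (hk : ∑ i ∈ Finset.univ.filter (fun i : Fin n => (i : ℕ) < k), (a i - 1) ≤ N - n)
    (hkmax : ∀ k' : ℕ, k' ≤ n →
      ∑ i ∈ Finset.univ.filter (fun i : Fin n => (i : ℕ) < k'), (a i - 1) ≤ N - n →
      k' ≤ k) :
    mBB n a (N : ℤ) =
      if k < n then
        (∏ i ∈ Finset.univ.filter (fun i : Fin n => (i : ℕ) < k), a i) *
          (1 + ((N - n) - ∑ i ∈ Finset.univ.filter (fun i : Fin n => (i : ℕ) < k), (a i - 1)))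
      else ∏ i, a i := by
  obtain ⟨y, hyN, hmin, hfill⟩ :=
    exists_isLeast_prod_ballDistributions ha (fun i j h => hmono i j h) hN1 hN2
  rw [mBB_eq_of_forall_le hN1 hN2 hyN hmin]
  obtain ⟨hy, hsum⟩ := mem_ballDistributions.1 hyN
  have hexc : ∑ i, (y i - 1) = N - n := by
    rw [Finset.sum_tsub_distrib _ fun i _ => (hy i).1]
    simp [hsum]
  have hlow : ∀ i : Fin n, (i : ℕ) < k → y i = a i := by
    intro i hik
    by_contra hne
    have hlt : ∑ x, (y x - 1) <
        ∑ x ∈ Finset.univ.filter (fun x : Fin n => (x : ℕ) < k), (a x - 1) := by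
      rw [Finset.sum_filter]
      refine Finset.sum_lt_sum (fun x _ => ?_) ⟨i, Finset.mem_univ i, ?_⟩
      · split_ifs with hx
        · exact Nat.sub_le_sub_right (hy x).2 1
        · have hix : i < x := by rw [Fin.lt_def]; omega
          have := (hfill i x hix).resolve_left hne
          omega
      · have := hy i
        rw [if_pos hik]
        omega
    omega
  split_ifs with hkn'
  · have hhigh : ∀ j : Fin n, k < (j : ℕ) → y j = 1 := by
      intro j hkj
      by_contra hne
      have hle : ∑ x ∈ Finset.univ.filter (fun x : Fin n => (x : ℕ) < k + 1), (a x - 1) ≤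
          ∑ x, (y x - 1) := by
        rw [Finset.sum_filter]
        refine Finset.sum_le_sum fun x _ => ?_
        split_ifs with hx
        · have hxj : x < j := by rw [Fin.lt_def]; omega
          rw [(hfill x j hxj).resolve_right hne]
        · exact Nat.zero_le _
      have := hkmax (k + 1) hkn' (hexc ▸ hle)
      omega
    have hy_at : 1 + ((N - n) -
        ∑ i ∈ Finset.univ.filter (fun i : Fin n => (i : ℕ) < k), (a i - 1)) = y ⟨k, hkn'⟩ := by
      have hsplit := Finset.sum_filter_add_sum_filter_not Finset.univ
        (fun i : Fin n => (i : ℕ) < k) (fun i => y i - 1)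
      have hrest : ∑ i ∈ Finset.univ.filter (fun i : Fin n => ¬ (i : ℕ) < k), (y i - 1) =
          y ⟨k, hkn'⟩ - 1 := by
        refine Finset.sum_eq_single _ (fun j hj hjk => ?_) (by simp)
        have : (j : ℕ) ≠ k := fun h => hjk (Fin.ext h)
        have := (Finset.mem_filter.1 hj).2
        simp [hhigh j (by omega)]
      rw [Finset.sum_congr rfl fun i hi => by rw [hlow i (Finset.mem_filter.1 hi).2],
        hrest, hexc] at hsplit
      have := (hy ⟨k, hkn'⟩).1
      omega
    rw [hy_at, ← Finset.prod_filter_mul_prod_filter_not Finset.univ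
      (fun i : Fin n => (i : ℕ) < k) y]
    congr 1
    · exact Finset.prod_congr rfl fun i hi => hlow i (Finset.mem_filter.1 hi).2
    · refine Finset.prod_eq_single _ (fun j hj hjk => ?_) (by simp)
      have : (j : ℕ) ≠ k := fun h => hjk (Fin.ext h)
      have := (Finset.mem_filter.1 hj).2
      exact hhigh j (by omega)
  · exact Finset.prod_congr rfl fun i _ => hlow i (by omega)
end

section
/- Let n be a positive integer, let a ≥ 2 be an integer, and let N be an integer with n ≤ N ≤ an. Write N − n = k(a−1) + R with k = ⌊(N−n)/(a−1)⌋ and 0 ≤ R < a−1. Then m(a,a,…,a;N) = (R+1)·a^k (with n copies of a). -/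
/-- The product of the greedy filling: distributing `s` extra balls over bins that already
hold one ball each and have room for `d` more, filling the bins one after another. -/
def greedyProd (d s : ℕ) : ℕ := (s % d + 1) * (d + 1) ^ (s / d)

theorem greedyProd_of_lt {d s : ℕ} (h : s < d) : greedyProd d s = s + 1 := by
  simp [greedyProd, Nat.mod_eq_of_lt h, Nat.div_eq_of_lt h]

theorem greedyProd_add_self {d : ℕ} (hd : 0 < d) (s : ℕ) :
    greedyProd d (s + d) = (d + 1) * greedyProd d s := by
  simp only [greedyProd, Nat.add_mod_right, Nat.add_div_right s hd, pow_succ]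
  ring

theorem greedyProd_add_le {d x : ℕ} (hd : 0 < d) (hx : x ≤ d) (s : ℕ) :
    greedyProd d (s + x) ≤ greedyProd d s * (x + 1) := by
  induction s using Nat.strong_induction_on with
  | _ s ih =>
    rcases lt_or_ge s d with hs | hs
    · rw [greedyProd_of_lt hs]
      rcases lt_or_ge (s + x) d with h | h
      · rw [greedyProd_of_lt h]
        nlinarith [Nat.zero_le (s * x)]
      · obtain ⟨t, ht⟩ := Nat.exists_eq_add_of_le h
        rw [ht, add_comm d t, greedyProd_add_self hd, greedyProd_of_lt (by lia)]
        obtain ⟨u, rfl⟩ := Nat.exists_eq_add_of_le hx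
        obtain rfl : s = t + u := by lia
        nlinarith [Nat.zero_le (t * u), Nat.zero_le (u * x)]
    · obtain ⟨t, rfl⟩ := Nat.exists_eq_add_of_le' hs
      rw [add_right_comm, greedyProd_add_self hd, greedyProd_add_self hd, mul_assoc]
      exact Nat.mul_le_mul_left _ (ih t (by lia))

theorem greedyProd_sum_le_prod {ι : Type*} {d : ℕ} (hd : 0 < d) (t : Finset ι) (x : ι → ℕ)
    (hx : ∀ i, x i ≤ d) : greedyProd d (∑ i ∈ t, x i) ≤ ∏ i ∈ t, (x i + 1) := by
  classical
  induction t using Finset.induction_on with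
  | empty => simp [greedyProd_of_lt hd]
  | insert i t hi ih =>
    rw [Finset.sum_insert hi, Finset.prod_insert hi, add_comm, mul_comm]
    exact (greedyProd_add_le hd (hx i) _).trans (Nat.mul_le_mul_right _ ih)

theorem exists_prod_eq_greedyProd {d : ℕ} (hd : 0 < d) (n s : ℕ) (hs : s ≤ d * n) :
    ∃ x : Fin n → ℕ, (∀ i, x i ≤ d) ∧ ∑ i, x i = s ∧ ∏ i, (x i + 1) = greedyProd d s := by
  induction n generalizing s with
  | zero =>
    obtain rfl : s = 0 := by simpa using hs
    exact ⟨0, by simp, by simp, by simp [greedyProd_of_lt hd]⟩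
  | succ n ih =>
    rw [mul_add_one] at hs
    rcases lt_or_ge s d with h | h
    · obtain ⟨x, hx, hsum, hprod⟩ := ih 0 (Nat.zero_le _)
      refine ⟨Fin.cons s x, Fin.cases h.le hx, ?_, ?_⟩
      · simp [Fin.sum_univ_succ, hsum]
      · simp [Fin.prod_univ_succ, hprod, greedyProd_of_lt hd, greedyProd_of_lt h]
    · obtain ⟨t, rfl⟩ := Nat.exists_eq_add_of_le' h
      obtain ⟨x, hx, hsum, hprod⟩ := ih t (by lia)
      refine ⟨Fin.cons d x, Fin.cases le_rfl hx, ?_, ?_⟩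
      · simp [Fin.sum_univ_succ, hsum, add_comm]
      · simp [Fin.prod_univ_succ, hprod, greedyProd_add_self hd]

/-- In the equal-bins case with `a ≥ 2` and `n ≤ N ≤ an`: writing
`N - n = k(a-1) + R` with `k = ⌊(N-n)/(a-1)⌋` and `0 ≤ R < a-1`, one has
`m(a,…,a;N) = (R+1)·a^k`. -/
theorem mBB_equal_bins
    (n : ℕ) (hn : 0 < n) (a : ℕ) (ha : 2 ≤ a)
    (N : ℕ) (hN1 : n ≤ N) (hN2 : N ≤ a * n) :
    mBB n (fun _ => a) (N : ℤ) = ((N - n) % (a - 1) + 1) * a ^ ((N - n) / (a - 1)) := by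
  obtain ⟨d, rfl⟩ := Nat.exists_eq_add_of_le' (one_le_two.trans ha)
  obtain ⟨s, rfl⟩ := Nat.exists_eq_add_of_le' hN1
  have hd : 0 < d := by lia
  have hs : s ≤ d * n := by rw [add_one_mul] at hN2; lia
  have hcap : ¬ (∑ _i : Fin n, ((d + 1 : ℕ) : ℤ)) < ((s + n : ℕ) : ℤ) := by
    rw [not_lt, ← Nat.cast_sum, Nat.cast_le]
    simpa [mul_comm n] using hN2
  rw [mBB, if_neg (by lia), if_neg hcap, Nat.add_sub_cancel, Nat.add_sub_cancel]
  change _ = greedyProd d s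
  refine IsLeast.csInf_eq ⟨?_, ?_⟩
  · obtain ⟨x, hx, hsum, hprod⟩ := exists_prod_eq_greedyProd hd n s hs
    refine ⟨fun i => x i + 1, fun i => ⟨by lia, Nat.succ_le_succ (hx i)⟩, ?_, hprod.symm⟩
    rw [← Nat.cast_sum, Finset.sum_add_distrib, hsum]
    simp
  · rintro P ⟨y, hy, hsum, rfl⟩
    have hsucc : ∀ i, y i - 1 + 1 = y i := fun i => Nat.sub_add_cancel (hy i).1
    have hsub : ∑ i, (y i - 1) = s := by
      have h : ∑ i, (y i - 1 + 1) = s + n := by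
        simp only [hsucc]
        exact_mod_cast hsum
      simpa [Finset.sum_add_distrib] using h
    simpa [hsub, hsucc] using
      greedyProd_sum_le_prod hd Finset.univ (fun i => y i - 1) fun i => by grind
end

section
/- Let p be a prime, let n and v be positive integers, and for 1 ≤ i ≤ n let A_i ⊆ ℤ be a complete set of coset representatives of pℤ in ℤ; put A = Π_{i=1}^n A_i. Let f ∈ ℤ[t_1,…,t_n] be a nonzero polynomial of degree d. Then there exist polynomials f_1,…,f_v ∈ 𝔽_p[t_1,…,t_n] with deg f_i ≤ p^{i−1}·d for 1 ≤ i ≤ v, such that for all x ∈ A: f(x) ≡ 0 (mod p^v) if and only if f_i(x mod p) = 0 in 𝔽_p for all 1 ≤ i ≤ v. -/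
namespace MvPolynomial

theorem totalDegree_aeval_le_s12 {σ τ R : Type*} [CommSemiring R] (y : σ → MvPolynomial τ R) (k : ℕ)
    (hy : ∀ i, (y i).totalDegree ≤ k) (f : MvPolynomial σ R) :
    (aeval y f).totalDegree ≤ k * f.totalDegree := by
  rw [aeval_def, eval₂_eq]
  refine totalDegree_finsetSum_le fun d hd => ?_
  refine (totalDegree_mul _ _).trans ?_
  rw [algebraMap_eq, totalDegree_C, zero_add]
  refine (totalDegree_finsetProd _ _).trans ?_
  calc ∑ i ∈ d.support, (y i ^ d i).totalDegree
      ≤ ∑ i ∈ d.support, k * d i := Finset.sum_le_sum fun i _ =>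
        (totalDegree_pow _ _).trans (by rw [mul_comm]; exact Nat.mul_le_mul_right _ (hy i))
    _ = k * d.degree := by rw [Finsupp.degree_apply, Finset.mul_sum]
    _ ≤ k * f.totalDegree := Nat.mul_le_mul_left _ (le_totalDegree hd)

/-- Every function of one variable on `ZMod p` is given by an integer polynomial
of degree at most `p - 1`. -/
theorem exists_eval₂_intCast_eq {σ : Type*} (p : ℕ) [Fact p.Prime] (i : σ) (h : ZMod p → ZMod p) :
    ∃ q : MvPolynomial σ ℤ, q.totalDegree ≤ p - 1 ∧
      ∀ c : σ → ZMod p, eval₂ (Int.castRingHom (ZMod p)) c q = h (c i) := by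
  refine ⟨∑ a : ZMod p, C ((h a).val : ℤ) * (1 - (X i - C (a.val : ℤ)) ^ (p - 1)), ?_, ?_⟩
  · refine totalDegree_finsetSum_le fun a _ => (totalDegree_mul _ _).trans ?_
    rw [totalDegree_C, zero_add]
    refine (totalDegree_sub _ _).trans (max_le (by simp) ((totalDegree_pow _ _).trans ?_))
    refine (Nat.mul_le_mul_left _ ((totalDegree_sub_C_le _ _).trans ?_)).trans (mul_one _).le
    rw [totalDegree_X]
  · intro c
    have hp1 : p - 1 ≠ 0 := Nat.sub_ne_zero_of_lt (Fact.out : p.Prime).one_lt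
    have hev (a : ZMod p) : eval₂ (Int.castRingHom (ZMod p)) c
        (C ((h a).val : ℤ) * (1 - (X i - C (a.val : ℤ)) ^ (p - 1))) =
        h a * (1 - (c i - a) ^ (p - 1)) := by
      simp only [eval₂_mul, eval₂_sub, eval₂_pow, eval₂_one, eval₂_C, eval₂_X,
        Int.coe_castRingHom, Int.cast_natCast, ZMod.natCast_zmod_val]
    simp only [eval₂_sum, hev]
    rw [Finset.sum_eq_single (c i)]
    · simp only [sub_self, zero_pow hp1, sub_zero, mul_one]
    · intro a _ ha
      simp [ZMod.pow_card_sub_one_eq_one (sub_ne_zero.mpr ha.symm)]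
    · simp

end MvPolynomial

namespace WittVector

variable {p : ℕ} [Fact p.Prime]

open MvPolynomial in
/-- A bound on the degrees of the ghost components of a Witt vector of integer polynomials
is inherited by its coefficients. -/
theorem totalDegree_coeff_le {σ : Type*} (F : WittVector p (MvPolynomial σ ℤ)) (D : ℕ)
    (hF : ∀ m, (ghostComponent m F).totalDegree ≤ p ^ m * D) (m : ℕ) :
    (F.coeff m).totalDegree ≤ p ^ m * D := by
  induction m using Nat.strong_induction_on with
  | _ m ih =>
    have hp0 : ((p : ℤ) ^ m) ≠ 0 := pow_ne_zero _ (by exact_mod_cast (Fact.out : p.Prime).ne_zero)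
    have key : C ((p : ℤ) ^ m) * F.coeff m = ghostComponent m F -
        ∑ i ∈ Finset.range m, C ((p : ℤ) ^ i) * F.coeff i ^ p ^ (m - i) := by
      rw [ghostComponent_apply, aeval_wittPolynomial, Finset.sum_range_succ]
      simp
    have hdeg : (C ((p : ℤ) ^ m) * F.coeff m).totalDegree ≤ p ^ m * D := by
      rw [key]
      refine (totalDegree_sub _ _).trans (max_le (hF m) (totalDegree_finsetSum_le fun i hi => ?_))
      have him := Finset.mem_range.mp hi
      refine (totalDegree_mul _ _).trans ?_
      rw [totalDegree_C, zero_add]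
      calc _ ≤ p ^ (m - i) * (F.coeff i).totalDegree := totalDegree_pow _ _
        _ ≤ p ^ (m - i) * (p ^ i * D) := Nat.mul_le_mul_left _ (ih i him)
        _ = p ^ m * D := by rw [← mul_assoc, ← pow_add, Nat.sub_add_cancel him.le]
    by_cases h0 : F.coeff m = 0
    · simp [h0]
    · rwa [totalDegree_mul_of_isDomain (by simpa using hp0) h0, totalDegree_C, zero_add] at hdeg

open MvPolynomial in
theorem totalDegree_ghostComponent_le {σ : Type*} (F : WittVector p (MvPolynomial σ ℤ)) (D : ℕ)
    (hF : ∀ m, (F.coeff m).totalDegree ≤ p ^ m * D) (m : ℕ) :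
    (ghostComponent m F).totalDegree ≤ p ^ m * D := by
  rw [ghostComponent_apply, aeval_wittPolynomial]
  refine totalDegree_finsetSum_le fun i hi => ?_
  have him := Finset.mem_range_succ_iff.mp hi
  rw [← map_natCast (C (R := ℤ) (σ := σ)), ← map_pow]
  refine (totalDegree_mul _ _).trans ?_
  rw [totalDegree_C, zero_add]
  calc _ ≤ p ^ (m - i) * (F.coeff i).totalDegree := totalDegree_pow _ _
    _ ≤ p ^ (m - i) * (p ^ i * D) := Nat.mul_le_mul_left _ (hF i)
    _ = p ^ m * D := by rw [← mul_assoc, ← pow_add, Nat.sub_add_cancel him]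

theorem totalDegree_coeff_aeval_le {σ τ : Type*} (Y : σ → WittVector p (MvPolynomial τ ℤ))
    (hY : ∀ j m, ((Y j).coeff m).totalDegree ≤ p ^ m) (f : MvPolynomial σ ℤ) (m : ℕ) :
    ((MvPolynomial.aeval Y f).coeff m).totalDegree ≤ p ^ m * f.totalDegree := by
  refine totalDegree_coeff_le _ _ (fun m => ?_) m
  have h : ghostComponent m (MvPolynomial.aeval Y f) =
      MvPolynomial.aeval (fun j => ghostComponent m (Y j)) f := by
    rw [MvPolynomial.aeval_def, MvPolynomial.hom_eval₂, MvPolynomial.aeval_def]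
    congr 1
    exact RingHom.ext_int _ _
  rw [h]
  refine MvPolynomial.totalDegree_aeval_le_s12 _ _ (fun j => ?_) f
  simpa using totalDegree_ghostComponent_le (Y j) 1 (by simpa using hY j) m

theorem pow_dvd_iff_coeff_intCast_eq_zero (v : ℕ) (z : ℤ) :
    (p : ℤ) ^ v ∣ z ↔ ∀ i < v, (z : WittVector p (ZMod p)).coeff i = 0 := by
  have := TruncatedWittVector.charP_zmod p v
  rw [← mem_ker_truncate, RingHom.mem_ker, map_intCast,
    CharP.intCast_eq_zero_iff (TruncatedWittVector p v (ZMod p)) (p ^ v), Nat.cast_pow]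

theorem coeff_zero_intCast {R : Type*} [CommRing R] (z : ℤ) :
    (z : WittVector p R).coeff 0 = z :=
  map_intCast (constantCoeff (p := p) (R := R)) z

open MvPolynomial in
/-- A section `r` of the reduction map `ℤ → ZMod p` is given by a Witt vector of integer
polynomials whose `m`-th coefficient has degree at most `p ^ m`. -/
theorem exists_map_eq_intCast_section {σ : Type*} (i : σ) (r : ZMod p → ℤ)
    (hr : ∀ c, (r c : ZMod p) = c) :
    ∃ Y : WittVector p (MvPolynomial σ ℤ), (∀ m, (Y.coeff m).totalDegree ≤ p ^ m) ∧
      ∀ c : σ → ZMod p, map (eval₂Hom (Int.castRingHom (ZMod p)) c) Y = r (c i) := by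
  have h : ∀ m, ∃ q : MvPolynomial σ ℤ, q.totalDegree ≤ p ^ m ∧
      ∀ c : σ → ZMod p, eval₂ (Int.castRingHom (ZMod p)) c q =
        (r (c i) : WittVector p (ZMod p)).coeff m := by
    rintro (_ | m)
    · exact ⟨X i, by simp, fun c => by rw [eval₂_X, coeff_zero_intCast, hr]⟩
    · obtain ⟨q, hq, hq'⟩ := exists_eval₂_intCast_eq p i
        fun c => (r c : WittVector p (ZMod p)).coeff (m + 1)
      exact ⟨q, hq.trans ((Nat.sub_le _ _).trans (Nat.le_self_pow m.succ_ne_zero p)), hq'⟩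
  choose q hq hq' using h
  refine ⟨mk p q, hq, fun c => ?_⟩
  ext m
  exact hq' m c

end WittVector

/-- **Schanuel's Lemma**: let each `A_i ⊆ ℤ` be a complete set of coset representatives
of `pℤ` in `ℤ`, and let `f ∈ ℤ[t₁,…,t_n]` be nonzero of degree `d`. Then there are
polynomials `f₁,…,f_v` over `𝔽_p` with `deg f_i ≤ p^{i-1}·d`, such that for all
`x ∈ ∏ A_i`: `f(x) ≡ 0 (mod p^v)` iff `f_i(x mod p) = 0` for all `i`. -/
theorem schanuel_lemma
    (p : ℕ) (hp : p.Prime) (n v : ℕ) (hn : 0 < n) (hv : 0 < v)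
    (A : Fin n → Set ℤ)
    (hA : ∀ i, ∀ z : ℤ, ∃! a, a ∈ A i ∧ (p : ℤ) ∣ (z - a))
    (f : MvPolynomial (Fin n) ℤ) (hf : f ≠ 0) :
    ∃ g : Fin v → MvPolynomial (Fin n) (ZMod p),
      (∀ i, (g i).totalDegree ≤ p ^ (i : ℕ) * f.totalDegree) ∧
      ∀ x : Fin n → ℤ, (∀ i, x i ∈ A i) →
        (((p : ℤ) ^ v ∣ MvPolynomial.eval x f) ↔
          ∀ i, MvPolynomial.eval (fun j => ((x j : ZMod p))) (g i) = 0) := by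
  have := Fact.mk hp
  have hr : ∀ i, ∃ r : ZMod p → ℤ, (∀ c, (r c : ZMod p) = c) ∧ ∀ x ∈ A i, r x = x := by
    intro i
    choose r hr using fun c : ZMod p => hA i c.val
    have hrc : ∀ c, (r c : ZMod p) = c := fun c => by
      have h := (ZMod.intCast_zmod_eq_zero_iff_dvd _ _).mpr (hr c).1.2
      simpa [sub_eq_zero, eq_comm] using h
    refine ⟨r, hrc, fun x hx => ((hr x).2 x ⟨hx, ?_⟩).symm⟩
    simp [← ZMod.intCast_zmod_eq_zero_iff_dvd]
  choose r hrc hrA using hr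
  choose Y hY hYr using fun i => WittVector.exists_map_eq_intCast_section (p := p) i (r i) (hrc i)
  refine ⟨fun m => MvPolynomial.map (Int.castRingHom (ZMod p))
    ((MvPolynomial.aeval Y f).coeff m), fun m => ?_, fun x hx => ?_⟩
  · exact (Finset.sup_mono (MvPolynomial.support_map_subset _ _)).trans
      (WittVector.totalDegree_coeff_aeval_le Y hY f m)
  · have h : WittVector.map (MvPolynomial.eval₂Hom (Int.castRingHom (ZMod p))
        fun j => (x j : ZMod p)) (MvPolynomial.aeval Y f) =
        (MvPolynomial.eval x f : WittVector p (ZMod p)) := by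
      rw [MvPolynomial.aeval_def, MvPolynomial.hom_eval₂, ← eq_intCast (Int.castRingHom _),
        ← MvPolynomial.eval₂_id, MvPolynomial.hom_eval₂]
      congr 1
      · exact RingHom.ext_int _ _
      · funext j
        simp [hYr, hrA j _ (hx j)]
    rw [WittVector.pow_dvd_iff_coeff_intCast_eq_zero, ← h, Fin.forall_iff]
    simp only [WittVector.map_coeff, MvPolynomial.eval_map, MvPolynomial.coe_eval₂Hom]
end

section
/- Let K be a number field with ring of integers R, let 𝔭 be a nonzero prime ideal of R, let q = #(R/𝔭), and let R_𝔭 be the localization of R at 𝔭. Let n be a positive integer and for 1 ≤ i ≤ n let A_i be a nonempty finite subset of R whose elements are pairwise incongruent modulo 𝔭; put A = Π_{i=1}^n A_i. Let f ∈ R_𝔭[t_1,…,t_n] be a nonzero polynomial of degree d and let v be a positive integer. Then there exist polynomials g_0, g_1, …, g_{v−1} ∈ R_𝔭[t_1,…,t_n] with deg g_i ≤ q^i·d for each i, such that for all a ∈ A: f(a) ∈ 𝔭^v R_𝔭 if and only if g_i(a) ∈ 𝔭R_𝔭 for all 0 ≤ i ≤ v−1. -/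
open MvPolynomial in
/-- Substituting polynomials of total degree at most `q` multiplies the total degree by at most
`q`. -/
theorem MvPolynomial.totalDegree_bind₁_le_mul {σ τ R : Type*} [CommSemiring R] {q : ℕ}
    (s : σ → MvPolynomial τ R) (hs : ∀ i, (s i).totalDegree ≤ q) (f : MvPolynomial σ R) :
    (bind₁ s f).totalDegree ≤ q * f.totalDegree := by
  conv_lhs => rw [f.as_sum, map_sum]
  refine totalDegree_finsetSum_le fun m hm => ?_
  rw [bind₁_monomial]
  refine (totalDegree_mul _ _).trans ?_
  rw [totalDegree_C, zero_add]
  refine (totalDegree_finsetProd _ _).trans ?_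
  calc ∑ i ∈ m.support, (s i ^ m i).totalDegree
      ≤ ∑ i ∈ m.support, q * m i := Finset.sum_le_sum fun i _ =>
        (totalDegree_pow _ _).trans (by rw [mul_comm]; exact Nat.mul_le_mul_right _ (hs i))
    _ = q * m.sum fun _ e => e := by rw [← Finset.mul_sum]; rfl
    _ ≤ q * f.totalDegree := Nat.mul_le_mul_left _ (le_totalDegree hm)

open MvPolynomial in
theorem MvPolynomial.totalDegree_aeval_polynomial_le {σ R : Type*} [CommSemiring R] (i : σ)
    (p : Polynomial R) : (Polynomial.aeval (X i : MvPolynomial σ R) p).totalDegree ≤ p.natDegree := by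
  rw [Polynomial.aeval_eq_sum_range]
  refine totalDegree_finsetSum_le fun k hk => (totalDegree_smul_le _ _).trans ?_
  rw [X_pow_eq_monomial]
  refine (totalDegree_monomial_le _ _).trans ?_
  rw [Finsupp.sum_single_index rfl]
  exact Nat.lt_succ_iff.mp (Finset.mem_range.mp hk)

open Polynomial in
/-- Interpolation over a commutative ring at nodes whose pairwise differences are units. -/
theorem Polynomial.exists_interpolation_of_isUnit_sub {ι S : Type*} [CommRing S]
    (s : Finset ι) (u r : ι → S)
    (hu : ∀ a ∈ s, ∀ b ∈ s, a ≠ b → IsUnit (u a - u b)) :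
    ∃ L : S[X], L.natDegree ≤ s.card ∧ ∀ a ∈ s, L.eval (u a) = r a := by
  classical
  induction s using Finset.induction_on with
  | empty => exact ⟨0, by simp, by simp⟩
  | insert a s ha ih =>
    obtain ⟨L, hL, hLe⟩ := ih fun b hb c hc =>
      hu b (Finset.mem_insert_of_mem hb) c (Finset.mem_insert_of_mem hc)
    have hunit : IsUnit (∏ b ∈ s, (u a - u b)) := by
      refine IsUnit.prod_iff.mpr fun b hb => hu a (Finset.mem_insert_self a s) b
        (Finset.mem_insert_of_mem hb) ?_
      rintro rfl
      exact ha hb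
    obtain ⟨w, hw⟩ := hunit.exists_left_inv
    refine ⟨L + C ((r a - L.eval (u a)) * w) * ∏ b ∈ s, (X - C (u b)), ?_, ?_⟩
    · rw [Finset.card_insert_of_notMem ha]
      refine natDegree_add_le_of_degree_le (hL.trans (Nat.le_succ _)) ?_
      refine (natDegree_C_mul_le _ _).trans ((natDegree_prod_le _ _).trans ?_)
      refine (Finset.sum_le_card_nsmul s _ 1 fun b _ => natDegree_X_sub_C_le (u b)).trans ?_
      simp
    · intro c hc
      rcases Finset.mem_insert.mp hc with rfl | hc
      · simp only [eval_add, eval_mul, eval_C, eval_prod, eval_sub, eval_X]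
        rw [mul_assoc, hw]
        ring
      · have h0 : ∏ b ∈ s, (u c - u b) = 0 := Finset.prod_eq_zero hc (sub_self _)
        simp [eval_prod, h0, hLe c hc]

section SchanuelBrink

open IsLocalRing MvPolynomial

variable {S : Type*} [CommRing S] [IsLocalRing S]

theorem MvPolynomial.C_dvd_of_map_residue_eq_zero {σ : Type*} {π : S}
    (hπ : maximalIdeal S = Ideal.span {π}) {f : MvPolynomial σ S} (hf : map (residue S) f = 0) :
    C π ∣ f := by
  rw [C_dvd_iff_dvd_coeff]
  intro m
  rw [← Ideal.mem_span_singleton, ← hπ, ← residue_eq_zero_iff, ← coeff_map, hf, coeff_zero]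

variable [Finite (ResidueField S)]

theorem IsLocalRing.residue_pow_card (c : S) :
    residue S c ^ Nat.card (ResidueField S) = residue S c := by
  have := Fintype.ofFinite (ResidueField S)
  rw [Nat.card_eq_fintype_card]
  exact FiniteField.pow_card _

theorem IsLocalRing.dvd_pow_card_sub {π : S} (hπ : maximalIdeal S = Ideal.span {π}) (c : S) :
    π ∣ c ^ Nat.card (ResidueField S) - c := by
  rw [← Ideal.mem_span_singleton, ← hπ, ← residue_eq_zero_iff, map_sub, map_pow,
    residue_pow_card, sub_self]

/-- If `s` reduces to the `q`-th power substitution, then `f ∘ s` and `f ^ q` have the same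
reduction. -/
theorem MvPolynomial.map_residue_bind₁_eq_pow {σ : Type*} (s : σ → MvPolynomial σ S)
    (hs : ∀ i, map (residue S) (s i) = X i ^ Nat.card (ResidueField S)) (f : MvPolynomial σ S) :
    map (residue S) (bind₁ s f) = map (residue S) f ^ Nat.card (ResidueField S) := by
  have := Fintype.ofFinite (ResidueField S)
  obtain ⟨p, hp, m, hpp, hcard⟩ := FiniteField.card' (ResidueField S)
  rw [← Nat.card_eq_fintype_card] at hcard
  have : Fact p.Prime := ⟨hpp⟩
  have : ExpChar (MvPolynomial σ (ResidueField S)) p := inferInstance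
  have key : (map (residue S)).comp (bind₁ s).toRingHom =
      (iterateFrobenius (MvPolynomial σ (ResidueField S)) p m).comp (map (residue S)) := by
    refine ringHom_ext (fun c => ?_) fun i => ?_
    · simp only [RingHom.comp_apply, AlgHom.toRingHom_eq_coe, RingHom.coe_coe, bind₁_C_right,
        map_C, iterateFrobenius_def]
      rw [← hcard, ← C_pow, residue_pow_card]
    · simp [iterateFrobenius_def, hs, ← hcard]
  have := DFunLike.congr_fun key f
  simpa [iterateFrobenius_def, ← hcard] using this

/-- A lift of the `q`-th power substitution, of degree at most `q`, fixing a finite set of points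
that are pairwise incongruent modulo the maximal ideal. -/
theorem IsLocalRing.exists_frobenius_lift_fixing {ι σ : Type*} {π : S}
    (hπ : maximalIdeal S = Ideal.span {π}) (A : σ → Finset ι) (u : ι → S)
    (hu : ∀ i, ∀ a ∈ A i, ∀ b ∈ A i, a ≠ b → IsUnit (u a - u b)) :
    ∃ s : σ → MvPolynomial σ S,
      (∀ i, (s i).totalDegree ≤ Nat.card (ResidueField S)) ∧
      (∀ i, map (residue S) (s i) = X i ^ Nat.card (ResidueField S)) ∧
      ∀ x : σ → ι, (∀ i, x i ∈ A i) → ∀ i, eval (fun j => u (x j)) (s i) = u (x i) := by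
  set q := Nat.card (ResidueField S)
  have hcard (i : σ) : (A i).card ≤ q := by
    have hinj : Function.Injective fun a : A i => residue S (u a) := by
      intro a b hab
      by_contra hne
      refine (residue_ne_zero_iff_isUnit _).mpr
        (hu i a a.2 b b.2 fun h => hne (Subtype.ext h)) ?_
      rw [map_sub]
      exact sub_eq_zero.mpr hab
    simpa using Nat.card_le_card_of_injective _ hinj
  choose r hr using fun a => dvd_pow_card_sub hπ (u a)
  choose L hL hLe using fun i => Polynomial.exists_interpolation_of_isUnit_sub (A i) u r (hu i)
  refine ⟨fun i => X i ^ q - C π * Polynomial.aeval (X i) (L i), fun i => ?_, fun i => ?_,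
    fun x hx i => ?_⟩
  · refine (totalDegree_sub _ _).trans (max_le (by rw [totalDegree_X_pow]) ?_)
    refine (totalDegree_mul _ _).trans ?_
    rw [totalDegree_C, zero_add]
    exact (totalDegree_aeval_polynomial_le i (L i)).trans ((hL i).trans (hcard i))
  · have h0 : residue S π = 0 := by
      rw [residue_eq_zero_iff, hπ]
      exact Ideal.mem_span_singleton_self π
    simp [h0]
  · have he : eval (fun j => u (x j)) (Polynomial.aeval (X i) (L i)) = r (x i) := by
      rw [← hLe i (x i) (hx i), Polynomial.aeval_def, Polynomial.hom_eval₂, eval_X]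
      have : (eval fun j => u (x j)).comp (algebraMap S (MvPolynomial σ S)) = RingHom.id S := by
        ext c
        simp [algebraMap_eq]
      rw [this, Polynomial.eval₂_id]
    rw [map_sub, map_mul, map_pow, eval_X, eval_C, he, ← hr]
    ring

variable [IsDomain S]

/-- The Schanuel–Brink operator: a polynomial `g` with `π * g(x) = f(x) - f(x) ^ q` on the given
finite grid. -/
theorem IsLocalRing.exists_schanuelBrink {ι σ : Type*} {π : S} (hπ0 : π ≠ 0)
    (hπ : maximalIdeal S = Ideal.span {π}) (A : σ → Finset ι) (u : ι → S)
    (hu : ∀ i, ∀ a ∈ A i, ∀ b ∈ A i, a ≠ b → IsUnit (u a - u b)) (f : MvPolynomial σ S) :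
    ∃ g : MvPolynomial σ S,
      g.totalDegree ≤ Nat.card (ResidueField S) * f.totalDegree ∧
      ∀ x : σ → ι, (∀ i, x i ∈ A i) →
        eval (fun j => u (x j)) f - eval (fun j => u (x j)) f ^ Nat.card (ResidueField S) =
          π * eval (fun j => u (x j)) g := by
  obtain ⟨s, hdeg, hmap, hfix⟩ := exists_frobenius_lift_fixing hπ A u hu
  obtain ⟨g, hg⟩ : C π ∣ bind₁ s f - f ^ Nat.card (ResidueField S) :=
    C_dvd_of_map_residue_eq_zero hπ (by
      rw [map_sub, map_residue_bind₁_eq_pow s hmap, map_pow, sub_self])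
  refine ⟨g, ?_, fun x hx => ?_⟩
  · have hle : (C π * g).totalDegree ≤ Nat.card (ResidueField S) * f.totalDegree := by
      rw [← hg]
      exact (totalDegree_sub _ _).trans
        (max_le (totalDegree_bind₁_le_mul s hdeg f) (totalDegree_pow _ _))
    rcases eq_or_ne g 0 with rfl | hg0
    · simp
    · rwa [totalDegree_mul_of_isDomain (C_ne_zero.mpr hπ0) hg0, totalDegree_C, zero_add] at hle
  · have hs : eval (fun j => u (x j)) (bind₁ s f) = eval (fun j => u (x j)) f := by
      rw [← aeval_eq_eval, aeval_bind₁]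
      congr 2
      funext i
      exact hfix x hx i
    rw [← hs, ← eval_C (f := fun j => u (x j)) π, ← map_mul, ← hg, map_sub, map_pow, hs]

theorem IsLocalRing.mem_maximalIdeal_pow_succ_iff {π : S} (hπ0 : π ≠ 0)
    (hπ : maximalIdeal S = Ideal.span {π}) {a b : S}
    (h : a - a ^ Nat.card (ResidueField S) = π * b) (v : ℕ) :
    a ∈ maximalIdeal S ^ (v + 1) ↔ a ∈ maximalIdeal S ∧ b ∈ maximalIdeal S ^ v := by
  have hq : 1 < Nat.card (ResidueField S) := Finite.one_lt_card
  have key (ha : a ∈ maximalIdeal S) :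
      a ∈ maximalIdeal S ^ (v + 1) ↔ b ∈ maximalIdeal S ^ v := by
    have hunit : IsUnit (1 - a ^ (Nat.card (ResidueField S) - 1)) :=
      isUnit_one_sub_self_of_mem_nonunits _
        ((mem_maximalIdeal _).mp (Ideal.pow_mem_of_mem _ ha _ (by omega)))
    have hfac : a * (1 - a ^ (Nat.card (ResidueField S) - 1)) = π * b := by
      rw [← h, mul_sub, mul_one, ← pow_succ', Nat.sub_add_cancel hq.le]
    simp only [hπ, Ideal.span_singleton_pow, Ideal.mem_span_singleton]
    rw [← hunit.dvd_mul_right, hfac, pow_succ', mul_dvd_mul_iff_left hπ0]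
  exact ⟨fun ha => have ha' := Ideal.pow_le_self (Nat.succ_ne_zero v) ha
    ⟨ha', (key ha').mp ha⟩, fun ha => (key ha.1).mpr ha.2⟩

theorem IsLocalRing.exists_schanuelBrink_iterates {ι σ : Type*} {π : S} (hπ0 : π ≠ 0)
    (hπ : maximalIdeal S = Ideal.span {π}) (A : σ → Finset ι) (u : ι → S)
    (hu : ∀ i, ∀ a ∈ A i, ∀ b ∈ A i, a ≠ b → IsUnit (u a - u b)) (v : ℕ)
    (f : MvPolynomial σ S) :
    ∃ g : Fin v → MvPolynomial σ S,
      (∀ i, (g i).totalDegree ≤ Nat.card (ResidueField S) ^ (i : ℕ) * f.totalDegree) ∧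
      ∀ x : σ → ι, (∀ i, x i ∈ A i) →
        (eval (fun j => u (x j)) f ∈ maximalIdeal S ^ v ↔
          ∀ i : Fin v, eval (fun j => u (x j)) (g i) ∈ maximalIdeal S) := by
  induction v generalizing f with
  | zero => exact ⟨Fin.elim0, fun i => i.elim0, by simp⟩
  | succ v ih =>
    obtain ⟨f', hdeg', hf'⟩ := exists_schanuelBrink hπ0 hπ A u hu f
    obtain ⟨g, hdeg, hg⟩ := ih f'
    refine ⟨Fin.cons f g, fun i => ?_, fun x hx => ?_⟩
    · refine Fin.cases (by simp) (fun i => ?_) i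
      rw [Fin.cons_succ, Fin.val_succ, pow_succ, mul_assoc]
      exact (hdeg i).trans (Nat.mul_le_mul_left _ hdeg')
    · rw [mem_maximalIdeal_pow_succ_iff hπ0 hπ (hf' x hx), hg x hx, Fin.forall_fin_succ]
      simp

end SchanuelBrink


/-- **Iterated Schanuel–Brink operator** (corollary of the Schanuel–Brink construction):
for `f ∈ R_𝔭[t₁,…,t_n]` nonzero of degree `d` and `v ≥ 1`, there are polynomials
`g₀,…,g_{v-1} ∈ R_𝔭[t₁,…,t_n]` with `deg g_i ≤ q^i·d` such that for all `a ∈ ∏ A_i`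
(the `A_i` being nonempty finite subsets of `R` pairwise incongruent mod `𝔭`):
`f(a) ∈ 𝔭^v R_𝔭` iff `g_i(a) ∈ 𝔭 R_𝔭` for all `0 ≤ i ≤ v-1`. -/
theorem schanuel_brink_iterates
    (K : Type*) [Field K] [NumberField K]
    (𝔭 : Ideal (NumberField.RingOfIntegers K)) [𝔭.IsPrime] (h𝔭 : 𝔭 ≠ ⊥)
    (q : ℕ) (hq : q = Nat.card (NumberField.RingOfIntegers K ⧸ 𝔭))
    (n : ℕ) (hn : 0 < n)
    (A : Fin n → Finset (NumberField.RingOfIntegers K)) (hA : ∀ i, (A i).Nonempty)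
    (hAp : ∀ i, ∀ a ∈ A i, ∀ b ∈ A i, a - b ∈ 𝔭 → a = b)
    (f : MvPolynomial (Fin n) (Localization.AtPrime 𝔭)) (hf : f ≠ 0)
    (v : ℕ) (hv : 0 < v) :
    ∃ g : Fin v → MvPolynomial (Fin n) (Localization.AtPrime 𝔭),
      (∀ i, (g i).totalDegree ≤ q ^ (i : ℕ) * f.totalDegree) ∧
      ∀ x : Fin n → NumberField.RingOfIntegers K, (∀ i, x i ∈ A i) →
        (MvPolynomial.eval
            (fun i => algebraMap (NumberField.RingOfIntegers K) (Localization.AtPrime 𝔭) (x i)) f ∈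
            (𝔭.map (algebraMap (NumberField.RingOfIntegers K) (Localization.AtPrime 𝔭))) ^ v ↔
          ∀ i : Fin v, MvPolynomial.eval
            (fun j => algebraMap (NumberField.RingOfIntegers K) (Localization.AtPrime 𝔭) (x j)) (g i) ∈
            𝔭.map (algebraMap (NumberField.RingOfIntegers K) (Localization.AtPrime 𝔭))) := by
  have hmax : 𝔭.IsMaximal := Ring.DimensionLEOne.maximalOfPrime h𝔭 inferInstance
  have : IsDiscreteValuationRing (Localization.AtPrime 𝔭) :=
    IsLocalization.AtPrime.isDiscreteValuationRing_of_dedekind_domain _ h𝔭 _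
  let e := IsLocalization.AtPrime.equivQuotMaximalIdeal 𝔭 (Localization.AtPrime 𝔭)
  have : Finite (NumberField.RingOfIntegers K ⧸ 𝔭) := Ideal.finiteQuotientOfFreeOfNeBot 𝔭 h𝔭
  have : Finite (IsLocalRing.ResidueField (Localization.AtPrime 𝔭)) := Finite.of_equiv _ e.toEquiv
  have hcard : q = Nat.card (IsLocalRing.ResidueField (Localization.AtPrime 𝔭)) :=
    hq.trans (Nat.card_congr e.toEquiv)
  obtain ⟨π, hπ⟩ := IsDiscreteValuationRing.exists_irreducible (Localization.AtPrime 𝔭)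
  rw [hcard, Localization.AtPrime.map_eq_maximalIdeal]
  refine IsLocalRing.exists_schanuelBrink_iterates hπ.ne_zero
    ((IsDiscreteValuationRing.irreducible_iff_uniformizer π).mp hπ) A
    (algebraMap (NumberField.RingOfIntegers K) (Localization.AtPrime 𝔭))
    (fun i a ha b hb hab => ?_) v f
  rw [← map_sub]
  exact (IsLocalization.AtPrime.isUnit_to_map_iff _ 𝔭 _).mpr
    fun h => hab (hAp i a ha b hb h)
end

section
/- Let p be a prime, let r and v_1,…,v_r be positive integers, and let G = ⊕_{j=1}^r ℤ/p^{v_j}ℤ. Let n be a positive integer and for 1 ≤ i ≤ n let A_i be a nonempty finite subset of ℤ whose elements are pairwise incongruent modulo p; put A = Π_{i=1}^n A_i. Assume Σ_{i=1}^n (#A_i − 1) > Σ_{j=1}^r (p^{v_j} − 1). Let x = (x_1,…,x_n) ∈ G^n. Then: a) #{(a_1,…,a_n) ∈ A : a_1·x_1 + … + a_n·x_n = 0 in G} ≠ 1; b) if moreover 0 ∈ A_i for all i, then there exists a = (a_1,…,a_n) ∈ A with a ≠ (0,…,0) and a_1·x_1 + … + a_n·x_n = 0 in G. -/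
open Finset in
/-- A multivariate version of the vanishing of divided differences: the top-order divided difference
over the grid `∏ S i` kills every polynomial of total degree less than `∑ (#(S i) - 1)`. -/
theorem MvPolynomial.sum_piFinset_eval_div_eq_zero {F σ ι : Type*} [Field F] [Fintype σ]
    [DecidableEq σ] [DecidableEq ι] (S : σ → Finset ι) (u : ι → F)
    (hu : ∀ i, Set.InjOn u (S i)) (P : MvPolynomial σ F)
    (hP : P.totalDegree < ∑ i, (#(S i) - 1)) :
    ∑ a ∈ Fintype.piFinset S,
      eval (fun i ↦ u (a i)) P / ∏ i, ∏ b ∈ (S i).erase (a i), (u (a i) - u b) = 0 := by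
  simp_rw [eval_eq', sum_div]
  rw [sum_comm]
  refine sum_eq_zero fun d hd ↦ ?_
  have hlt : ∑ i, d i < ∑ i, (#(S i) - 1) := by
    refine lt_of_le_of_lt ?_ hP
    have h := le_totalDegree hd
    rwa [Finsupp.sum_fintype _ _ (fun _ ↦ rfl)] at h
  obtain ⟨i, -, hi⟩ := exists_lt_of_sum_lt hlt
  have hzero : ∑ x ∈ S i, u x ^ d i / ∏ b ∈ (S i).erase x, (u x - u b) = 0 := by
    have hdeg : (Polynomial.X ^ d i : Polynomial F).degree < #(S i) := by
      rw [Polynomial.degree_X_pow]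
      exact_mod_cast (by omega : d i < #(S i))
    have h := Lagrange.coeff_eq_sum (hu i) hdeg
    simp only [Polynomial.eval_pow, Polynomial.eval_X] at h
    rw [← h, Polynomial.coeff_X_pow, if_neg (by omega)]
  simp_rw [mul_div_assoc, ← mul_sum, ← prod_div_distrib]
  rw [← prod_univ_sum S (fun i x ↦ u x ^ d i / ∏ b ∈ (S i).erase x, (u x - u b)),
    prod_eq_zero (mem_univ i) hzero, mul_zero]

theorem Ring.factorial_mul_choose_sub_one (m : ℤ) (k : ℕ) :
    (k.factorial : ℤ) * Ring.choose (m - 1) k = ∏ i ∈ Finset.range k, (m - ((i : ℤ) + 1)) := by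
  rw [← nsmul_eq_mul, ← Ring.descPochhammer_eq_factorial_smul_choose,
    ← Polynomial.eval_eq_smeval, descPochhammer_eval_eq_prod_range]
  exact Finset.prod_congr rfl fun i _ ↦ by ring

/-- The integer-valued polynomial `m ↦ (m - 1).choose (p ^ v - 1)` is, modulo `p`, supported on
the multiples of `p ^ v`. -/
theorem Ring.prime_dvd_choose_sub_one_iff {p : ℕ} [Fact p.Prime] (v : ℕ) (m : ℤ) :
    (p : ℤ) ∣ Ring.choose (m - 1) (p ^ v - 1) ↔ ¬ ((p ^ v : ℕ) : ℤ) ∣ m := by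
  have hp : p.Prime := Fact.out
  have hq : 0 < p ^ v := pow_pos hp.pos v
  constructor
  · intro h hm
    have hnorm : ‖((p ^ v - 1).factorial : ℚ_[p])‖ * ‖((Ring.choose (m - 1) (p ^ v - 1) : ℤ) : ℚ_[p])‖
        = ‖((p ^ v - 1).factorial : ℚ_[p])‖ := by
      rw [← norm_mul]
      have h1 := congrArg (Int.cast : ℤ → ℚ_[p]) (factorial_mul_choose_sub_one m (p ^ v - 1))
      push_cast at h1
      rw [h1, ← Finset.prod_range_add_one_eq_factorial]
      push_cast
      rw [norm_prod, norm_prod]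
      refine Finset.prod_congr rfl fun i hi ↦ ?_
      have hm' := (Padic.norm_int_le_pow_iff_dvd (p := p) m v).2 (by exact_mod_cast hm)
      have hi' : ¬ ‖(((i : ℤ) + 1 : ℤ) : ℚ_[p])‖ ≤ (p : ℝ) ^ (-v : ℤ) := by
        rw [Padic.norm_int_le_pow_iff_dvd]
        intro hd
        have hle : p ^ v ≤ i + 1 := by exact_mod_cast Int.le_of_dvd (by positivity) hd
        have hlt := Finset.mem_range.1 hi
        omega
      push_cast at hi'
      have hlt := lt_of_le_of_lt hm' (not_le.1 hi')
      rw [sub_eq_add_neg, Padic.add_eq_max_of_ne (by rw [norm_neg]; exact hlt.ne), norm_neg,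
        max_eq_right hlt.le]
    have hlt := (Padic.norm_intCast_lt_one_iff (p := p)).2 h
    have hne : ‖((p ^ v - 1).factorial : ℚ_[p])‖ ≠ 0 := by
      simpa using Nat.factorial_ne_zero _
    exact hlt.ne ((mul_eq_left₀ hne).1 hnorm)
  · intro hm
    by_contra h
    refine hm (IsCoprime.dvd_of_dvd_mul_right (z := Ring.choose (m - 1) (p ^ v - 1)) ?_ ?_)
    · push_cast
      exact ((Nat.prime_iff_prime_int.1 hp).coprime_iff_not_dvd.2 h).pow_left
    · have key := Ring.choose_smul_choose m (n := p ^ v) (k := 1) hq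
      rw [Nat.choose_one_right, Ring.choose_one_right, nsmul_eq_mul] at key
      exact ⟨_, by simpa using key.symm⟩

open Finset in
/-- The number of points of a grid satisfying a system of integer linear congruences modulo
powers of `p` is not one, when the grid is large. -/
theorem card_filter_linear_congruences_ne_one {p : ℕ} [Fact p.Prime] {σ κ : Type*}
    [Fintype σ] [DecidableEq σ] [Fintype κ] (v : κ → ℕ) (A : σ → Finset ℤ)
    (hA : ∀ i, ∀ a ∈ A i, ∀ b ∈ A i, (p : ℤ) ∣ a - b → a = b)
    (hbig : ∑ j, (p ^ v j - 1) < ∑ i, (#(A i) - 1)) (y : σ → κ → ℤ) :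
    #{a ∈ Fintype.piFinset A | ∀ j, ((p ^ v j : ℕ) : ℤ) ∣ ∑ i, a i * y i j} ≠ 1 := by
  intro hcard
  obtain ⟨a₀, ha₀⟩ := card_eq_one.1 hcard
  have hmem : ∀ a, a ∈ Fintype.piFinset A ∧
      (∀ j, ((p ^ v j : ℕ) : ℤ) ∣ ∑ i, a i * y i j) ↔ a = a₀ := fun a ↦ by
    have h := Finset.ext_iff.1 ha₀ a
    rwa [mem_filter, mem_singleton] at h
  let c : (σ → ℤ) → ℤ := fun a ↦ ∏ j, Ring.choose (∑ i, a i * y i j - 1) (p ^ v j - 1)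
  let w : (σ → ℤ) → ℚ_[p] := fun a ↦
    ∏ i, ∏ b ∈ (A i).erase (a i), (((a i : ℤ) : ℚ_[p]) - (b : ℚ_[p]))
  have hw : ∀ a ∈ Fintype.piFinset A, ‖w a‖ = 1 := by
    intro a ha
    simp only [w, norm_prod]
    refine prod_eq_one fun i _ ↦ prod_eq_one fun b hb ↦ ?_
    rw [mem_erase] at hb
    rw [← Int.cast_sub]
    refine le_antisymm (Padic.norm_int_le_one _) (not_lt.1 fun h ↦ hb.1 ?_)
    exact (hA i _ (Fintype.mem_piFinset.1 ha i) _ hb.2 (Padic.norm_intCast_lt_one_iff.1 h)).symm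
  have hc : ∀ a ∈ Fintype.piFinset A, ‖(c a : ℚ_[p])‖ < 1 ↔ a ≠ a₀ := by
    intro a ha
    rw [Padic.norm_intCast_lt_one_iff,
      (Nat.prime_iff_prime_int.1 (Fact.out : p.Prime)).dvd_finsetProd_iff]
    simp only [mem_univ, true_and, Ring.prime_dvd_choose_sub_one_iff, ← hmem a, ne_eq, ha,
      not_forall]
  let P : MvPolynomial σ ℚ_[p] := ∏ j, ∏ k ∈ range (p ^ v j - 1),
    (∑ i, MvPolynomial.X i * MvPolynomial.C (y i j : ℚ_[p]) -
      MvPolynomial.C ((k : ℚ_[p]) + 1))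
  have hPdeg : P.totalDegree ≤ ∑ j, (p ^ v j - 1) := by
    refine (MvPolynomial.totalDegree_finsetProd _ _).trans (sum_le_sum fun j _ ↦ ?_)
    refine (MvPolynomial.totalDegree_finsetProd _ _).trans ?_
    refine (sum_le_card_nsmul _ _ 1 fun k _ ↦ ?_).trans (by simp)
    refine (MvPolynomial.totalDegree_sub_C_le _ _).trans ?_
    refine MvPolynomial.totalDegree_finsetSum_le fun i _ ↦ ?_
    refine (MvPolynomial.totalDegree_mul _ _).trans ?_
    rw [MvPolynomial.totalDegree_X, MvPolynomial.totalDegree_C]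
  have hPeval : ∀ a : σ → ℤ, MvPolynomial.eval (fun i ↦ (a i : ℚ_[p])) P =
      (∏ j, ((p ^ v j - 1).factorial : ℚ_[p])) * (c a : ℚ_[p]) := by
    intro a
    simp only [P, c, map_prod, map_sub, map_sum, map_mul, MvPolynomial.eval_X,
      MvPolynomial.eval_C, Int.cast_prod, ← prod_mul_distrib]
    refine prod_congr rfl fun j _ ↦ ?_
    have h := congrArg (Int.cast : ℤ → ℚ_[p])
      (Ring.factorial_mul_choose_sub_one (∑ i, a i * y i j) (p ^ v j - 1))
    push_cast at h
    exact h.symm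
  have hsum := MvPolynomial.sum_piFinset_eval_div_eq_zero A (Int.cast : ℤ → ℚ_[p])
    (fun i ↦ Int.cast_injective.injOn) P (hPdeg.trans_lt hbig)
  have hfac : (∏ j, ((p ^ v j - 1).factorial : ℚ_[p])) ≠ 0 :=
    prod_ne_zero_iff.2 fun j _ ↦ Nat.cast_ne_zero.2 (Nat.factorial_ne_zero _)
  simp_rw [hPeval, mul_div_assoc] at hsum
  rw [← mul_sum] at hsum
  replace hsum : ∑ a ∈ Fintype.piFinset A, (c a : ℚ_[p]) / w a = 0 :=
    (mul_eq_zero.1 hsum).resolve_left hfac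
  have ha₀A : a₀ ∈ Fintype.piFinset A := ((hmem a₀).2 rfl).1
  rw [← add_sum_erase _ _ ha₀A] at hsum
  have hrest : ‖∑ a ∈ (Fintype.piFinset A).erase a₀, (c a : ℚ_[p]) / w a‖ < 1 := by
    rcases ((Fintype.piFinset A).erase a₀).eq_empty_or_nonempty with he | he
    · simp [he]
    refine (he.norm_sum_le_sup'_norm _).trans_lt ((sup'_lt_iff he).2 fun a ha ↦ ?_)
    rw [mem_erase] at ha
    rw [norm_div, hw a ha.2, div_one]
    exact (hc a ha.2).2 ha.1
  have hmain : ¬ ‖(c a₀ : ℚ_[p]) / w a₀‖ < 1 := by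
    rw [norm_div, hw a₀ ha₀A, div_one, hc a₀ ha₀A]
    simp
  rw [eq_neg_of_add_eq_zero_left hsum, norm_neg] at hmain
  exact hmain hrest


/-- **Brink's theorem on generalized zero-sum subsequences** in a finite commutative
`p`-group `G = ⊕_j ℤ/p^{v_j}ℤ`: if `∑_i (#A_i - 1) > ∑_j (p^{v_j} - 1)` then
a) the number of `a ∈ ∏ A_i` with `∑ a_i·x_i = 0` is not `1`; and
b) if `0 ∈ A_i` for all `i`, there is a nonzero such `a`. -/
theorem brink_generalized_zero_sum
    (p : ℕ) (hp : p.Prime) (r : ℕ) (hr : 0 < r)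
    (v : Fin r → ℕ) (hv : ∀ j, 0 < v j)
    (n : ℕ) (hn : 0 < n)
    (A : Fin n → Finset ℤ) (hA : ∀ i, (A i).Nonempty)
    (hAp : ∀ i, ∀ a ∈ A i, ∀ b ∈ A i, (p : ℤ) ∣ (a - b) → a = b)
    (hbig : ∑ j, (p ^ v j - 1) < ∑ i, ((A i).card - 1))
    (x : Fin n → (∀ j : Fin r, ZMod (p ^ v j))) :
    (Set.ncard {a : Fin n → ℤ | (∀ i, a i ∈ A i) ∧ ∑ i, a i • x i = 0} ≠ 1) ∧
    ((∀ i, (0 : ℤ) ∈ A i) →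
      ∃ a : Fin n → ℤ, (∀ i, a i ∈ A i) ∧ a ≠ 0 ∧ ∑ i, a i • x i = 0) := by
  have : Fact p.Prime := ⟨hp⟩
  have : ∀ j, NeZero (p ^ v j) := fun j ↦ ⟨pow_ne_zero _ hp.ne_zero⟩
  have hset : {a : Fin n → ℤ | (∀ i, a i ∈ A i) ∧ ∑ i, a i • x i = 0} =
      ↑(Finset.filter (fun a : Fin n → ℤ ↦
        ∀ j, ((p ^ v j : ℕ) : ℤ) ∣ ∑ i, a i * ((x i j).val : ℤ)) (Fintype.piFinset A)) := by
    ext a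
    simp only [Set.mem_ofPred_eq, Finset.coe_filter, Fintype.mem_piFinset, funext_iff,
      ← ZMod.intCast_zmod_eq_zero_iff_dvd]
    simp
  have hcard : Set.ncard {a : Fin n → ℤ | (∀ i, a i ∈ A i) ∧ ∑ i, a i • x i = 0} ≠ 1 := by
    rw [hset, Set.ncard_coe_finset]
    convert! card_filter_linear_congruences_ne_one v A hAp hbig fun i j ↦ ((x i j).val : ℤ)
  refine ⟨hcard, fun h0 ↦ ?_⟩
  by_contra! hne
  refine hcard (Set.ncard_eq_one.2 ⟨0, Set.eq_singleton_iff_unique_mem.2 ⟨⟨h0, by simp⟩, ?_⟩⟩)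
  intro a ha
  by_contra ha0
  exact hne a ha.1 ha0 ha.2
end
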